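/- Let K > 1, a > 0, C₀ ≥ 1, m₀ ∈ ℝ, q₀ = m₀/π, M > 0. Let f : ℝ × (K, ∞) → ℝ be C², 2π-periodic in its first variable τ, with ‖f‖_{C²} ≤ C₀, 1/C₀ ≤ f ≤ C₀, and |f(τ, x₃) − 1| + x₃ |∂_{x₃} f(τ, x₃)| + x₃² |∂²_{x₃} f(τ, x₃)| ≤ C₀ x₃^{−a} for all τ and all x₃ > K. Let Ω_K = {(r cos τ, r sin τ, x₃) : 0 ≤ r < f(τ, x₃), x₃ > K}. Suppose φ is C¹ on the closure of Ω_K and satisfies: (i) ∫_{Ω_K} ∇φ · ∇ψ dx = 0 for every C¹ function ψ : ℝ³ → ℝ with compact support contained in {x₃ > K}; (ii) ∫_{Σ_t} ∂₃φ(x′, t) dx′ = m₀ for every t > K, where Σ_t = {x′ ∈ ℝ² : (x′, t) ∈ Ω_K}; (iii) sup_{Ω_K} |∇φ| ≤ M. Then there exists C > 0, depending only on M, m₀, C₀, a and K, such that |∇φ(x) − (0, 0, q₀)| ≤ C x₃^{−a} for all x ∈ Ω_K with x₃ > 2K. -/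

import Mathlib

open Real Set MeasureTheory

/-- Gradient of a scalar function on ℝ³. -/
noncomputable def grad3 (φ : (Fin 3 → ℝ) → ℝ) (x : Fin 3 → ℝ) : Fin 3 → ℝ :=
  fun i => fderiv ℝ φ x (Pi.single i 1)

/-- Euclidean length of a vector of ℝ³. -/
noncomputable def norm3 (u : Fin 3 → ℝ) : ℝ := Real.sqrt (∑ i, (u i) ^ 2)

/-- The downstream nozzle Ω_K = {(r cos τ, r sin τ, x₃) : 0 ≤ r < f(τ, x₃), x₃ > K}. -/
def nozzleFrom (f : ℝ → ℝ → ℝ) (K : ℝ) : Set (Fin 3 → ℝ) :=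
  {x | K < x 2 ∧ ∃ r τ : ℝ, 0 ≤ r ∧ r < f τ (x 2) ∧
    x 0 = r * Real.cos τ ∧ x 1 = r * Real.sin τ}

section
/-- The hypotheses on the boundary function. -/
structure FN (K a C₀ : ℝ) (f : ℝ → ℝ → ℝ) : Prop where
  K1 : 1 < K
  a0 : 0 < a
  C1 : 1 ≤ C₀
  c2 : ContDiffOn ℝ 2 (fun p : ℝ × ℝ => f p.1 p.2) {p : ℝ × ℝ | K < p.2}
  bd : ∀ p ∈ {p : ℝ × ℝ | K < p.2}, ∀ n : ℕ, n ≤ 2 →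
        ‖iteratedFDerivWithin ℝ n (fun p : ℝ × ℝ => f p.1 p.2) {p : ℝ × ℝ | K < p.2} p‖ ≤ C₀
  per : ∀ τ t : ℝ, f (τ + 2 * π) t = f τ t
  rng : ∀ τ t : ℝ, K < t → 1 / C₀ ≤ f τ t ∧ f τ t ≤ C₀
  dec : ∀ τ t : ℝ, K < t →
        |f τ t - 1| + t * |deriv (fun s => f τ s) t|
          + t ^ 2 * |deriv (deriv (fun s => f τ s)) t| ≤ C₀ * t ^ (-a)

/-- logarithmic derivative of `f` in the angle -/
noncomputable def p1 (f : ℝ → ℝ → ℝ) (τ t : ℝ) : ℝ :=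
  fderiv ℝ (fun p : ℝ × ℝ => f p.1 p.2) (τ, t) (1, 0) / f τ t

/-- logarithmic derivative of `f` in `x₃` -/
noncomputable def p2 (f : ℝ → ℝ → ℝ) (τ t : ℝ) : ℝ :=
  fderiv ℝ (fun p : ℝ × ℝ => f p.1 p.2) (τ, t) (0, 1) / f τ t

namespace FN
variable {K a C₀ : ℝ} {f : ℝ → ℝ → ℝ}

lemma isOpenS (K : ℝ) : IsOpen {p : ℝ × ℝ | K < p.2} := isOpen_lt continuous_const continuous_snd

lemma fpos (h : FN K a C₀ f) (τ : ℝ) {t : ℝ} (ht : K < t) : 0 < f τ t :=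
  lt_of_lt_of_le (by have := h.C1; positivity) (h.rng τ t ht).1

lemma C0pos (h : FN K a C₀ f) : 0 < C₀ := by linarith [h.C1]

lemma diffAt (h : FN K a C₀ f) (τ : ℝ) {t : ℝ} (ht : K < t) :
    DifferentiableAt ℝ (fun p : ℝ × ℝ => f p.1 p.2) (τ, t) :=
  (h.c2.contDiffAt ((isOpenS K).mem_nhds ht)).differentiableAt (by norm_num)

lemma fderiv_c1 (h : FN K a C₀ f) :
    ContDiffOn ℝ 1 (fderiv ℝ (fun p : ℝ × ℝ => f p.1 p.2)) {p : ℝ × ℝ | K < p.2} :=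
  h.c2.fderiv_of_isOpen (isOpenS K) (by norm_num)

lemma fderiv_norm (h : FN K a C₀ f) (p : ℝ × ℝ) (hp : K < p.2) :
    ‖fderiv ℝ (fun p : ℝ × ℝ => f p.1 p.2) p‖ ≤ C₀ := by
  have := h.bd p hp 1 (by norm_num)
  rw [norm_iteratedFDerivWithin_one _ ((isOpenS K).uniqueDiffWithinAt hp),
    fderivWithin_of_isOpen (isOpenS K) hp] at this
  exact this

lemma convexS (K : ℝ) : Convex ℝ {p : ℝ × ℝ | K < p.2} :=
  convex_halfSpace_gt (IsLinearMap.mk (fun _ _ => rfl) (fun _ _ => rfl)) K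

lemma fderiv_lip (h : FN K a C₀ f) (p p' : ℝ × ℝ) (hp : K < p.2) (hp' : K < p'.2) :
    ‖fderiv ℝ (fun p : ℝ × ℝ => f p.1 p.2) p' - fderiv ℝ (fun p : ℝ × ℝ => f p.1 p.2) p‖
      ≤ C₀ * ‖p' - p‖ := by
  refine (convexS K).norm_image_sub_le_of_norm_fderivWithin_le
    (h.fderiv_c1.differentiableOn (by norm_num)) ?_ hp hp'
  intro x hx
  have := h.bd x hx 2 (by norm_num)
  rw [← norm_iteratedFDerivWithin_fderivWithin (isOpenS K).uniqueDiffOn hx,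
    norm_iteratedFDerivWithin_one _ ((isOpenS K).uniqueDiffWithinAt hx)] at this
  rw [fderivWithin_congr (fun y hy => (fderivWithin_of_isOpen (isOpenS K) hy).symm)
    (fderivWithin_of_isOpen (isOpenS K) hx).symm]
  exact this

lemma f_lip (h : FN K a C₀ f) (p p' : ℝ × ℝ) (hp : K < p.2) (hp' : K < p'.2) :
    |f p'.1 p'.2 - f p.1 p.2| ≤ C₀ * ‖p' - p‖ := by
  have := (convexS K).norm_image_sub_le_of_norm_fderiv_le
    (f := (fun p : ℝ × ℝ => f p.1 p.2)) (fun x hx => h.diffAt x.1 hx)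
    (fun x hx => h.fderiv_norm x hx) hp hp'
  simpa using this

lemma quot_lip {g1 g2 f1 f2 C D : ℝ} (hC : 1 ≤ C) (h1 : 1 / C ≤ f1) (h2 : 1 / C ≤ f2)
    (hg : |g2| ≤ C) (hgd : |g1 - g2| ≤ C * D) (hfd : |f1 - f2| ≤ C * D) (hD : 0 ≤ D) :
    |g1 / f1 - g2 / f2| ≤ 2 * C ^ 4 * D := by
  have hC0 : 0 < C := by linarith
  have hf1 : 0 < f1 := lt_of_lt_of_le (by positivity) h1
  have hf2 : 0 < f2 := lt_of_lt_of_le (by positivity) h2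
  have e1 : f1⁻¹ ≤ C := by
    rw [inv_le_comm₀ hf1 hC0]; simpa using h1
  have e2 : f2⁻¹ ≤ C := by
    rw [inv_le_comm₀ hf2 hC0]; simpa using h2
  have : g1 / f1 - g2 / f2 = (g1 - g2) * f1⁻¹ - g2 * (f1 - f2) * f1⁻¹ * f2⁻¹ := by
    field_simp; ring
  rw [this]
  calc |(g1 - g2) * f1⁻¹ - g2 * (f1 - f2) * f1⁻¹ * f2⁻¹|
      ≤ |(g1 - g2) * f1⁻¹| + |g2 * (f1 - f2) * f1⁻¹ * f2⁻¹| := abs_sub _ _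
    _ = |g1 - g2| * f1⁻¹ + |g2| * |f1 - f2| * f1⁻¹ * f2⁻¹ := by
        rw [abs_mul, abs_mul, abs_mul, abs_mul, abs_of_pos (inv_pos.2 hf1),
          abs_of_pos (inv_pos.2 hf2)]
    _ ≤ (C * D) * C + C * (C * D) * C * C := by
        gcongr
    _ ≤ 2 * C ^ 4 * D := by
        have : C * C ≤ C ^ 4 := by nlinarith [mul_self_nonneg C, mul_self_nonneg (C*C-1), mul_pos hC0 hC0]
        nlinarith [mul_le_mul_of_nonneg_right this hD]

lemma p1_lip (h : FN K a C₀ f) (p p' : ℝ × ℝ) (hp : K < p.2) (hp' : K < p'.2) :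
    |p1 f p'.1 p'.2 - p1 f p.1 p.2| ≤ 2 * C₀ ^ 4 * ‖p' - p‖ := by
  refine quot_lip h.C1 (h.rng _ _ hp').1 (h.rng _ _ hp).1 ?_ ?_ (h.f_lip p p' hp hp')
    (norm_nonneg _)
  · have := (fderiv ℝ (fun p : ℝ × ℝ => f p.1 p.2) p).le_of_opNorm_le (h.fderiv_norm p hp) (1, 0)
    simpa [Prod.norm_def] using this
  · have := (fderiv ℝ (fun p : ℝ × ℝ => f p.1 p.2) p' - fderiv ℝ (fun p : ℝ × ℝ => f p.1 p.2) p).le_of_opNorm_le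
      (h.fderiv_lip p p' hp hp') (1, 0)
    simpa [Prod.norm_def] using this

lemma p2_lip (h : FN K a C₀ f) (p p' : ℝ × ℝ) (hp : K < p.2) (hp' : K < p'.2) :
    |p2 f p'.1 p'.2 - p2 f p.1 p.2| ≤ 2 * C₀ ^ 4 * ‖p' - p‖ := by
  refine quot_lip h.C1 (h.rng _ _ hp').1 (h.rng _ _ hp).1 ?_ ?_ (h.f_lip p p' hp hp')
    (norm_nonneg _)
  · have := (fderiv ℝ (fun p : ℝ × ℝ => f p.1 p.2) p).le_of_opNorm_le (h.fderiv_norm p hp) (0, 1)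
    simpa [Prod.norm_def] using this
  · have := (fderiv ℝ (fun p : ℝ × ℝ => f p.1 p.2) p' - fderiv ℝ (fun p : ℝ × ℝ => f p.1 p.2) p).le_of_opNorm_le
      (h.fderiv_lip p p' hp hp') (0, 1)
    simpa [Prod.norm_def] using this

lemma p_bd_aux {g f1 C : ℝ} (hC : 1 ≤ C) (h1 : 1 / C ≤ f1) (hg : |g| ≤ C) :
    |g / f1| ≤ C ^ 2 := by
  have hC0 : 0 < C := by linarith
  have hf1 : 0 < f1 := lt_of_lt_of_le (by positivity) h1
  rw [abs_div, abs_of_pos hf1, div_le_iff₀ hf1]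
  calc |g| ≤ C := hg
    _ = C ^ 2 * (1 / C) := by field_simp
    _ ≤ C ^ 2 * f1 := by gcongr

lemma p1_bd (h : FN K a C₀ f) (τ : ℝ) {t : ℝ} (ht : K < t) : |p1 f τ t| ≤ C₀ ^ 2 := by
  refine p_bd_aux h.C1 (h.rng τ t ht).1 ?_
  have := (fderiv ℝ (fun p : ℝ × ℝ => f p.1 p.2) (τ, t)).le_of_opNorm_le (h.fderiv_norm (τ, t) ht) (1, 0)
  simpa [Prod.norm_def] using this

lemma p2_bd (h : FN K a C₀ f) (τ : ℝ) {t : ℝ} (ht : K < t) : |p2 f τ t| ≤ C₀ ^ 2 := by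
  refine p_bd_aux h.C1 (h.rng τ t ht).1 ?_
  have := (fderiv ℝ (fun p : ℝ × ℝ => f p.1 p.2) (τ, t)).le_of_opNorm_le (h.fderiv_norm (τ, t) ht) (0, 1)
  simpa [Prod.norm_def] using this

lemma hasDerivAt_t (h : FN K a C₀ f) (τ : ℝ) {t : ℝ} (ht : K < t) :
    HasDerivAt (fun s => f τ s) (p2 f τ t * f τ t) t := by
  have h1 := (h.diffAt τ ht).hasFDerivAt
  have h2 : HasDerivAt (fun s : ℝ => (τ, s)) (0, 1) t :=
    (hasDerivAt_const t τ).prodMk (hasDerivAt_id t)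
  have := h1.comp_hasDerivAt t h2
  rw [p2, div_mul_cancel₀ _ (h.fpos τ ht).ne']
  exact this

lemma dec_f (h : FN K a C₀ f) (τ : ℝ) {t : ℝ} (ht : K < t) : |f τ t - 1| ≤ C₀ * t ^ (-a) := by
  have := h.dec τ t ht
  have ht0 : 0 < t := by linarith [h.K1]
  have h1 : 0 ≤ t * |deriv (fun s => f τ s) t| := by positivity
  have h2 : 0 ≤ t ^ 2 * |deriv (deriv (fun s => f τ s)) t| := by positivity
  linarith

lemma dec_p2 (h : FN K a C₀ f) (τ : ℝ) {t : ℝ} (ht : K < t) :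
    |p2 f τ t| ≤ C₀ ^ 2 * t ^ (-a - 1) := by
  have := h.dec τ t ht
  have ht0 : 0 < t := by linarith [h.K1]
  have h1 : 0 ≤ |f τ t - 1| := by positivity
  have h2 : 0 ≤ t ^ 2 * |deriv (deriv (fun s => f τ s)) t| := by positivity
  have hd := (h.hasDerivAt_t τ ht).deriv
  rw [hd, abs_mul, abs_of_pos (h.fpos τ ht)] at this
  have h3 : t * (|p2 f τ t| * f τ t) ≤ C₀ * t ^ (-a) := by linarith
  have h4 : 1 ≤ C₀ * f τ t := by
    have := (h.rng τ t ht).1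
    rw [div_le_iff₀ h.C0pos] at this; linarith
  have h5 : t ^ (-a - 1) = t ^ (-a) / t := by rw [rpow_sub ht0, rpow_one]
  rw [h5, ← mul_div_assoc, le_div_iff₀ ht0]
  calc |p2 f τ t| * t = 1 * (t * |p2 f τ t|) := by ring
    _ ≤ (C₀ * f τ t) * (t * |p2 f τ t|) := by gcongr
    _ = C₀ * (t * (|p2 f τ t| * f τ t)) := by ring
    _ ≤ C₀ * (C₀ * t ^ (-a)) := by have := h.C0pos; gcongr
    _ = C₀ ^ 2 * t ^ (-a) := by ring

lemma p1_cont (h : FN K a C₀ f) :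
    ContinuousOn (fun p : ℝ × ℝ => p1 f p.1 p.2) {p : ℝ × ℝ | K < p.2} := by
  unfold p1
  refine ContinuousOn.div ?_ h.c2.continuousOn (fun p hp => (h.fpos _ hp).ne')
  exact h.fderiv_c1.continuousOn.clm_apply continuousOn_const

lemma p2_cont (h : FN K a C₀ f) :
    ContinuousOn (fun p : ℝ × ℝ => p2 f p.1 p.2) {p : ℝ × ℝ | K < p.2} := by
  unfold p2
  refine ContinuousOn.div ?_ h.c2.continuousOn (fun p hp => (h.fpos _ hp).ne')
  exact h.fderiv_c1.continuousOn.clm_apply continuousOn_const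

lemma per_int (h : FN K a C₀ f) (τ t : ℝ) (n : ℤ) : f (τ + n * (2 * π)) t = f τ t := by
  have : Function.Periodic (fun τ => f τ t) (2 * π) := fun τ => h.per τ t
  exact (this.int_mul n) τ

end FN
end

section
set_option linter.unusedSimpArgs false

/-- scaled radius in the chart -/
noncomputable def rho (f : ℝ → ℝ → ℝ) (y : Fin 3 → ℝ) : ℝ := exp (y 0) * f (y 1) (y 2)

/-- logarithmic polar chart -/
noncomputable def Th (f : ℝ → ℝ → ℝ) (y : Fin 3 → ℝ) : Fin 3 → ℝ :=
  ![rho f y * cos (y 1), rho f y * sin (y 1), y 2]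

/-- Jacobian matrix of the chart -/
noncomputable def MTh (f : ℝ → ℝ → ℝ) (y : Fin 3 → ℝ) : Matrix (Fin 3) (Fin 3) ℝ :=
  !![Th f y 0, p1 f (y 1) (y 2) * Th f y 0 - Th f y 1, p2 f (y 1) (y 2) * Th f y 0;
     Th f y 1, p1 f (y 1) (y 2) * Th f y 1 + Th f y 0, p2 f (y 1) (y 2) * Th f y 1;
     0, 0, 1]

/-- derivative of the chart -/
noncomputable def DTh (f : ℝ → ℝ → ℝ) (y : Fin 3 → ℝ) : (Fin 3 → ℝ) →L[ℝ] (Fin 3 → ℝ) :=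
  LinearMap.toContinuousLinearMap (Matrix.toLin' (MTh f y))

/-- the window of the chart -/
def Wn (K τ0 : ℝ) : Set (Fin 3 → ℝ) := {y | y 0 < 0 ∧ |y 1 - τ0| < π ∧ K < y 2}

/-- rotated complex coordinate of the cross-section -/
noncomputable def zet (τ0 : ℝ) (x : Fin 3 → ℝ) : ℂ :=
  ((x 0 : ℂ) + (x 1 : ℂ) * Complex.I) * Complex.exp (-(τ0 : ℂ) * Complex.I)

/-- angle around `τ0` -/
noncomputable def ang (τ0 : ℝ) (x : Fin 3 → ℝ) : ℝ := τ0 + (zet τ0 x).arg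

/-- distance to the axis -/
noncomputable def rad (x : Fin 3 → ℝ) : ℝ := Real.sqrt (x 0 ^ 2 + x 1 ^ 2)

/-- inverse chart -/
noncomputable def ThInv (f : ℝ → ℝ → ℝ) (τ0 : ℝ) (x : Fin 3 → ℝ) : Fin 3 → ℝ :=
  ![Real.log (rad x / f (ang τ0 x) (x 2)), ang τ0 x, x 2]

lemma norm_zet (τ0 : ℝ) (x : Fin 3 → ℝ) : ‖zet τ0 x‖ = rad x := by
  rw [zet, norm_mul, ← Complex.ofReal_neg, Complex.norm_exp_ofReal_mul_I, mul_one, Complex.norm_add_mul_I, rad]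

lemma x_eq_ang (τ0 : ℝ) (x : Fin 3 → ℝ) :
    x 0 = rad x * cos (ang τ0 x) ∧ x 1 = rad x * sin (ang τ0 x) := by
  have h : ((x 0 : ℂ) + (x 1 : ℂ) * Complex.I)
      = (rad x : ℂ) * Complex.exp ((ang τ0 x : ℝ) * Complex.I) := by
    have h1 := Complex.norm_mul_exp_arg_mul_I (zet τ0 x)
    rw [norm_zet] at h1
    have h2 : ((x 0 : ℂ) + (x 1 : ℂ) * Complex.I) = zet τ0 x * Complex.exp ((τ0 : ℂ) * Complex.I) := by
      rw [zet, mul_assoc, ← Complex.exp_add]; simp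
    rw [h2, ← h1, mul_assoc, ← Complex.exp_add, ang]
    push_cast; ring_nf
  rw [Complex.exp_mul_I, ← Complex.ofReal_cos, ← Complex.ofReal_sin] at h
  constructor
  · simpa [Complex.cos_ofReal_re, Complex.sin_ofReal_re, Complex.cos_ofReal_im, Complex.sin_ofReal_im] using congrArg Complex.re h
  · simpa [Complex.cos_ofReal_re, Complex.sin_ofReal_re, Complex.cos_ofReal_im, Complex.sin_ofReal_im] using congrArg Complex.im h

lemma rad_nonneg (x : Fin 3 → ℝ) : 0 ≤ rad x := Real.sqrt_nonneg _

lemma rad_of_polar {x : Fin 3 → ℝ} {r τ : ℝ} (hr : 0 ≤ r) (h0 : x 0 = r * cos τ)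
    (h1 : x 1 = r * sin τ) : rad x = r := by
  rw [rad, h0, h1]
  rw [show (r * cos τ) ^ 2 + (r * sin τ) ^ 2 = r ^ 2 * (sin τ ^ 2 + cos τ ^ 2) by ring,
    sin_sq_add_cos_sq, mul_one, Real.sqrt_sq hr]

lemma zet_of_polar {τ0 : ℝ} {x : Fin 3 → ℝ} {r τ : ℝ} (h0 : x 0 = r * cos τ)
    (h1 : x 1 = r * sin τ) : zet τ0 x = r * Complex.exp (((τ - τ0 : ℝ) : ℂ) * Complex.I) := by
  have : ((x 0 : ℂ) + (x 1 : ℂ) * Complex.I) = r * Complex.exp ((τ : ℂ) * Complex.I) := by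
    rw [Complex.exp_mul_I, h0, h1]; push_cast; ring
  rw [zet, this, mul_assoc, ← Complex.exp_add]; push_cast; ring_nf

namespace FN
variable {K a C₀ : ℝ} {f : ℝ → ℝ → ℝ}

lemma f_ang (h : FN K a C₀ f) {τ0 : ℝ} {x : Fin 3 → ℝ} {r τ : ℝ} (hr : 0 < r) (h0 : x 0 = r * cos τ)
    (h1 : x 1 = r * sin τ) (t : ℝ) : f (ang τ0 x) t = f τ t := by
  have h2 := x_eq_ang τ0 x
  rw [rad_of_polar hr.le h0 h1, h0, h1] at h2
  have hc : cos τ = cos (ang τ0 x) := mul_left_cancel₀ hr.ne' h2.1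
  have hs : sin τ = sin (ang τ0 x) := mul_left_cancel₀ hr.ne' h2.2
  have : ((τ : ℝ) : Real.Angle) = ((ang τ0 x : ℝ) : Real.Angle) :=
    Real.Angle.cos_sin_inj hc hs
  obtain ⟨n, hn⟩ := Real.Angle.angle_eq_iff_two_pi_dvd_sub.1 this
  rw [← h.per_int (ang τ0 x) t n]
  congr 1; linarith

lemma mem_iff (h : FN K a C₀ f) (τ0 : ℝ) (x : Fin 3 → ℝ) :
    x ∈ nozzleFrom f K ↔ K < x 2 ∧ rad x < f (ang τ0 x) (x 2) := by
  constructor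
  · rintro ⟨hK, r, τ, hr, hrf, h0, h1⟩
    refine ⟨hK, ?_⟩
    rw [rad_of_polar hr h0 h1]
    rcases hr.eq_or_lt with rfl | hr
    · exact h.fpos _ hK
    · rwa [h.f_ang hr h0 h1]
  · rintro ⟨hK, hr⟩
    exact ⟨hK, rad x, ang τ0 x, rad_nonneg x, hr, x_eq_ang τ0 x⟩

lemma rho_pos (h : FN K a C₀ f) {y : Fin 3 → ℝ} (hy : K < y 2) : 0 < rho f y :=
  mul_pos (exp_pos _) (h.fpos _ hy)

lemma rad_Th (h : FN K a C₀ f) {y : Fin 3 → ℝ} (hy : K < y 2) : rad (Th f y) = rho f y :=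
  rad_of_polar (τ := y 1) (h.rho_pos hy).le (by simp [Th]) (by simp [Th])

lemma ang_Th (h : FN K a C₀ f) {τ0 : ℝ} {y : Fin 3 → ℝ} (hy : K < y 2) (hy1 : |y 1 - τ0| < π) :
    ang τ0 (Th f y) = y 1 := by
  rw [ang, zet_of_polar (r := rho f y) (τ := y 1) (by simp [Th]) (by simp [Th]),
    Complex.arg_real_mul _ (h.rho_pos hy), Complex.arg_exp_mul_I, toIocMod_eq_self _ |>.2]
  · ring
  · rw [abs_lt] at hy1
    constructor <;> linarith

lemma leftInv (h : FN K a C₀ f) {τ0 : ℝ} {y : Fin 3 → ℝ} (hy : K < y 2) (hy1 : |y 1 - τ0| < π) :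
    ThInv f τ0 (Th f y) = y := by
  have e2 : Th f y 2 = y 2 := by simp [Th]
  rw [ThInv, h.rad_Th hy, h.ang_Th hy hy1, e2, rho, mul_div_assoc, div_self (h.fpos _ hy).ne',
    mul_one, Real.log_exp]
  ext i; fin_cases i <;> rfl

lemma rightInv (h : FN K a C₀ f) {τ0 : ℝ} {x : Fin 3 → ℝ} (hx : K < x 2) (hr : 0 < rad x) :
    Th f (ThInv f τ0 x) = x := by
  have hρ : rho f (ThInv f τ0 x) = rad x := by
    simp only [rho, ThInv, Matrix.cons_val]
    rw [Real.exp_log (div_pos hr (h.fpos _ hx)), div_mul_cancel₀ _ (h.fpos _ hx).ne']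
  have := x_eq_ang τ0 x
  rw [Th, hρ]
  ext i; fin_cases i
  · simp [ThInv]; exact this.1.symm
  · simp [ThInv]; exact this.2.symm
  · simp [ThInv]

lemma injOn (h : FN K a C₀ f) (τ0 : ℝ) :
    InjOn (Th f) {y | |y 1 - τ0| < π ∧ K < y 2} := fun y hy y' hy' e => by
  rw [← h.leftInv hy.2 hy.1, e, h.leftInv hy'.2 hy'.1]

lemma Th_mem (h : FN K a C₀ f) {y : Fin 3 → ℝ} (hy : K < y 2) (h0 : y 0 < 0) :
    Th f y ∈ nozzleFrom f K := by
  refine ⟨hy, rho f y, y 1, (h.rho_pos hy).le, ?_, rfl, rfl⟩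
  have e2 : Th f y 2 = y 2 := by simp [Th]
  rw [e2, rho]
  have := h.fpos (y 1) hy
  have h1 : exp (y 0) < 1 := by simpa using h0
  nlinarith

lemma Th_mem_iff (h : FN K a C₀ f) {y : Fin 3 → ℝ} (hy : K < y 2) :
    Th f y ∈ nozzleFrom f K ↔ y 0 < 0 := by
  refine ⟨fun hx => ?_, h.Th_mem hy⟩
  rw [h.mem_iff (y 1), h.rad_Th hy, h.ang_Th hy (by simp [pi_pos])] at hx
  have := hx.2
  have e2 : Th f y 2 = y 2 := by simp [Th]
  rw [e2, rho] at this
  have := h.fpos (y 1) hy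
  by_contra hc
  have h1 : 1 ≤ exp (y 0) := by simpa using hc
  nlinarith

lemma image_Wn (h : FN K a C₀ f) (τ0 : ℝ) :
    Th f '' Wn K τ0 = nozzleFrom f K ∩ {x | zet τ0 x ∈ Complex.slitPlane} := by
  ext x
  constructor
  · rintro ⟨y, ⟨h0, h1, h2⟩, rfl⟩
    refine ⟨h.Th_mem h2 h0, ?_⟩
    have hz : zet τ0 (Th f y) = (rho f y : ℂ) * Complex.exp (((y 1 - τ0 : ℝ) : ℂ) * Complex.I) :=
      zet_of_polar (by simp [Th]) (by simp [Th])
    rw [mem_ofPred_eq, Complex.mem_slitPlane_iff_arg, ← norm_ne_zero_iff, norm_zet, h.rad_Th h2]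
    refine ⟨?_, (h.rho_pos h2).ne'⟩
    have := h.ang_Th h2 h1
    rw [ang] at this
    rw [abs_lt] at h1
    intro h3; linarith
  · rintro ⟨hx, hs⟩
    rw [h.mem_iff τ0] at hx
    rw [mem_ofPred_eq, Complex.mem_slitPlane_iff_arg, ← norm_ne_zero_iff, norm_zet] at hs
    have hr : 0 < rad x := lt_of_le_of_ne (rad_nonneg x) hs.2.symm
    refine ⟨ThInv f τ0 x, ⟨?_, ?_, ?_⟩, h.rightInv hx.1 hr⟩
    · simp only [ThInv, Matrix.cons_val]
      have := h.fpos (ang τ0 x) hx.1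
      exact Real.log_neg (div_pos hr this) ((div_lt_one this).2 hx.2)
    · simp only [ThInv, Matrix.cons_val, ang]
      rw [add_sub_cancel_left, abs_lt]
      exact ⟨Complex.neg_pi_lt_arg _, lt_of_le_of_ne (Complex.arg_le_pi _) hs.1⟩
    · simpa [ThInv] using hx.1

end FN

lemma zet_cont (τ0 : ℝ) : Continuous (zet τ0) := by
  unfold zet
  fun_prop

lemma zet_im (τ0 : ℝ) (x : Fin 3 → ℝ) : (zet τ0 x).im = x 1 * cos τ0 - x 0 * sin τ0 := by
  rw [zet, ← Complex.ofReal_neg, Complex.exp_mul_I, ← Complex.ofReal_cos, ← Complex.ofReal_sin]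
  simp [Complex.cos_ofReal_re, Complex.sin_ofReal_re, Complex.cos_ofReal_im, Complex.sin_ofReal_im]; ring

lemma zet_contDiff (τ0 : ℝ) : ContDiff ℝ 2 (zet τ0) := by
  unfold zet
  have h (i : Fin 3) : ContDiff ℝ 2 (fun x : Fin 3 → ℝ => ((x i : ℝ) : ℂ)) :=
    Complex.ofRealCLM.contDiff.comp (contDiff_apply ℝ ℝ i)
  exact ((h 0).add ((h 1).mul contDiff_const)).mul contDiff_const

lemma ang_contDiffAt (τ0 : ℝ) (x : Fin 3 → ℝ) (hx : zet τ0 x ∈ Complex.slitPlane) :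
    ContDiffAt ℝ 2 (ang τ0) x := by
  have h1 : ang τ0 = fun x => τ0 + Complex.imCLM (Complex.log (zet τ0 x)) := by
    funext x; simp [ang, Complex.log_im]
  rw [h1]
  refine contDiffAt_const.add (Complex.imCLM.contDiff.contDiffAt.comp x ?_)
  exact ((Complex.contDiffAt_log hx).restrict_scalars ℝ).comp x (zet_contDiff τ0).contDiffAt

lemma null_slit (τ0 : ℝ) : volume {x : Fin 3 → ℝ | zet τ0 x ∉ Complex.slitPlane} = 0 := by
  let l : (Fin 3 → ℝ) →ₗ[ℝ] ℝ :=
    cos τ0 • LinearMap.proj 1 - sin τ0 • LinearMap.proj 0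
  have hl : LinearMap.ker l ≠ ⊤ := by
    intro e
    rw [LinearMap.ker_eq_top] at e
    have h0 := congrArg (fun l => l (Pi.single 0 1)) e
    have h1 := congrArg (fun l => l (Pi.single 1 1)) e
    simp [l] at h0 h1
    have := sin_sq_add_cos_sq τ0
    rw [h0, h1] at this; norm_num at this
  refine measure_mono_null ?_ (Measure.addHaar_submodule volume _ hl)
  intro x hx
  rw [mem_ofPred_eq, Complex.mem_slitPlane_iff] at hx
  push Not at hx
  have := hx.2
  rw [zet_im] at this
  simp [l]; linarith

namespace FN
variable {K a C₀ : ℝ} {f : ℝ → ℝ → ℝ}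

lemma isOpen_noz (h : FN K a C₀ f) : IsOpen (nozzleFrom f K) := by
  rw [isOpen_iff_mem_nhds]
  intro x hx
  have hx' := hx
  by_cases hr : rad x = 0
  · have hc : Continuous rad := by unfold rad; fun_prop
    have : {x : Fin 3 → ℝ | rad x < 1 / C₀} ∩ {x | K < x 2} ∈ nhds x := by
      refine Filter.inter_mem ?_ ?_
      · refine (isOpen_lt hc continuous_const).mem_nhds ?_
        rw [mem_ofPred_eq, hr]; have := h.C0pos; positivity
      · exact (isOpen_lt continuous_const (continuous_apply 2)).mem_nhds hx.1
    filter_upwards [this] with y hy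
    rw [h.mem_iff 0]
    exact ⟨hy.2, lt_of_lt_of_le hy.1 (h.rng _ _ hy.2).1⟩
  · have hr : 0 < rad x := lt_of_le_of_ne (rad_nonneg x) (Ne.symm hr)
    set τ0 := ang 0 x
    have hs : zet τ0 x ∈ Complex.slitPlane := by
      have := x_eq_ang 0 x
      rw [zet_of_polar this.1 this.2]
      simp [τ0, Complex.ofReal_mem_slitPlane, hr]
    rw [h.mem_iff τ0] at hx
    have hang := (ang_contDiffAt τ0 x hs).continuousAt
    have hf : ContinuousAt (fun x : Fin 3 → ℝ => f (ang τ0 x) (x 2)) x := by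
      have h1 : ContinuousAt (fun p : ℝ × ℝ => f p.1 p.2) (ang τ0 x, x 2) :=
        (h.diffAt _ hx.1).continuousAt
      exact ContinuousAt.comp (g := fun p : ℝ × ℝ => f p.1 p.2)
        (f := fun x : Fin 3 → ℝ => (ang τ0 x, x 2)) h1
        (hang.prodMk (continuous_apply 2).continuousAt)
    have hc : Continuous rad := by unfold rad; fun_prop
    filter_upwards [hc.continuousAt.eventually_lt hf hx.2,
      (isOpen_lt continuous_const (continuous_apply 2)).mem_nhds hx.1] with y h1 h2
    rw [h.mem_iff τ0]
    exact ⟨h2, h1⟩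

lemma meas_noz (h : FN K a C₀ f) : MeasurableSet (nozzleFrom f K) := h.isOpen_noz.measurableSet

lemma isOpen_Wn (K τ0 : ℝ) : IsOpen (Wn K τ0) := by
  refine (isOpen_lt (continuous_apply 0) continuous_const).inter
    ((isOpen_lt (f := fun y : Fin 3 → ℝ => |y 1 - τ0|) (by fun_prop) continuous_const).inter
    (isOpen_lt continuous_const (continuous_apply 2)))

lemma hasFDerivAt_rho (h : FN K a C₀ f) {y : Fin 3 → ℝ} (hy : K < y 2) :
    HasFDerivAt (rho f) (rho f y • (ContinuousLinearMap.proj (R := ℝ) (φ := fun _ : Fin 3 => ℝ) 0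
      + p1 f (y 1) (y 2) • ContinuousLinearMap.proj (R := ℝ) (φ := fun _ : Fin 3 => ℝ) 1
      + p2 f (y 1) (y 2) • ContinuousLinearMap.proj (R := ℝ) (φ := fun _ : Fin 3 => ℝ) 2)) y := by
  have h0 : HasFDerivAt (fun y : Fin 3 → ℝ => exp (y 0))
    (exp (y 0) • ContinuousLinearMap.proj (R := ℝ) (φ := fun _ : Fin 3 => ℝ) 0) y :=
    (hasFDerivAt_apply (𝕜 := ℝ) (F' := fun _ : Fin 3 => ℝ) 0 y).exp
  have h1 : HasFDerivAt (fun y : Fin 3 → ℝ => (y 1, y 2))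
    ((ContinuousLinearMap.proj (R := ℝ) (φ := fun _ : Fin 3 => ℝ) 1).prod
     (ContinuousLinearMap.proj (R := ℝ) (φ := fun _ : Fin 3 => ℝ) 2)) y :=
    (hasFDerivAt_apply (𝕜 := ℝ) (F' := fun _ : Fin 3 => ℝ) 1 y).prodMk
     (hasFDerivAt_apply (𝕜 := ℝ) (F' := fun _ : Fin 3 => ℝ) 2 y)
  have h2 := HasFDerivAt.comp (g := fun p : ℝ × ℝ => f p.1 p.2) y (h.diffAt (y 1) hy).hasFDerivAt h1
  refine (h0.mul h2).congr_fderiv ?_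
  ext v
  have hf := (h.fpos (y 1) hy).ne'
  set D := fderiv ℝ (fun p : ℝ × ℝ => f p.1 p.2) (y 1, y 2) with hD
  have hv : D (v 1, v 2) = v 1 * D (1, 0) + v 2 * D (0, 1) := by
    have : (v 1, v 2) = v 1 • ((1 : ℝ), (0 : ℝ)) + v 2 • ((0 : ℝ), (1 : ℝ)) := by simp
    rw [this, map_add, map_smul, map_smul]; simp
  simp only [_root_.add_apply, _root_.smul_apply,
    ContinuousLinearMap.comp_apply, ContinuousLinearMap.prod_apply, ContinuousLinearMap.proj_apply,
    smul_eq_mul, Function.comp_apply, hv, rho, p1, p2, ← hD]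
  field_simp
  ring

lemma hasFDerivAt_Th (h : FN K a C₀ f) {y : Fin 3 → ℝ} (hy : K < y 2) :
    HasFDerivAt (Th f) (DTh f y) y := by
  have h1 := hasFDerivAt_apply (𝕜 := ℝ) (F' := fun _ : Fin 3 => ℝ) 1 y
  have hr := h.hasFDerivAt_rho hy
  rw [hasFDerivAt_pi']
  intro i
  fin_cases i
  · refine (hr.mul h1.cos).congr_fderiv ?_
    ext v
    simp [DTh, MTh, Th, Matrix.mulVec, dotProduct, Fin.sum_univ_three]
    ring
  · refine (hr.mul h1.sin).congr_fderiv ?_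
    ext v
    simp [DTh, MTh, Th, Matrix.mulVec, dotProduct, Fin.sum_univ_three]
    ring
  · refine (hasFDerivAt_apply (𝕜 := ℝ) (F' := fun _ : Fin 3 => ℝ) 2 y).congr_fderiv ?_
    ext v
    simp [DTh, MTh, Matrix.mulVec, dotProduct, Fin.sum_univ_three]

lemma det_DTh (y : Fin 3 → ℝ) : (DTh f y).det = rho f y ^ 2 := by
  have : (DTh f y).det = (MTh f y).det := by
    rw [DTh, ContinuousLinearMap.det, LinearMap.coe_toContinuousLinearMap, LinearMap.det_toLin']
  rw [this, Matrix.det_fin_three]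
  simp [MTh, Th]
  have := sin_sq_add_cos_sq (y 1)
  linear_combination (rho f y ^ 2) * this

lemma integral_chart (h : FN K a C₀ f) (τ0 : ℝ) (G : (Fin 3 → ℝ) → ℝ) :
    ∫ x in nozzleFrom f K, G x = ∫ y in Wn K τ0, rho f y ^ 2 * G (Th f y) := by
  have hinj : InjOn (Th f) (Wn K τ0) := by
    refine (h.injOn τ0).mono ?_
    rintro y ⟨_, h1, h2⟩
    exact ⟨h1, h2⟩
  have h1 : ∫ x in nozzleFrom f K, G x = ∫ x in Th f '' Wn K τ0, G x := by
    refine setIntegral_congr_set ?_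
    rw [h.image_Wn]
    refine (inter_ae_eq_left_of_ae_eq_univ ?_).symm
    rw [ae_eq_univ]
    exact null_slit τ0
  rw [h1, integral_image_eq_integral_abs_det_fderiv_smul volume (isOpen_Wn K τ0).measurableSet
    (fun y hy => (h.hasFDerivAt_Th hy.2.2).hasFDerivWithinAt)
    hinj]
  simp only [det_DTh, abs_pow, sq_abs, smul_eq_mul]

lemma integrable_chart (h : FN K a C₀ f) (τ0 : ℝ) (G : (Fin 3 → ℝ) → ℝ) :
    IntegrableOn G (nozzleFrom f K) ↔
      IntegrableOn (fun y => rho f y ^ 2 * G (Th f y)) (Wn K τ0) := by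
  have hinj : InjOn (Th f) (Wn K τ0) := by
    refine (h.injOn τ0).mono ?_
    rintro y ⟨_, h1, h2⟩
    exact ⟨h1, h2⟩
  have h1 : IntegrableOn G (nozzleFrom f K) ↔ IntegrableOn G (Th f '' Wn K τ0) := by
    refine integrableOn_congr_set_ae ?_
    rw [h.image_Wn]
    refine (inter_ae_eq_left_of_ae_eq_univ ?_).symm
    rw [ae_eq_univ]
    exact null_slit τ0
  rw [h1, integrableOn_image_iff_integrableOn_abs_det_fderiv_smul volume (isOpen_Wn K τ0).measurableSet
    (fun y hy => (h.hasFDerivAt_Th hy.2.2).hasFDerivWithinAt)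
    hinj]
  simp only [det_DTh, abs_pow, sq_abs, smul_eq_mul]

end FN
end

section
open scoped NNReal

/-- smooth radial profile -/
noncomputable def kk (s : ℝ) : ℝ := Real.smoothTransition (1 - s)
/-- squared Euclidean length -/
def sq3 (z : Fin 3 → ℝ) : ℝ := z 0 ^ 2 + z 1 ^ 2 + z 2 ^ 2
/-- radial kernel -/
noncomputable def KK (z : Fin 3 → ℝ) : ℝ := kk (sq3 z)
/-- minus the i-th derivative of the kernel -/
noncomputable def kap (i : Fin 3) (z : Fin 3 → ℝ) : ℝ := -(2 * deriv kk (sq3 z) * z i)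
/-- test function -/
noncomputable def Psi (i : Fin 3) (z : Fin 3 → ℝ) : ℝ := z i * KK z

lemma kk_contDiff : ContDiff ℝ 2 kk :=
  (Real.smoothTransition.contDiff (n := 2)).comp (contDiff_const.sub contDiff_id)

lemma sq3_contDiff : ContDiff ℝ 2 sq3 := by
  unfold sq3; fun_prop

lemma KK_contDiff : ContDiff ℝ 2 KK := kk_contDiff.comp sq3_contDiff

lemma Psi_contDiff (i : Fin 3) : ContDiff ℝ 2 (Psi i) := by
  have := KK_contDiff
  unfold Psi; fun_prop

lemma kk_zero {s : ℝ} (h : 1 ≤ s) : kk s = 0 := Real.smoothTransition.zero_of_nonpos (by linarith)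
lemma kk_nonneg (s : ℝ) : 0 ≤ kk s := Real.smoothTransition.nonneg _
lemma kk_le_one (s : ℝ) : kk s ≤ 1 := Real.smoothTransition.le_one _
lemma KK_nonneg (z : Fin 3 → ℝ) : 0 ≤ KK z := kk_nonneg _
lemma KK_le_one (z : Fin 3 → ℝ) : KK z ≤ 1 := kk_le_one _
lemma KK_zero {z : Fin 3 → ℝ} (h : 1 ≤ sq3 z) : KK z = 0 := kk_zero h
lemma Psi_zero (i : Fin 3) {z : Fin 3 → ℝ} (h : 1 ≤ sq3 z) : Psi i z = 0 := by
  simp [Psi, KK_zero h]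

lemma coord_sq_le (z : Fin 3 → ℝ) (i : Fin 3) : z i ^ 2 ≤ sq3 z := by
  unfold sq3; fin_cases i <;> simp <;> nlinarith [sq_nonneg (z 0), sq_nonneg (z 1), sq_nonneg (z 2)]

lemma norm_sq_le (z : Fin 3 → ℝ) : ‖z‖ ^ 2 ≤ sq3 z := by
  have h0 : 0 ≤ sq3 z := le_trans (sq_nonneg _) (coord_sq_le z 0)
  have : ‖z‖ ≤ Real.sqrt (sq3 z) := by
    rw [pi_norm_le_iff_of_nonneg (Real.sqrt_nonneg _)]
    intro i
    rw [Real.norm_eq_abs]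
    exact Real.abs_le_sqrt (coord_sq_le z i)
  calc ‖z‖ ^ 2 ≤ Real.sqrt (sq3 z) ^ 2 := by gcongr
    _ = _ := Real.sq_sqrt h0

lemma sq3_le_norm (z : Fin 3 → ℝ) : sq3 z ≤ 3 * ‖z‖ ^ 2 := by
  have (i : Fin 3) : z i ^ 2 ≤ ‖z‖ ^ 2 := by
    rw [← sq_abs]; have := norm_le_pi_norm z i; rw [Real.norm_eq_abs] at this; gcongr
  unfold sq3; linarith [this 0, this 1, this 2]

lemma cs_of_zero {h : (Fin 3 → ℝ) → ℝ} (hh : ∀ z, 1 ≤ sq3 z → h z = 0) : HasCompactSupport h := by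
  refine HasCompactSupport.intro (isCompact_closedBall (0 : Fin 3 → ℝ) 1) fun z hz => hh z ?_
  have : 1 < ‖z‖ := by simpa using hz
  nlinarith [norm_sq_le z]

lemma KK_cs : HasCompactSupport KK := cs_of_zero fun _ => KK_zero
lemma Psi_cs (i : Fin 3) : HasCompactSupport (Psi i) := cs_of_zero fun _ => Psi_zero i

lemma fderiv_sq3 (z v : Fin 3 → ℝ) : fderiv ℝ sq3 z v = 2 * (z 0 * v 0 + z 1 * v 1 + z 2 * v 2) := by
  have h (i : Fin 3) := (hasFDerivAt_apply (𝕜 := ℝ) (F' := fun _ : Fin 3 => ℝ) i z).pow 2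
  have := (((h 0).add (h 1)).add (h 2)).fderiv
  have e : fderiv ℝ sq3 z = _ := this
  rw [e]
  simp; ring

lemma grad_KK (z : Fin 3 → ℝ) (i : Fin 3) : grad3 KK z i = - kap i z := by
  have h1 : HasDerivAt kk (deriv kk (sq3 z)) (sq3 z) :=
    (kk_contDiff.differentiable (by norm_num) _).hasDerivAt
  have h2 : HasFDerivAt sq3 (fderiv ℝ sq3 z) z :=
    (sq3_contDiff.differentiable (by norm_num) _).hasFDerivAt
  have h3 := (h1.comp_hasFDerivAt z h2).fderiv
  have e : fderiv ℝ KK z = _ := h3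
  rw [grad3, e, kap, _root_.smul_apply, fderiv_sq3]
  fin_cases i <;> simp <;> ring

lemma grad_Psi (i : Fin 3) (z : Fin 3 → ℝ) (j : Fin 3) :
    grad3 (Psi i) z j = (if j = i then KK z else 0) - z j * kap i z := by
  have h2 : HasFDerivAt KK (fderiv ℝ KK z) z :=
    (KK_contDiff.differentiable (by norm_num) _).hasFDerivAt
  have h3 := ((hasFDerivAt_apply (𝕜 := ℝ) (F' := fun _ : Fin 3 => ℝ) i z).mul h2).fderiv
  have e : fderiv ℝ (Psi i) z = _ := h3
  have e2 : fderiv ℝ KK z (Pi.single j 1) = - kap j z := grad_KK z j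
  rw [grad3, e, _root_.add_apply, _root_.smul_apply, _root_.smul_apply, e2, kap, kap]
  by_cases h : j = i
  · subst h; simp
    ring
  · simp [h, Ne.symm h]
    ring

lemma kap_cont (i : Fin 3) : Continuous (kap i) := by
  have h1 : Continuous (deriv kk) := kk_contDiff.continuous_deriv (by norm_num)
  have := sq3_contDiff.continuous
  unfold kap
  fun_prop

lemma grad3_cont {h : (Fin 3 → ℝ) → ℝ} (hh : ContDiff ℝ 1 h) (i : Fin 3) :
    Continuous (fun z => grad3 h z i) :=
  (hh.continuous_fderiv (by norm_num)).clm_apply continuous_const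

lemma kap_cs (i : Fin 3) : HasCompactSupport (kap i) := by
  have h : HasCompactSupport (fun z => fderiv ℝ KK z (Pi.single i 1)) :=
    (KK_cs.fderiv (𝕜 := ℝ)).comp_left (g := fun l : (Fin 3 → ℝ) →L[ℝ] ℝ => l (Pi.single i 1)) (by simp)
  have e : kap i = fun z => -(fderiv ℝ KK z (Pi.single i 1)) := by
    funext z; have := grad_KK z i; rw [grad3] at this; rw [this]; ring
  rw [e]; exact h.neg

lemma gradPsi_cs (i j : Fin 3) : HasCompactSupport (fun z => grad3 (Psi i) z j) :=
    ((Psi_cs i).fderiv (𝕜 := ℝ)).comp_left (g := fun l : (Fin 3 → ℝ) →L[ℝ] ℝ => l (Pi.single j 1)) (by simp)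

lemma lipschitz_of_cs {h : (Fin 3 → ℝ) → ℝ} (hh : ContDiff ℝ 1 h) (hc : HasCompactSupport h) :
    ∃ D : ℝ≥0, LipschitzWith D h := hh.lipschitzWith_of_hasCompactSupport hc (by norm_num)

/-- the mollified derivative -/
noncomputable def GG (g : (Fin 3 → ℝ) → ℝ) (i : Fin 3) (ε : ℝ) : ℝ :=
  ε⁻¹ * ∫ z, g (ε • z) * kap i z

lemma smul_lip {g : (Fin 3 → ℝ) → ℝ} {L : ℝ≥0} (hg : LipschitzWith L g) (ε : ℝ) :
    LipschitzWith (L * ‖ε‖₊) (fun z => g (ε • z)) :=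
  hg.comp (lipschitzWith_smul ε)

lemma ae_diff_smul {g : (Fin 3 → ℝ) → ℝ} {L : ℝ≥0} (hg : LipschitzWith L g) {ε : ℝ} (hε : 0 < ε) :
    ∀ᵐ z : Fin 3 → ℝ, DifferentiableAt ℝ g (ε • z) := by
  filter_upwards [(smul_lip hg ε).ae_differentiableAt (μ := volume)] with z hz
  have e : g = (fun z => g (ε • z)) ∘ (fun z => ε⁻¹ • z) := by
    funext z; simp [smul_smul, hε.ne']
  rw [e]
  refine DifferentiableAt.comp _ ?_ (by fun_prop)
  simpa [smul_smul, hε.ne'] using hz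

lemma grad_smul {g : (Fin 3 → ℝ) → ℝ} {ε : ℝ} {z : Fin 3 → ℝ}
    (h : DifferentiableAt ℝ g (ε • z)) (v : Fin 3 → ℝ) :
    fderiv ℝ (fun z => g (ε • z)) z v = ε * fderiv ℝ g (ε • z) v := by
  have h1 : HasFDerivAt (fun z : Fin 3 → ℝ => ε • z) (ε • ContinuousLinearMap.id ℝ _) z :=
    (hasFDerivAt_id z).const_smul ε
  have := (HasFDerivAt.comp z h.hasFDerivAt h1).fderiv
  have e : fderiv ℝ (fun z => g (ε • z)) z = _ := this
  rw [e]; simp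

lemma GG_eq {g : (Fin 3 → ℝ) → ℝ} {L : ℝ≥0} (hg : LipschitzWith L g) (i : Fin 3) {ε : ℝ} (hε : 0 < ε) :
    GG g i ε = ∫ z, grad3 g (ε • z) i * KK z := by
  obtain ⟨D, hD⟩ := lipschitz_of_cs (KK_contDiff.of_le (by norm_num)) KK_cs
  have h := (smul_lip hg ε).integral_lineDeriv_mul_eq (μ := volume) hD KK_cs (Pi.single i 1)
  have e1 : ∫ z, lineDeriv ℝ (fun z => g (ε • z)) z (Pi.single i 1) * KK z
      = ε * ∫ z, grad3 g (ε • z) i * KK z := by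
    rw [← integral_const_mul]
    refine integral_congr_ae ?_
    filter_upwards [ae_diff_smul hg hε] with z hz
    have hd : DifferentiableAt ℝ (fun z => g (ε • z)) z :=
      DifferentiableAt.comp (g := g) z hz (by fun_prop)
    rw [hd.lineDeriv_eq_fderiv, grad_smul hz, grad3]
    ring
  have e2 : ∫ z, lineDeriv ℝ KK z (-(Pi.single i 1)) * g (ε • z) = ∫ z, g (ε • z) * kap i z := by
    congr 1; funext z
    rw [(KK_contDiff.differentiable (by norm_num) z).lineDeriv_eq_fderiv, map_neg]
    have := grad_KK z i; rw [grad3] at this; rw [this]; ring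
  rw [e1, e2] at h
  rw [GG, ← h]; field_simp

lemma grad_bound {g : (Fin 3 → ℝ) → ℝ} {L : ℝ≥0} (hg : LipschitzWith L g) (z : Fin 3 → ℝ) (i : Fin 3) :
    |grad3 g z i| ≤ L := by
  have h := (fderiv ℝ g z).le_of_opNorm_le (norm_fderiv_le_of_lipschitz ℝ hg) (Pi.single i 1)
  rw [Pi.norm_single] at h
  simpa [grad3] using h

lemma grad_meas (g : (Fin 3 → ℝ) → ℝ) (i : Fin 3) : Measurable (fun z => grad3 g z i) :=
  measurable_fderiv_apply_const ℝ g _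

lemma int_grad_mul {g : (Fin 3 → ℝ) → ℝ} {L : ℝ≥0} (hg : LipschitzWith L g) (i : Fin 3) (ε : ℝ)
    {h : (Fin 3 → ℝ) → ℝ} (hh : Integrable h) : Integrable (fun z => grad3 g (ε • z) i * h z) :=
  hh.bdd_mul (c := L) ((grad_meas g i).comp (measurable_const_smul ε)).aestronglyMeasurable
    (Filter.Eventually.of_forall fun _ => grad_bound hg _ _)

lemma fderiv_eq_sum (l : (Fin 3 → ℝ) →L[ℝ] ℝ) (v : Fin 3 → ℝ) :
    l v = ∑ j, l (Pi.single j 1) * v j := by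
  conv_lhs => rw [← Finset.univ_sum_single v]
  rw [map_sum]
  refine Finset.sum_congr rfl fun j _ => ?_
  have : (Pi.single j (v j) : Fin 3 → ℝ) = v j • Pi.single j 1 := by
    rw [← Pi.single_smul]; simp
  rw [this, map_smul, smul_eq_mul, mul_comm]

lemma GG_deriv {g : (Fin 3 → ℝ) → ℝ} {L : ℝ≥0} (hg : LipschitzWith L g) (i : Fin 3) {ε : ℝ} (hε : 0 < ε) :
    HasDerivAt (GG g i) (-(ε⁻¹ * ∫ z, ∑ j, grad3 g (ε • z) j * grad3 (Psi i) z j)) ε := by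
  have hk : Integrable (kap i) := (kap_cont i).integrable_of_hasCompactSupport (kap_cs i)
  have hcs (ε : ℝ) : Integrable (fun z => g (ε • z) * kap i z) := by
    refine Continuous.integrable_of_hasCompactSupport ?_ ((kap_cs i).mul_left)
    exact ((smul_lip hg ε).continuous).mul (kap_cont i)
  have key := hasDerivAt_integral_of_dominated_loc_of_lip (𝕜 := ℝ) (μ := (volume : Measure (Fin 3 → ℝ)))
    (F := fun ε z => g (ε • z) * kap i z)
    (F' := fun z => (∑ j, grad3 g (ε • z) j * z j) * kap i z) (x₀ := ε) (s := univ)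
    (bound := fun z => L * ‖z‖ * |kap i z|) Filter.univ_mem
    (Filter.Eventually.of_forall fun ε => (hcs ε).aestronglyMeasurable) (hcs ε) ?_ ?_ ?_ ?_
  · have h1 := (hasDerivAt_inv hε.ne').mul key.2
    have e : GG g i = fun x => x⁻¹ * ∫ z, g (x • z) * kap i z := rfl
    rw [e]
    refine h1.congr_deriv ?_
    have hG := GG_eq hg i hε
    rw [GG] at hG
    have e2 : ∫ z, ∑ j, grad3 g (ε • z) j * grad3 (Psi i) z j =
       (∫ z, grad3 g (ε • z) i * KK z) - ∫ z, (∑ j, grad3 g (ε • z) j * z j) * kap i z := by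
      rw [← integral_sub (int_grad_mul hg i ε
        (KK_contDiff.continuous.integrable_of_hasCompactSupport KK_cs)) key.1]
      congr 1; funext z
      simp only [grad_Psi, mul_sub, Finset.sum_sub_distrib, mul_ite, mul_zero, Finset.sum_ite_eq',
        Finset.mem_univ, if_true, Finset.sum_mul]
      congr 1
      refine Finset.sum_congr rfl fun j _ => by ring
    rw [e2, ← hG]
    field_simp
    ring
  · have (j : Fin 3) : Measurable (fun z : Fin 3 → ℝ => grad3 g (ε • z) j) :=
      (grad_meas g j).comp (measurable_const_smul ε)
    have hk := (kap_cont i).measurable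
    refine Measurable.aestronglyMeasurable ?_
    fun_prop
  · refine Filter.Eventually.of_forall fun z => LipschitzOnWith.of_dist_le_mul fun x _ y _ => ?_
    rw [Real.dist_eq, Real.dist_eq, ← sub_mul, abs_mul]
    have h1 := hg.dist_le_mul (x • z) (y • z)
    rw [Real.dist_eq, dist_eq_norm, ← sub_smul, norm_smul] at h1
    have h2 : (↑(Real.nnabs (↑L * ‖z‖ * |kap i z|)) : ℝ) = L * ‖z‖ * |kap i z| := by
      rw [Real.coe_nnabs, abs_of_nonneg (by positivity)]
    rw [h2]
    calc _ ≤ (L * (‖x - y‖ * ‖z‖)) * |kap i z| := by gcongr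
      _ = _ := by rw [Real.norm_eq_abs]; ring
  · refine Continuous.integrable_of_hasCompactSupport ?_ ?_
    · have := kap_cont i; fun_prop
    · have := (kap_cs i).abs
      exact this.mul_left
  · filter_upwards [ae_diff_smul hg hε] with z hz
    have h1 : HasDerivAt (fun x : ℝ => x • z) z ε := by
      simpa using (hasDerivAt_id ε).smul_const z
    have h2 := hz.hasFDerivAt.comp_hasDerivAt ε h1
    rw [fderiv_eq_sum] at h2
    exact h2.mul_const _

/-- total mass of the kernel -/
noncomputable def cK : ℝ := ∫ z, KK z

lemma KK_int : Integrable KK := KK_contDiff.continuous.integrable_of_hasCompactSupport KK_cs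

lemma cK_pos : 0 < cK := by
  refine KK_contDiff.continuous.integral_pos_of_hasCompactSupport_nonneg_nonzero KK_cs
    (fun z => KK_nonneg z) (x := 0) ?_
  have : KK 0 = 1 := by
    simp only [KK, kk, sq3, Pi.zero_apply]; norm_num
  rw [this]; norm_num

lemma GG_lim {g : (Fin 3 → ℝ) → ℝ} {L : ℝ≥0} (hg : LipschitzWith L g) (i : Fin 3)
    (hc : ContinuousAt (fun z => grad3 g z i) 0) :
    Filter.Tendsto (GG g i) (nhdsWithin 0 (Ioi 0)) (nhds (grad3 g 0 i * cK)) := by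
  have h1 : Filter.Tendsto (fun ε : ℝ => ∫ z, grad3 g (ε • z) i * KK z) (nhdsWithin 0 (Ioi 0))
      (nhds (∫ z, grad3 g 0 i * KK z)) := by
    refine tendsto_integral_filter_of_dominated_convergence (fun z => L * KK z) ?_ ?_ ?_ ?_
    · exact Filter.Eventually.of_forall fun ε => (int_grad_mul hg i ε KK_int).aestronglyMeasurable
    · refine Filter.Eventually.of_forall fun ε => Filter.Eventually.of_forall fun z => ?_
      rw [norm_mul, Real.norm_eq_abs, Real.norm_eq_abs, abs_of_nonneg (KK_nonneg z)]
      exact mul_le_mul_of_nonneg_right (grad_bound hg _ _) (KK_nonneg z)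
    · exact KK_int.const_mul _
    · refine Filter.Eventually.of_forall fun z => Filter.Tendsto.mul_const _ ?_
      refine hc.tendsto.comp ?_
      have : Filter.Tendsto (fun ε : ℝ => ε • z) (nhds 0) (nhds ((0 : ℝ) • z)) :=
        (Continuous.tendsto (by fun_prop) 0)
      rw [zero_smul] at this
      exact this.mono_left nhdsWithin_le_nhds
  rw [integral_const_mul] at h1
  refine h1.congr' ?_
  filter_upwards [self_mem_nhdsWithin] with ε hε
  exact (GG_eq hg i hε).symm

lemma KL {g : (Fin 3 → ℝ) → ℝ} {L : ℝ≥0} (hg : LipschitzWith L g) (i : Fin 3)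
    (hc : ContinuousAt (fun z => grad3 g z i) 0) {A B β ε0 : ℝ} (hβ : 0 < β) (hε0 : 0 < ε0)
    (H : ∀ ε, 0 < ε → ε ≤ ε0 → |∫ z, ∑ j, grad3 g (ε • z) j * grad3 (Psi i) z j| ≤ A * ε + B * ε ^ β) :
    |grad3 g 0 i| * cK ≤ |GG g i ε0| + (A * ε0 + B / β * ε0 ^ β) := by
  have hS : ∀ x : ℝ, 0 < x → HasDerivAt (fun x => A * x + B / β * x ^ β) (x⁻¹ * (A * x + B * x ^ β)) x := by
    intro x hx
    have h1 := ((hasDerivAt_id x).const_mul A).add ((Real.hasDerivAt_rpow_const (p := β) (Or.inl hx.ne')).const_mul (B / β))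
    refine h1.congr_deriv ?_
    rw [Real.rpow_sub hx, Real.rpow_one]
    field_simp
  set S := fun x : ℝ => A * x + B / β * x ^ β with hSd
  have step : ∀ ε, 0 < ε → ε ≤ ε0 → |GG g i ε0 - GG g i ε| ≤ S ε0 - S ε := by
    intro ε hε hle
    have := image_norm_le_of_norm_deriv_right_le_deriv_boundary' (f := fun x => GG g i x - GG g i ε)
      (f' := fun x => -(x⁻¹ * ∫ z, ∑ j, grad3 g (x • z) j * grad3 (Psi i) z j)) (a := ε) (b := ε0)
      (B := fun x => S x - S ε) (B' := fun x => x⁻¹ * (A * x + B * x ^ β))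
      ?_ ?_ ?_ ?_ ?_ ?_ ⟨hle, le_refl ε0⟩
    · simpa using this
    · intro x hx
      exact ((GG_deriv hg i (lt_of_lt_of_le hε hx.1)).sub_const _).continuousAt.continuousWithinAt
    · intro x hx
      exact ((GG_deriv hg i (lt_of_lt_of_le hε hx.1)).sub_const _).hasDerivWithinAt
    · simp
    · intro x hx
      exact ((hS x (lt_of_lt_of_le hε hx.1)).sub_const _).continuousAt.continuousWithinAt
    · intro x hx
      exact ((hS x (lt_of_lt_of_le hε hx.1)).sub_const _).hasDerivWithinAt
    · intro x hx
      have hx0 := lt_of_lt_of_le hε hx.1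
      rw [norm_neg, norm_mul, norm_inv, Real.norm_eq_abs, Real.norm_eq_abs, abs_of_pos hx0]
      exact mul_le_mul_of_nonneg_left (H x hx0 hx.2.le) (by positivity)
  have hS0 : Filter.Tendsto S (nhdsWithin 0 (Ioi 0)) (nhds 0) := by
    have : ContinuousAt S 0 := by
      have h2 := Real.continuousAt_rpow_const 0 β (Or.inr hβ.le)
      exact (continuousAt_const.mul continuousAt_id).add (continuousAt_const.mul h2)
    have h0 : S 0 = 0 := by simp [hSd, Real.zero_rpow hβ.ne']
    have h2 := this.tendsto
    rw [h0] at h2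
    exact h2.mono_left nhdsWithin_le_nhds
  have hlim := ((tendsto_const_nhds (x := GG g i ε0)).sub (GG_lim hg i hc)).abs
  have hlim2 := (tendsto_const_nhds (x := S ε0)).sub hS0
  have hle : |GG g i ε0 - grad3 g 0 i * cK| ≤ S ε0 - 0 := by
    refine le_of_tendsto_of_tendsto hlim hlim2 ?_
    filter_upwards [Ioc_mem_nhdsGT hε0] with ε hε
    exact step ε hε.1 hε.2
  have : |grad3 g 0 i| * cK = |grad3 g 0 i * cK| := by rw [abs_mul, abs_of_pos cK_pos]
  rw [this]
  have h3 := abs_sub_abs_le_abs_sub (grad3 g 0 i * cK) (GG g i ε0)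
  rw [abs_sub_comm] at h3
  linarith
end

section
open scoped NNReal

/-- linear form n · z -/
def ell (n z : Fin 3 → ℝ) : ℝ := n 0 * z 0 + n 1 * z 1 + n 2 * z 2
/-- matrix of the linear reflection -/
def RM (n : Fin 3 → ℝ) : Matrix (Fin 3) (Fin 3) ℝ := fun i j => (if i = j then 1 else 0) - 2 * n i * n j
/-- linear reflection -/
noncomputable def RL (n : Fin 3 → ℝ) : (Fin 3 → ℝ) →L[ℝ] (Fin 3 → ℝ) :=
  LinearMap.toContinuousLinearMap (Matrix.toLin' (RM n))
/-- affine reflection across the plane `ell = d` -/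
def ref (n : Fin 3 → ℝ) (d : ℝ) (z : Fin 3 → ℝ) : Fin 3 → ℝ := fun i => z i - 2 * (ell n z - d) * n i
/-- folding map -/
def fold (n : Fin 3 → ℝ) (d : ℝ) (z : Fin 3 → ℝ) : Fin 3 → ℝ :=
  fun i => z i - 2 * max 0 (ell n z - d) * n i
/-- half space -/
def HS (n : Fin 3 → ℝ) (d : ℝ) : Set (Fin 3 → ℝ) := {z | ell n z < d}

/-- linear map version of `ell` -/
def ellL (n : Fin 3 → ℝ) : (Fin 3 → ℝ) →ₗ[ℝ] ℝ where
  toFun := ell n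
  map_add' x y := by simp [ell]; ring
  map_smul' c x := by simp [ell]; ring

lemma ell_cont (n : Fin 3 → ℝ) : Continuous (ell n) := by unfold ell; fun_prop
lemma HS_open (n : Fin 3 → ℝ) (d : ℝ) : IsOpen (HS n d) := isOpen_lt (ell_cont n) continuous_const

lemma RL_apply (n z : Fin 3 → ℝ) (i : Fin 3) : RL n z i = z i - 2 * ell n z * n i := by
  simp only [RL, LinearMap.coe_toContinuousLinearMap', Matrix.toLin'_apply, Matrix.mulVec, dotProduct,
    RM, Fin.sum_univ_three, ell]
  fin_cases i <;> simp <;> ring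

lemma ref_eq (n : Fin 3 → ℝ) (d : ℝ) : ref n d = fun z => RL n z + (2 * d) • n := by
  funext z i
  simp only [ref, Pi.add_apply, RL_apply, Pi.smul_apply, smul_eq_mul]; ring

lemma ref_hasFDerivAt (n : Fin 3 → ℝ) (d : ℝ) (z : Fin 3 → ℝ) : HasFDerivAt (ref n d) (RL n) z := by
  rw [ref_eq]; exact (RL n).hasFDerivAt.add_const _

lemma ref_contDiff (n : Fin 3 → ℝ) (d : ℝ) : ContDiff ℝ 2 (ref n d) := by
  rw [ref_eq]; exact (RL n).contDiff.add contDiff_const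

lemma RL_single (n : Fin 3 → ℝ) (j : Fin 3) : RL n (Pi.single j 1) = fun k => RM n k j := by
  funext k
  simp [RL]

lemma RL_det {n : Fin 3 → ℝ} (hn : sq3 n = 1) : (RL n).det = -1 := by
  have : (RL n).det = (RM n).det := by
    rw [RL, ContinuousLinearMap.det, LinearMap.coe_toContinuousLinearMap, LinearMap.det_toLin']
  rw [this, Matrix.det_fin_three]
  simp [RM]
  unfold sq3 at hn
  linear_combination (-2) * hn

lemma ell_ref {n : Fin 3 → ℝ} (hn : sq3 n = 1) (d : ℝ) (z : Fin 3 → ℝ) :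
    ell n (ref n d z) = 2 * d - ell n z := by
  unfold sq3 at hn
  simp only [ref, ell]
  linear_combination (-2 * (n 0 * z 0 + n 1 * z 1 + n 2 * z 2 - d)) * hn

lemma ref_ref {n : Fin 3 → ℝ} (hn : sq3 n = 1) (d : ℝ) (z : Fin 3 → ℝ) : ref n d (ref n d z) = z := by
  funext i
  have := ell_ref hn d z
  rw [ref, this]
  simp only [ref]; ring

lemma sq3_ref {n : Fin 3 → ℝ} (hn : sq3 n = 1) (d : ℝ) (z : Fin 3 → ℝ) :
    sq3 (ref n d z) = sq3 z - 4 * d * (ell n z - d) := by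
  unfold sq3 at *
  simp only [ref, ell]
  linear_combination (4 * (n 0 * z 0 + n 1 * z 1 + n 2 * z 2 - d)^2) * hn

lemma fold_of_lt {n : Fin 3 → ℝ} {d : ℝ} {z : Fin 3 → ℝ} (h : ell n z < d) : fold n d z = z := by
  funext i; rw [fold, max_eq_left (by linarith)]; ring
lemma fold_of_gt {n : Fin 3 → ℝ} {d : ℝ} {z : Fin 3 → ℝ} (h : d < ell n z) : fold n d z = ref n d z := by
  funext i; rw [fold, max_eq_right (by linarith), ref]

lemma fold_lip (n : Fin 3 → ℝ) (d : ℝ) : ∃ D : ℝ≥0, LipschitzWith D (fold n d) := by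
  have hell : LipschitzWith ‖LinearMap.toContinuousLinearMap (ellL n)‖₊ (ell n) :=
    ContinuousLinearMap.lipschitz (LinearMap.toContinuousLinearMap (ellL n))
  have h1 : LipschitzWith _ (fun z => max 0 (ell n z - d)) :=
    (LipschitzWith.const_max (hell.sub (LipschitzWith.const d)) 0)
  have h2 : LipschitzWith _ (fun z : Fin 3 → ℝ => z - (max 0 (ell n z - d)) • ((2:ℝ) • n)) :=
    LipschitzWith.id.sub (((ContinuousLinearMap.toSpanSingleton ℝ ((2:ℝ) • n)).lipschitz).comp h1)
  have e : fold n d = (fun z : Fin 3 → ℝ => z - (max 0 (ell n z - d)) • ((2:ℝ) • n)) := by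
      funext z i; simp [fold]; ring
  rw [e]; exact ⟨_, h2⟩

lemma HS_image {n : Fin 3 → ℝ} (hn : sq3 n = 1) (d : ℝ) : ref n d '' HS n d = {z | d < ell n z} := by
  ext z
  constructor
  · rintro ⟨w, hw, rfl⟩
    have : ell n w < d := hw
    rw [mem_ofPred_eq, ell_ref hn]; linarith
  · intro hz
    have : d < ell n z := hz
    refine ⟨ref n d z, ?_, ref_ref hn d z⟩
    change ell n (ref n d z) < d
    rw [ell_ref hn]; linarith

lemma compl_ae {n : Fin 3 → ℝ} (hn : sq3 n = 1) (d : ℝ) :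
    ((HS n d)ᶜ : Set (Fin 3 → ℝ)) =ᵐ[volume] {z | d < ell n z} := by
  have hnull : volume {z : Fin 3 → ℝ | ell n z = d} = 0 := by
    let l : (Fin 3 → ℝ) →ₗ[ℝ] ℝ := ellL n
    have hl : LinearMap.ker l ≠ ⊤ := by
      intro e
      rw [LinearMap.ker_eq_top] at e
      have h0 := congrArg (fun l => l n) e
      simp [l, ellL, ell] at h0
      unfold sq3 at hn
      nlinarith
    have h1 := Measure.addHaar_submodule (volume : Measure (Fin 3 → ℝ)) _ hl
    have h2 := measure_preimage_add_right (volume : Measure (Fin 3 → ℝ)) (-(d • n)) (LinearMap.ker l : Set (Fin 3 → ℝ))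
    rw [h1] at h2
    refine measure_mono_null ?_ h2
    intro z hz
    have hz' : ell n z = d := hz
    simp only [mem_preimage, SetLike.mem_coe, LinearMap.mem_ker, l]
    change ell n _ = 0
    unfold sq3 at hn
    simp only [ell, Pi.add_apply, Pi.neg_apply, Pi.smul_apply, smul_eq_mul] at hz' ⊢
    linear_combination hz' - d * hn
  rw [Filter.eventuallyEq_set]
  have : ∀ᵐ z : Fin 3 → ℝ, ell n z ≠ d := by
    rw [ae_iff]; simpa using hnull
  filter_upwards [this] with z hz
  simp only [HS, mem_compl_iff, mem_ofPred_eq, not_lt]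
  exact ⟨fun h => lt_of_le_of_ne h (Ne.symm hz), fun h => h.le⟩

lemma integral_split {n : Fin 3 → ℝ} (hn : sq3 n = 1) (d : ℝ) {G : (Fin 3 → ℝ) → ℝ} (hG : Integrable G) :
    ∫ z, G z = (∫ z in HS n d, G z) + ∫ z in HS n d, G (ref n d z) := by
  rw [← integral_add_compl (HS_open n d).measurableSet hG, setIntegral_congr_set (compl_ae hn d),
    ← HS_image hn d, integral_image_eq_integral_abs_det_fderiv_smul volume (HS_open n d).measurableSet
    (fun y _ => (ref_hasFDerivAt n d y).hasFDerivWithinAt)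
    (fun x _ y _ h => by rw [← ref_ref hn d x, h, ref_ref hn d y])]
  simp [RL_det hn]

lemma grad_comp_ref {n : Fin 3 → ℝ} (d : ℝ) {v : (Fin 3 → ℝ) → ℝ} {z : Fin 3 → ℝ}
    (hv : DifferentiableAt ℝ v (ref n d z)) (j : Fin 3) :
    grad3 (fun z => v (ref n d z)) z j = ∑ k, grad3 v (ref n d z) k * RM n k j := by
  have h1 := (HasFDerivAt.comp z hv.hasFDerivAt (ref_hasFDerivAt n d z)).fderiv
  have e : fderiv ℝ (fun z => v (ref n d z)) z = _ := h1
  rw [grad3, e, ContinuousLinearMap.comp_apply, fderiv_eq_sum, RL_single]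
  rfl

lemma RM_symm (n : Fin 3 → ℝ) (i j : Fin 3) : RM n i j = RM n j i := by
  unfold RM
  by_cases h : i = j
  · subst h; rfl
  · simp [h, Ne.symm h]; ring

lemma RM_bd {n : Fin 3 → ℝ} (hn : sq3 n = 1) (i j : Fin 3) : |RM n i j| ≤ 3 := by
  have h (i : Fin 3) : |n i| ≤ 1 := by
    have := coord_sq_le n i
    rw [hn] at this
    exact (sq_le_one_iff_abs_le_one _).1 this
  have h1 : |n i * n j| ≤ 1 := by
    rw [abs_mul]; exact mul_le_one₀ (h i) (abs_nonneg _) (h j)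
  rw [abs_le] at h1 ⊢
  unfold RM
  split_ifs <;> constructor <;> nlinarith [h1.1, h1.2]

/-- scaled test function -/
noncomputable def Pse (i : Fin 3) (ε : ℝ) (z : Fin 3 → ℝ) : ℝ := ε * Psi i (ε⁻¹ • z)
/-- symmetrized test function -/
noncomputable def Pst (n : Fin 3 → ℝ) (d : ℝ) (i : Fin 3) (ε : ℝ) (z : Fin 3 → ℝ) : ℝ :=
  Pse i ε z + Pse i ε (ref n d z)

lemma Pse_contDiff (i : Fin 3) (ε : ℝ) : ContDiff ℝ 2 (Pse i ε) := by
  have := Psi_contDiff i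
  unfold Pse; fun_prop

lemma Pst_contDiff (n : Fin 3 → ℝ) (d : ℝ) (i : Fin 3) (ε : ℝ) : ContDiff ℝ 2 (Pst n d i ε) :=
  (Pse_contDiff i ε).add ((Pse_contDiff i ε).comp (ref_contDiff n d))

lemma grad_Pse (i : Fin 3) {ε : ℝ} (hε : 0 < ε) (z : Fin 3 → ℝ) (j : Fin 3) :
    grad3 (Pse i ε) z j = grad3 (Psi i) (ε⁻¹ • z) j := by
  have h := (Psi_contDiff i).differentiable (by norm_num)
  have e : Pse i ε = fun z => ε * (fun z => Psi i (ε⁻¹ • z)) z := rfl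
  rw [grad3, e, fderiv_const_mul (by fun_prop), _root_.smul_apply, grad_smul (h _), grad3, smul_eq_mul,
    ← mul_assoc, mul_inv_cancel₀ hε.ne', one_mul]

lemma grad_Pst (n : Fin 3 → ℝ) (d : ℝ) (i : Fin 3) {ε : ℝ} (z : Fin 3 → ℝ) (j : Fin 3) :
    grad3 (Pst n d i ε) z j = grad3 (Pse i ε) z j + ∑ k, grad3 (Pse i ε) (ref n d z) k * RM n k j := by
  have h := (Pse_contDiff i ε).differentiable (by norm_num)
  have h2 := ((Pse_contDiff i ε).comp (ref_contDiff n d)).differentiable (by norm_num)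
  rw [← grad_comp_ref d (h _)]
  have e : Pst n d i ε = (Pse i ε) + (Pse i ε) ∘ (ref n d) := rfl
  rw [grad3, e, fderiv_add (h _) (h2 _)]
  rfl

lemma sq3_smul (c : ℝ) (z : Fin 3 → ℝ) : sq3 (c • z) = c ^ 2 * sq3 z := by
  simp [sq3]; ring

lemma Pse_zero (i : Fin 3) {ε : ℝ} (hε : 0 < ε) {z : Fin 3 → ℝ} (h : ε ^ 2 ≤ sq3 z) : Pse i ε z = 0 := by
  rw [Pse, Psi_zero, mul_zero]
  rw [sq3_smul, inv_pow, inv_mul_eq_div, one_le_div (by positivity)]; exact h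

lemma gradPsi_zero (i : Fin 3) {z : Fin 3 → ℝ} (h : 1 ≤ sq3 z) (j : Fin 3) : grad3 (Psi i) z j = 0 := by
  rcases h.eq_or_lt with h | h
  · have hk : deriv kk 1 = 0 := by
      have hc : Continuous (deriv kk) := kk_contDiff.continuous_deriv (by norm_num)
      have h2 : ∀ s ∈ Ioi (1:ℝ), deriv kk s = 0 := by
        intro s hs
        have : kk =ᶠ[nhds s] fun _ => 0 := by
          filter_upwards [Ioi_mem_nhds hs] with x hx
          exact kk_zero (le_of_lt hx)
        rw [this.deriv_eq]; simp
      have h3 : closure (Ioi (1:ℝ)) ⊆ {s | deriv kk s = 0} :=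
        closure_minimal h2 (isClosed_eq hc continuous_const)
      rw [closure_Ioi] at h3
      exact h3 (mem_Ici.2 le_rfl)
    rw [grad_Psi, kap, KK_zero h.le, ← h, hk]; simp
  · have : Psi i =ᶠ[nhds z] fun _ => 0 := by
      filter_upwards [(isOpen_lt continuous_const sq3_contDiff.continuous).mem_nhds h] with x hx
      exact Psi_zero i (le_of_lt hx)
    rw [grad3, this.fderiv_eq]; simp

lemma gradPse_zero (i : Fin 3) {ε : ℝ} (hε : 0 < ε) {z : Fin 3 → ℝ} (h : ε ^ 2 ≤ sq3 z) (j : Fin 3) :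
    grad3 (Pse i ε) z j = 0 := by
  rw [grad_Pse i hε, gradPsi_zero]
  rw [sq3_smul, inv_pow, inv_mul_eq_div, one_le_div (by positivity)]; exact h
end

section
open scoped NNReal

/-- Euclidean ball around zero -/
def B3 (δ : ℝ) : Set (Fin 3 → ℝ) := {z | sq3 z < δ ^ 2}

lemma B3_open (δ : ℝ) : IsOpen (B3 δ) := isOpen_lt sq3_contDiff.continuous continuous_const

lemma B3_convex (δ : ℝ) : Convex ℝ (B3 δ) := by
  intro x hx y hy a b ha hb hab
  have hx' : sq3 x < δ ^ 2 := hx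
  have hy' : sq3 y < δ ^ 2 := hy
  change sq3 _ < δ ^ 2
  have h1 : sq3 (a • x + b • y) = a * sq3 x + b * sq3 y - a * b * sq3 (x - y) := by
    have hb' : b = 1 - a := by linarith
    subst hb'
    simp [sq3]; ring
  have h2 : 0 ≤ sq3 (x - y) := by unfold sq3; positivity
  have h3 : a * sq3 x + b * sq3 y < δ ^ 2 := by
    rcases ha.eq_or_lt with rfl | ha'
    · have : b = 1 := by linarith
      subst this; linarith
    · have h4 : b * sq3 y ≤ b * δ ^ 2 := mul_le_mul_of_nonneg_left hy'.le hb
      have h5 : a * sq3 x < a * δ ^ 2 := mul_lt_mul_of_pos_left hx' ha'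
      have : a * δ ^ 2 + b * δ ^ 2 = δ ^ 2 := by rw [← add_mul, hab, one_mul]
      linarith
  have h6 := mul_nonneg (mul_nonneg ha hb) h2
  linarith

lemma HS_convex (n : Fin 3 → ℝ) (d : ℝ) : Convex ℝ (HS n d) :=
  convex_halfSpace_lt (f := ell n) ((ellL n).isLinear) d

lemma B3_vol (δ : ℝ) : volume (B3 δ) < ⊤ := by
  refine lt_of_le_of_lt (measure_mono ?_) (measure_closedBall_lt_top (x := (0 : Fin 3 → ℝ)) (r := |δ|))
  intro z hz
  have hz' : sq3 z < δ ^ 2 := hz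
  rw [mem_closedBall_zero_iff]
  have := norm_sq_le z
  exact le_of_sq_le_sq (by rw [sq_abs]; linarith) (abs_nonneg δ)

lemma fderiv_norm_le {v : (Fin 3 → ℝ) → ℝ} {z : Fin 3 → ℝ} {L : ℝ} (h : ∀ j, |grad3 v z j| ≤ L) :
    ‖fderiv ℝ v z‖ ≤ 3 * L := by
  have hL : 0 ≤ L := le_trans (abs_nonneg _) (h 0)
  refine ContinuousLinearMap.opNorm_le_bound _ (by positivity) fun w => ?_
  rw [fderiv_eq_sum, Fin.sum_univ_three]
  have h1 (j : Fin 3) : |fderiv ℝ v z (Pi.single j 1) * w j| ≤ L * ‖w‖ := by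
    rw [abs_mul]
    exact mul_le_mul (h j) (norm_le_pi_norm w j) (abs_nonneg _) hL
  calc _ ≤ |fderiv ℝ v z (Pi.single 0 1) * w 0| + |fderiv ℝ v z (Pi.single 1 1) * w 1|
        + |fderiv ℝ v z (Pi.single 2 1) * w 2| := abs_add_three _ _ _
    _ ≤ _ := by linarith [h1 0, h1 1, h1 2]

lemma KLH {n : Fin 3 → ℝ} (hn : sq3 n = 1) {d : ℝ} (hd : 0 < d) {v : (Fin 3 → ℝ) → ℝ} {δ L : ℝ}
    (hv : ∀ z ∈ HS n d ∩ B3 δ, DifferentiableAt ℝ v z)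
    (hL : ∀ z ∈ HS n d ∩ B3 δ, ∀ j, |grad3 v z j| ≤ L) (i : Fin 3)
    (hc : ContinuousAt (fun z => grad3 v z i) 0) {A B β ε0 : ℝ} (hβ : 0 < β) (hε0 : 0 < ε0)
    (hεδ : ε0 < δ)
    (H : ∀ ε, 0 < ε → ε ≤ ε0 →
      |∫ z in HS n d, ∑ j, grad3 v z j * grad3 (Pst n d i ε) z j| ≤ ε ^ 3 * (A * ε + B * ε ^ β)) :
    |grad3 v 0 i| * cK ≤ 10 * (ε0 ^ 3)⁻¹ * (∫ z in HS n d ∩ B3 ε0, ∑ j, |grad3 v z j|)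
      + (A * ε0 + B / β * ε0 ^ β) := by
  have hδ : 0 < δ := hε0.trans hεδ
  set S := HS n d ∩ B3 δ with hS
  have hSo : IsOpen S := (HS_open n d).inter (B3_open δ)
  have h0S : (0 : Fin 3 → ℝ) ∈ S := by
    refine ⟨?_, ?_⟩
    · change ell n 0 < d; simpa [ell] using hd
    · change sq3 0 < δ ^ 2
      simp [sq3]; positivity
  have hL0 : 0 ≤ L := le_trans (abs_nonneg _) (hL 0 h0S 0)
  have hlip : LipschitzOnWith (Real.toNNReal (3 * L)) v S := by
    refine ((HS_convex n d).inter (B3_convex δ)).lipschitzOnWith_of_nnnorm_fderiv_le hv fun z hz => ?_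
    rw [← NNReal.coe_le_coe, Real.coe_toNNReal _ (by positivity)]
    exact fderiv_norm_le (hL z hz)
  obtain ⟨w, hw, hwv⟩ := hlip.extend_real
  obtain ⟨D, hD⟩ := fold_lip n d
  set g := fun z => w (fold n d z) with hg
  have hgl : LipschitzWith _ g := hw.comp hD
  have g1 : ∀ z ∈ S, ∀ j, grad3 g z j = grad3 v z j := by
    intro z hz j
    have : g =ᶠ[nhds z] v := by
      filter_upwards [hSo.mem_nhds hz] with y hy
      rw [hg]; simp only
      rw [fold_of_lt hy.1]; exact (hwv hy).symm
    rw [grad3, grad3, this.fderiv_eq]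
  have hrefc : Continuous (ref n d) := (ref_contDiff n d).continuous
  have g2 : ∀ z ∈ S, ∀ j, grad3 g (ref n d z) j = ∑ k, grad3 v z k * RM n k j := by
    intro z hz j
    have : g =ᶠ[nhds (ref n d z)] fun y => v (ref n d y) := by
      have : ref n d ⁻¹' S ∈ nhds (ref n d z) := by
        refine (hSo.preimage hrefc).mem_nhds ?_
        rw [mem_preimage, ref_ref hn]; exact hz
      filter_upwards [this] with y hy
      have hy1 : ell n (ref n d y) < d := hy.1
      rw [ell_ref hn] at hy1
      rw [hg]; simp only
      rw [fold_of_gt (by linarith)]; exact (hwv hy).symm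
    have h2 : DifferentiableAt ℝ v (ref n d (ref n d z)) := by rw [ref_ref hn]; exact hv z hz
    have h3 := grad_comp_ref d h2 j
    rw [ref_ref hn] at h3
    rw [← h3, grad3, grad3, this.fderiv_eq]
  have hcg : ContinuousAt (fun z => grad3 g z i) 0 := by
    refine hc.congr ?_
    filter_upwards [hSo.mem_nhds h0S] with y hy
    exact (g1 y hy i).symm
  have href_ge : ∀ z ∈ HS n d, sq3 z ≤ sq3 (ref n d z) := by
    intro z hz
    have hz' : ell n z < d := hz
    rw [sq3_ref hn]; nlinarith
  have key : ∀ ε, 0 < ε → ε ≤ ε0 → |∫ z, ∑ j, grad3 g (ε • z) j * grad3 (Psi i) z j|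
      ≤ A * ε + B * ε ^ β := by
    intro ε hε hle
    have hF : Integrable (fun y => ∑ j, grad3 g y j * grad3 (Pse i ε) y j) := by
      refine integrable_finsetSum _ fun j _ => ?_
      have h1 : Integrable (fun y => grad3 (Pse i ε) y j) := by
        refine Continuous.integrable_of_hasCompactSupport
          (grad3_cont ((Pse_contDiff i ε).of_le (by norm_num)) j) ?_
        refine HasCompactSupport.intro (isCompact_closedBall (0 : Fin 3 → ℝ) ε) fun z hz => ?_
        refine gradPse_zero i hε ?_ j
        have : ε < ‖z‖ := by simpa using hz
        nlinarith [norm_sq_le z]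
      have := int_grad_mul hgl j 1 h1
      simpa using this
    have h1 := Measure.integral_comp_smul (volume : Measure (Fin 3 → ℝ))
      (fun y => ∑ j, grad3 g y j * grad3 (Pse i ε) y j) ε
    have h2 : (fun z => ∑ j, grad3 g (ε • z) j * grad3 (Pse i ε) (ε • z) j)
        = fun z => ∑ j, grad3 g (ε • z) j * grad3 (Psi i) z j := by
      funext z
      simp only [grad_Pse i hε, smul_smul, inv_mul_cancel₀ hε.ne', one_smul]
    simp only [h2] at h1
    rw [h1, integral_split hn d hF, smul_eq_mul]
    have h3 : (∫ z in HS n d, ∑ j, grad3 g z j * grad3 (Pse i ε) z j)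
        + (∫ z in HS n d, ∑ j, grad3 g (ref n d z) j * grad3 (Pse i ε) (ref n d z) j)
        = ∫ z in HS n d, ∑ j, grad3 v z j * grad3 (Pst n d i ε) z j := by
      have hF2 : IntegrableOn (fun z => ∑ j, grad3 g (ref n d z) j * grad3 (Pse i ε) (ref n d z) j)
          (HS n d) := by
        have := (integrableOn_image_iff_integrableOn_abs_det_fderiv_smul volume
          (HS_open n d).measurableSet (fun y _ => (ref_hasFDerivAt n d y).hasFDerivWithinAt)
          (fun x _ y _ h => by rw [← ref_ref hn d x, h, ref_ref hn d y])
          (fun y => ∑ j, grad3 g y j * grad3 (Pse i ε) y j)).1 hF.integrableOn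
        simpa [RL_det hn] using this
      rw [← integral_add hF.integrableOn hF2]
      refine setIntegral_congr_fun (HS_open n d).measurableSet fun z hz => ?_
      by_cases hzB : z ∈ B3 δ
      · simp only [g1 z ⟨hz, hzB⟩, g2 z ⟨hz, hzB⟩, grad_Pst, Fin.sum_univ_three,
          RM_symm n 1 0, RM_symm n 2 0, RM_symm n 2 1]
        ring
      · have h5 : ε ^ 2 ≤ sq3 z := by
          have : δ ^ 2 ≤ sq3 z := not_lt.1 hzB
          have : ε ^ 2 ≤ δ ^ 2 := by gcongr; linarith
          linarith
        have h6 := h5.trans (href_ge z hz)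
        simp [grad_Pst, gradPse_zero i hε h5, gradPse_zero i hε h6]
    rw [h3, abs_mul]
    have h7 := H ε hε hle
    have h8 : Module.finrank ℝ (Fin 3 → ℝ) = 3 := by simp
    rw [h8, abs_abs, abs_of_pos (by positivity : 0 < (ε ^ 3)⁻¹), inv_mul_le_iff₀ (by positivity)]
    exact h7
  have hKL := KL hgl i hcg hβ hε0 key
  rw [g1 0 h0S] at hKL
  refine hKL.trans (add_le_add_left ?_ _)
  -- bound of GG
  set F := fun y => |grad3 g y i| * KK (ε0⁻¹ • y) with hFd
  have hKi : Integrable (fun y : Fin 3 → ℝ => KK (ε0⁻¹ • y)) := KK_int.comp_smul (by positivity)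
  have hFi : Integrable F := by
    refine hKi.bdd_mul (c := (Real.toNNReal (3 * L) * D : ℝ≥0)) (grad_meas g i).abs.aestronglyMeasurable
      (Filter.Eventually.of_forall fun z => ?_)
    rw [Real.norm_eq_abs, abs_abs]; exact grad_bound hgl _ _
  have hGG : |GG g i ε0| ≤ (ε0 ^ 3)⁻¹ * ∫ y, F y := by
    rw [GG_eq hgl i hε0]
    have h1 := Measure.integral_comp_smul (volume : Measure (Fin 3 → ℝ)) F ε0
    have h2 : (fun z => F (ε0 • z)) = fun z => |grad3 g (ε0 • z) i| * KK z := by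
      funext z
      simp only [hFd, smul_smul, inv_mul_cancel₀ hε0.ne', one_smul]
    have h8 : Module.finrank ℝ (Fin 3 → ℝ) = 3 := by simp
    rw [h2, h8, abs_of_pos (by positivity : 0 < (ε0 ^ 3)⁻¹), smul_eq_mul] at h1
    rw [← h1]
    refine (abs_integral_le_integral_abs).trans (le_of_eq ?_)
    congr 1; funext z
    rw [abs_mul, abs_of_nonneg (KK_nonneg z)]
  refine hGG.trans ?_
  set I := ∫ z in HS n d ∩ B3 ε0, ∑ j, |grad3 v z j| with hI
  have hBsub : HS n d ∩ B3 ε0 ⊆ S := by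
    refine inter_subset_inter_right _ fun z hz => ?_
    have : sq3 z < ε0 ^ 2 := hz
    change sq3 z < δ ^ 2
    exact this.trans_le (by gcongr)
  have hms : MeasurableSet (HS n d ∩ B3 ε0) := ((HS_open n d).inter (B3_open ε0)).measurableSet
  have hIi : IntegrableOn (fun z => ∑ j, |grad3 v z j|) (HS n d ∩ B3 ε0) := by
    have hfin : volume (HS n d ∩ B3 ε0) < ⊤ := (measure_mono inter_subset_right).trans_lt (B3_vol ε0)
    refine Measure.integrableOn_of_bounded (M := 3 * L) hfin.ne ?_ ?_
    · exact (Finset.measurable_sum _ fun j _ => (grad_meas v j).abs).aestronglyMeasurable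
    · filter_upwards [ae_restrict_mem hms] with z hz
      have := hL z (hBsub hz)
      rw [Real.norm_eq_abs, abs_of_nonneg (by positivity), Fin.sum_univ_three]
      linarith [this 0, this 1, this 2]
  have hbd : ∀ c : ℝ, ∀ G : (Fin 3 → ℝ) → ℝ, 0 ≤ c → IntegrableOn G (HS n d) →
      (∀ z ∈ HS n d ∩ B3 ε0, G z ≤ c * ∑ j, |grad3 v z j|) →
      (∀ z ∈ HS n d, z ∉ B3 ε0 → G z = 0) → ∫ z in HS n d, G z ≤ c * I := by
    intro c G hc0 hGi h1 h2
    have : ∫ z in HS n d, G z = ∫ z in HS n d ∩ B3 ε0, G z := by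
      refine (setIntegral_eq_of_subset_of_forall_sdiff_eq_zero (HS_open n d).measurableSet
        inter_subset_left ?_)
      rintro z ⟨hz, hz2⟩
      exact h2 z hz fun h => hz2 ⟨hz, h⟩
    rw [this, hI, ← integral_const_mul]
    exact setIntegral_mono_on (hGi.mono_set inter_subset_left) (hIi.const_mul c) hms h1
  have hKz : ∀ z, ε0 ^ 2 ≤ sq3 z → KK (ε0⁻¹ • z) = 0 := fun z h => by
    apply KK_zero
    rw [sq3_smul, inv_pow, inv_mul_eq_div, one_le_div (by positivity)]; exact h
  rw [integral_split hn d hFi]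
  have b1 : ∫ z in HS n d, F z ≤ 1 * I := by
    refine hbd 1 _ (by norm_num) hFi.integrableOn ?_ ?_
    · intro z hz
      rw [hFd]; simp only
      rw [g1 z (hBsub hz), one_mul]
      have h1 : |grad3 v z i| ≤ ∑ j, |grad3 v z j| :=
        Finset.single_le_sum (f := fun j => |grad3 v z j|) (fun j _ => abs_nonneg _) (Finset.mem_univ i)
      exact (mul_le_of_le_one_right (abs_nonneg _) (KK_le_one _)).trans h1
    · intro z _ hz
      rw [hFd]; simp only
      rw [hKz z (not_lt.1 hz), mul_zero]
  have b2 : ∫ z in HS n d, F (ref n d z) ≤ 3 * I := by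
    refine hbd 3 _ (by norm_num) ?_ ?_ ?_
    · have := (integrableOn_image_iff_integrableOn_abs_det_fderiv_smul volume
          (HS_open n d).measurableSet (fun y _ => (ref_hasFDerivAt n d y).hasFDerivWithinAt)
          (fun x _ y _ h => by rw [← ref_ref hn d x, h, ref_ref hn d y]) F).1 hFi.integrableOn
      simpa [RL_det hn] using this
    · intro z hz
      rw [hFd]; simp only
      rw [g2 z (hBsub hz)]
      refine (mul_le_of_le_one_right (abs_nonneg _) (KK_le_one _)).trans ?_
      rw [Finset.mul_sum]
      refine (Finset.abs_sum_le_sum_abs _ _).trans (Finset.sum_le_sum fun k _ => ?_)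
      rw [abs_mul, mul_comm]
      exact mul_le_mul_of_nonneg_right (RM_bd hn _ _) (abs_nonneg _)
    · intro z hz hz2
      rw [hFd]; simp only
      rw [hKz _ ((not_lt.1 hz2).trans (href_ge z hz)), mul_zero]
  have hI0 : 0 ≤ I := by
    rw [hI]; exact integral_nonneg fun z => Finset.sum_nonneg fun j _ => abs_nonneg _
  calc _ ≤ (ε0 ^ 3)⁻¹ * (10 * I) := by gcongr; linarith
    _ = _ := by ring
end

section
/-- affine normalization of the chart at the base point `o` -/
noncomputable def aff (f : ℝ → ℝ → ℝ) (o z : Fin 3 → ℝ) : Fin 3 → ℝ :=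
  ![o 0 + z 0 - p1 f (o 1) (o 2) * z 1 - rho f o * p2 f (o 1) (o 2) * z 2, o 1 + z 1, o 2 + rho f o * z 2]

/-- inverse of `aff` -/
noncomputable def affInv (f : ℝ → ℝ → ℝ) (o y : Fin 3 → ℝ) : Fin 3 → ℝ :=
  ![(y 0 - o 0) + p1 f (o 1) (o 2) * (y 1 - o 1) + p2 f (o 1) (o 2) * (y 2 - o 2), y 1 - o 1,
    (y 2 - o 2) / rho f o]

/-- matrix of `aff` -/
noncomputable def AM (f : ℝ → ℝ → ℝ) (o : Fin 3 → ℝ) : Matrix (Fin 3) (Fin 3) ℝ :=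
  !![1, - p1 f (o 1) (o 2), - (rho f o * p2 f (o 1) (o 2)); 0, 1, 0; 0, 0, rho f o]

/-- linear part of `aff` -/
noncomputable def AL (f : ℝ → ℝ → ℝ) (o : Fin 3 → ℝ) : (Fin 3 → ℝ) →L[ℝ] (Fin 3 → ℝ) :=
  LinearMap.toContinuousLinearMap (Matrix.toLin' (AM f o))

/-- normalized chart -/
noncomputable def PH (f : ℝ → ℝ → ℝ) (o z : Fin 3 → ℝ) : Fin 3 → ℝ := Th f (aff f o z)

/-- window of the normalized chart, without the boundary constraint -/
def ZU (f : ℝ → ℝ → ℝ) (K : ℝ) (o : Fin 3 → ℝ) : Set (Fin 3 → ℝ) :=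
  {z | |z 1| < π ∧ K < o 2 + rho f o * z 2}

/-- window of the normalized chart -/
def ZW (f : ℝ → ℝ → ℝ) (K : ℝ) (o : Fin 3 → ℝ) : Set (Fin 3 → ℝ) :=
  {z | aff f o z 0 < 0 ∧ z ∈ ZU f K o}

namespace FN
variable {K a C₀ : ℝ} {f : ℝ → ℝ → ℝ}

lemma aff_eq (f : ℝ → ℝ → ℝ) (o z : Fin 3 → ℝ) : aff f o z = AL f o z + o := by
  funext i
  simp only [aff, AL, AM, LinearMap.coe_toContinuousLinearMap', Matrix.toLin'_apply, Matrix.mulVec,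
    dotProduct, Fin.sum_univ_three, Pi.add_apply]
  fin_cases i <;> simp <;> ring

lemma aff_hasFDerivAt (f : ℝ → ℝ → ℝ) (o z : Fin 3 → ℝ) : HasFDerivAt (aff f o) (AL f o) z := by
  have : aff f o = fun z => AL f o z + o := by funext z; exact aff_eq f o z
  rw [this]; exact (AL f o).hasFDerivAt.add_const _

lemma aff_cont (f : ℝ → ℝ → ℝ) (o : Fin 3 → ℝ) : Continuous (aff f o) :=
  continuous_iff_continuousAt.2 fun z => (aff_hasFDerivAt f o z).continuousAt

lemma AL_det (f : ℝ → ℝ → ℝ) (o : Fin 3 → ℝ) : (AL f o).det = rho f o := by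
  have : (AL f o).det = (AM f o).det := by
    rw [AL, ContinuousLinearMap.det, LinearMap.coe_toContinuousLinearMap, LinearMap.det_toLin']
  rw [this, Matrix.det_fin_three]; simp [AM]

lemma affInv_aff (h : FN K a C₀ f) {o : Fin 3 → ℝ} (ho : K < o 2) (z : Fin 3 → ℝ) :
    affInv f o (aff f o z) = z := by
  have := (h.rho_pos ho).ne'
  funext i; fin_cases i
  · simp [affInv, aff]; ring
  · simp [affInv, aff]
  · simp [affInv, aff]; field_simp

lemma aff_affInv (h : FN K a C₀ f) {o : Fin 3 → ℝ} (ho : K < o 2) (z : Fin 3 → ℝ) :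
    aff f o (affInv f o z) = z := by
  have := (h.rho_pos ho).ne'
  funext i; fin_cases i
  · simp [affInv, aff]; field_simp; ring
  · simp [affInv, aff]
  · simp [affInv, aff]; field_simp; ring

lemma affInv_contDiff (f : ℝ → ℝ → ℝ) (o : Fin 3 → ℝ) : ContDiff ℝ 2 (affInv f o) := by
  rw [contDiff_pi]
  intro i; fin_cases i <;> simp [affInv] <;> fun_prop

lemma isOpen_ZU (f : ℝ → ℝ → ℝ) (K : ℝ) (o : Fin 3 → ℝ) : IsOpen (ZU f K o) :=
  (isOpen_lt (f := fun z : Fin 3 → ℝ => |z 1|) (by fun_prop) continuous_const).inter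
    (isOpen_lt (g := fun z : Fin 3 → ℝ => o 2 + rho f o * z 2) continuous_const (by fun_prop))

lemma isOpen_ZW (f : ℝ → ℝ → ℝ) (K : ℝ) (o : Fin 3 → ℝ) : IsOpen (ZW f K o) := by
  have h1 : IsOpen {z | aff f o z 0 < 0} :=
    isOpen_lt ((continuous_apply 0).comp (aff_cont f o)) continuous_const
  exact h1.inter (isOpen_ZU f K o)

lemma image_ZW (h : FN K a C₀ f) {o : Fin 3 → ℝ} (ho : K < o 2) : aff f o '' ZW f K o = Wn K (o 1) := by
  ext y
  constructor
  · rintro ⟨z, ⟨h0, h1, h2⟩, rfl⟩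
    exact ⟨h0, by simpa [aff] using h1, by simpa [aff] using h2⟩
  · rintro ⟨h0, h1, h2⟩
    have e := h.aff_affInv ho y
    refine ⟨affInv f o y, ⟨by rw [e]; exact h0, by simpa [affInv] using h1, ?_⟩, e⟩
    have := congrFun e 2
    simp only [aff, Matrix.cons_val] at this
    rw [this]; exact h2

lemma integral_PH (h : FN K a C₀ f) {o : Fin 3 → ℝ} (ho : K < o 2) (G : (Fin 3 → ℝ) → ℝ) :
    ∫ x in nozzleFrom f K, G x = ∫ z in ZW f K o, rho f o * (rho f (aff f o z) ^ 2 * G (PH f o z)) := by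
  have hinj : InjOn (aff f o) (ZW f K o) := fun x _ y _ e => by
    rw [← h.affInv_aff ho x, e, h.affInv_aff ho y]
  rw [h.integral_chart (o 1), ← h.image_ZW ho,
    integral_image_eq_integral_abs_det_fderiv_smul volume (isOpen_ZW f K o).measurableSet
    (fun y _ => (aff_hasFDerivAt f o y).hasFDerivWithinAt) hinj]
  simp only [AL_det, abs_of_pos (h.rho_pos ho), smul_eq_mul, PH]

lemma integrable_PH (h : FN K a C₀ f) {o : Fin 3 → ℝ} (ho : K < o 2) (G : (Fin 3 → ℝ) → ℝ) :
    IntegrableOn G (nozzleFrom f K) ↔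
      IntegrableOn (fun z => rho f o * (rho f (aff f o z) ^ 2 * G (PH f o z))) (ZW f K o) := by
  have hinj : InjOn (aff f o) (ZW f K o) := fun x _ y _ e => by
    rw [← h.affInv_aff ho x, e, h.affInv_aff ho y]
  rw [h.integrable_chart (o 1), ← h.image_ZW ho,
    integrableOn_image_iff_integrableOn_abs_det_fderiv_smul volume (isOpen_ZW f K o).measurableSet
    (fun y _ => (aff_hasFDerivAt f o y).hasFDerivWithinAt) hinj]
  simp only [AL_det, abs_of_pos (h.rho_pos ho), smul_eq_mul, PH]

lemma aff_two (f : ℝ → ℝ → ℝ) (o z : Fin 3 → ℝ) : aff f o z 2 = o 2 + rho f o * z 2 := by simp [aff]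

lemma PH_hasFDerivAt (h : FN K a C₀ f) {o z : Fin 3 → ℝ} (hz : K < o 2 + rho f o * z 2) :
    HasFDerivAt (PH f o) ((DTh f (aff f o z)).comp (AL f o)) z := by
  have h1 : K < aff f o z 2 := by rw [aff_two]; exact hz
  exact HasFDerivAt.comp z (h.hasFDerivAt_Th h1) (aff_hasFDerivAt f o z)

lemma PH_contOn (h : FN K a C₀ f) (o : Fin 3 → ℝ) : ContinuousOn (PH f o) (ZU f K o) :=
  fun _ hz => (h.PH_hasFDerivAt hz.2).continuousAt.continuousWithinAt

/-- gradient in the normalized chart -/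
lemma grad_PH (h : FN K a C₀ f) {o z : Fin 3 → ℝ} (hz : K < o 2 + rho f o * z 2)
    {u : (Fin 3 → ℝ) → ℝ} (hu : DifferentiableAt ℝ u (PH f o z)) :
    grad3 (fun z => u (PH f o z)) z 0 = PH f o z 0 * grad3 u (PH f o z) 0 + PH f o z 1 * grad3 u (PH f o z) 1 ∧
    grad3 (fun z => u (PH f o z)) z 1 =
      (p1 f (aff f o z 1) (aff f o z 2) - p1 f (o 1) (o 2)) * grad3 (fun z => u (PH f o z)) z 0
      + (- PH f o z 1 * grad3 u (PH f o z) 0 + PH f o z 0 * grad3 u (PH f o z) 1) ∧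
    grad3 (fun z => u (PH f o z)) z 2 =
      rho f o * (p2 f (aff f o z 1) (aff f o z 2) - p2 f (o 1) (o 2)) * grad3 (fun z => u (PH f o z)) z 0
      + rho f o * grad3 u (PH f o z) 2 := by
  have h1 := (HasFDerivAt.comp z hu.hasFDerivAt (h.PH_hasFDerivAt hz)).fderiv
  have e : fderiv ℝ (fun z => u (PH f o z)) z = _ := h1
  have key : ∀ j, grad3 (fun z => u (PH f o z)) z j =
      ∑ k, grad3 u (PH f o z) k * (MTh f (aff f o z) * AM f o) k j := by
    intro j
    rw [grad3, e, ContinuousLinearMap.comp_apply, fderiv_eq_sum]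
    refine Finset.sum_congr rfl fun k _ => ?_
    congr 1
    simp [DTh, AL, Matrix.mul_apply, Matrix.mulVec, dotProduct]
  rw [key 0, key 1, key 2]
  simp only [Fin.sum_univ_three, Matrix.mul_apply, MTh, AM, PH]
  refine ⟨?_, ?_, ?_⟩ <;> simp <;> ring

lemma ThInv_contDiffAt (h : FN K a C₀ f) {τ0 : ℝ} {x : Fin 3 → ℝ} (hx : zet τ0 x ∈ Complex.slitPlane)
    (hK : K < x 2) : ContDiffAt ℝ 2 (ThInv f τ0) x := by
  have ha := ang_contDiffAt τ0 x hx
  have hr : 0 < rad x := by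
    rw [Complex.mem_slitPlane_iff_arg, ← norm_ne_zero_iff, norm_zet] at hx
    exact lt_of_le_of_ne (rad_nonneg x) hx.2.symm
  have h2 : ContDiffAt ℝ 2 (fun x : Fin 3 → ℝ => x 2) x :=
    (contDiff_apply ℝ ℝ (2 : Fin 3)).contDiffAt
  have hf : ContDiffAt ℝ 2 (fun x : Fin 3 → ℝ => f (ang τ0 x) (x 2)) x := by
    have h1 : ContDiffAt ℝ 2 (fun p : ℝ × ℝ => f p.1 p.2) (ang τ0 x, x 2) :=
      h.c2.contDiffAt ((isOpenS K).mem_nhds hK)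
    exact ContDiffAt.comp (g := fun p : ℝ × ℝ => f p.1 p.2)
        (f := fun x : Fin 3 → ℝ => (ang τ0 x, x 2)) x h1 (ha.prodMk h2)
  have hrad : ContDiffAt ℝ 2 rad x := by
    unfold rad
    refine ContDiffAt.sqrt (by fun_prop) ?_
    rw [rad] at hr
    exact (Real.sqrt_pos.1 hr).ne'
  rw [contDiffAt_pi]
  intro i; fin_cases i
  · exact (hrad.div hf (h.fpos _ hK).ne').log (div_pos hr (h.fpos _ hK)).ne'
  · exact ha
  · exact h2

lemma PH_slit (h : FN K a C₀ f) {o z : Fin 3 → ℝ} (hz : z ∈ ZU f K o) :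
    zet (o 1) (PH f o z) ∈ Complex.slitPlane := by
  have h2 : K < aff f o z 2 := by rw [aff_two]; exact hz.2
  have h1 : |aff f o z 1 - o 1| < π := by simpa [aff] using hz.1
  rw [Complex.mem_slitPlane_iff_arg, ← norm_ne_zero_iff, norm_zet, PH, h.rad_Th h2]
  refine ⟨?_, (h.rho_pos h2).ne'⟩
  have := h.ang_Th h2 h1
  rw [ang] at this
  rw [abs_lt] at h1
  intro h3; linarith

lemma exists_test (h : FN K a C₀ f) {o : Fin 3 → ℝ} (ho : K < o 2) {Ψ : (Fin 3 → ℝ) → ℝ}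
    (hΨ : ContDiff ℝ 1 Ψ) (hc : HasCompactSupport Ψ) (hs : tsupport Ψ ⊆ ZU f K o) :
    ∃ ψ : (Fin 3 → ℝ) → ℝ, ContDiff ℝ 1 ψ ∧ HasCompactSupport ψ ∧
      tsupport ψ ⊆ {x : Fin 3 → ℝ | K < x 2} ∧ ∀ z ∈ ZU f K o, ψ (PH f o z) = Ψ z := by
  classical
  set S : Set (Fin 3 → ℝ) := {x | zet (o 1) x ∈ Complex.slitPlane ∧ K < x 2} with hS
  have hSo : IsOpen S := (Complex.isOpen_slitPlane.preimage (zet_cont (o 1))).inter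
    (isOpen_lt continuous_const (continuous_apply 2))
  set I : (Fin 3 → ℝ) → (Fin 3 → ℝ) := fun x => affInv f o (ThInv f (o 1) x) with hI
  have hIP : ∀ z ∈ ZU f K o, I (PH f o z) = z := by
    intro z hz
    have h2 : K < aff f o z 2 := by rw [aff_two]; exact hz.2
    have h1 : |aff f o z 1 - o 1| < π := by simpa [aff] using hz.1
    rw [hI]; simp only
    rw [PH, h.leftInv h2 h1, h.affInv_aff ho]
  have hPI : ∀ x ∈ S, PH f o (I x) = x := by
    intro x hx
    have hr : 0 < rad x := by
      have := hx.1
      rw [Complex.mem_slitPlane_iff_arg, ← norm_ne_zero_iff, norm_zet] at this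
      exact lt_of_le_of_ne (rad_nonneg x) this.2.symm
    rw [hI, PH]; simp only
    rw [h.aff_affInv ho, h.rightInv hx.2 hr]
  have hPS : ∀ z ∈ ZU f K o, PH f o z ∈ S := fun z hz =>
    ⟨h.PH_slit hz, by have := hz.2; rw [← aff_two] at this; exact this⟩
  set N := PH f o '' tsupport Ψ with hN
  have hNc : IsCompact N := IsCompact.image_of_continuousOn hc ((h.PH_contOn o).mono hs)
  set ψ : (Fin 3 → ℝ) → ℝ := fun x => if x ∈ S then Ψ (I x) else 0 with hψ
  have hz0 : ∀ x, x ∉ N → ψ x = 0 := by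
    intro x hx
    rw [hψ]; simp only
    split_ifs with hxS
    · by_contra hne
      exact hx ⟨I x, subset_tsupport _ hne, hPI x hxS⟩
    · rfl
  have hNS : N ⊆ S := by
    rintro _ ⟨z, hz, rfl⟩
    exact hPS z (hs hz)
  have hts : tsupport ψ ⊆ N := closure_minimal
    (fun x hx => by by_contra hc; exact hx (hz0 x hc)) hNc.isClosed
  refine ⟨ψ, ?_, ?_, fun x hx => (hNS (hts hx)).2, ?_⟩
  · rw [contDiff_iff_contDiffAt]
    intro x
    by_cases hx : x ∈ S
    · have : ψ =ᶠ[nhds x] fun x => Ψ (I x) := by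
        filter_upwards [hSo.mem_nhds hx] with y hy
        rw [hψ]; simp only
        rw [if_pos hy]
      refine ContDiffAt.congr_of_eventuallyEq ?_ this
      refine ContDiffAt.comp x hΨ.contDiffAt ?_
      exact ((affInv_contDiff f o).contDiffAt.comp x (h.ThInv_contDiffAt hx.1 hx.2)).of_le (by norm_num)
    · have : ψ =ᶠ[nhds x] fun _ => 0 := by
        filter_upwards [hNc.isClosed.isOpen_compl.mem_nhds (fun hc => hx (hNS hc))] with y hy
        exact hz0 y hy
      exact contDiffAt_const.congr_of_eventuallyEq this
  · exact HasCompactSupport.intro hNc fun x hx => hz0 x hx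
  · intro z hz
    rw [hψ]; simp only
    rw [if_pos (hPS z hz), hIP z hz]

end FN
end

section
/-- a point of ℝ³ from a cross-section point and a height -/
def sn (x' : Fin 2 → ℝ) (t : ℝ) : Fin 3 → ℝ := Fin.snoc x' t

lemma sn_zero (x' : Fin 2 → ℝ) (t : ℝ) : sn x' t 0 = x' 0 := rfl
lemma sn_one (x' : Fin 2 → ℝ) (t : ℝ) : sn x' t 1 = x' 1 := rfl
lemma sn_two (x' : Fin 2 → ℝ) (t : ℝ) : sn x' t 2 = t := rfl

lemma sn_eq : (fun p : ℝ × (Fin 2 → ℝ) => sn p.2 p.1) =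
    (MeasurableEquiv.piFinSuccAbove (fun _ : Fin 3 => ℝ) (Fin.last 2)).symm := by
  funext p
  exact (Fin.insertNth_last' p.1 p.2).symm

lemma sn_mp : MeasurePreserving (fun p : ℝ × (Fin 2 → ℝ) => sn p.2 p.1) (volume.prod volume) volume := by
  rw [sn_eq]
  exact (volume_preserving_piFinSuccAbove (fun _ : Fin 3 => ℝ) (Fin.last 2)).symm

lemma sn_me : MeasurableEmbedding (fun p : ℝ × (Fin 2 → ℝ) => sn p.2 p.1) := by
  rw [sn_eq]
  exact (MeasurableEquiv.piFinSuccAbove (fun _ : Fin 3 => ℝ) (Fin.last 2)).symm.measurableEmbedding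

lemma fub_int {G : (Fin 3 → ℝ) → ℝ} (hG : Integrable G) :
    Integrable (fun p : ℝ × (Fin 2 → ℝ) => G (sn p.2 p.1)) (volume.prod volume) :=
  (sn_mp.integrable_comp_emb sn_me).2 hG

lemma fub_t {G : (Fin 3 → ℝ) → ℝ} (hG : Integrable G) :
    ∫ x, G x = ∫ t, ∫ x' : Fin 2 → ℝ, G (sn x' t) := by
  rw [← sn_mp.integral_comp sn_me, integral_prod _ (fub_int hG)]

lemma fub_x {G : (Fin 3 → ℝ) → ℝ} (hG : Integrable G) :
    ∫ x, G x = ∫ x' : Fin 2 → ℝ, ∫ t, G (sn x' t) := by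
  rw [← sn_mp.integral_comp sn_me, integral_prod_symm _ (fub_int hG)]

lemma fub_ae {G : (Fin 3 → ℝ) → ℝ} (hG : Integrable G) :
    ∀ᵐ x' : Fin 2 → ℝ, Integrable (fun t => G (sn x' t)) :=
  (fub_int hG).prod_left_ae

lemma int_d2 {K τ0 t1 t2 : ℝ} {H G : (Fin 3 → ℝ) → ℝ} (ht1 : K < t1)
    (hG : IntegrableOn G (Wn K τ0))
    (hd : ∀ x' : Fin 2 → ℝ, x' 0 < 0 → ∀ t, K < t → HasDerivAt (fun t => H (sn x' t)) (G (sn x' t)) t)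
    (hz : ∀ x' : Fin 2 → ℝ, x' 0 < 0 → ∀ t, K < t → (t < t1 ∨ t2 < t) → H (sn x' t) = 0) :
    ∫ y in Wn K τ0, G y = 0 := by
  classical
  rw [← integral_indicator (FN.isOpen_Wn K τ0).measurableSet]
  rw [← integrable_indicator_iff (FN.isOpen_Wn K τ0).measurableSet] at hG
  rw [fub_x hG]
  refine integral_eq_zero_of_ae ?_
  filter_upwards [fub_ae hG] with x' hx'
  by_cases hS : x' 0 < 0 ∧ |x' 1 - τ0| < π
  swap
  · simp only [Pi.zero_apply]
    rw [← integral_zero ℝ ℝ]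
    congr 1; funext t
    rw [indicator_of_notMem]
    rintro ⟨h0, h1, _⟩
    exact hS ⟨h0, h1⟩
  set g : ℝ → ℝ := fun t => if K < t then H (sn x' t) else 0 with hg
  have hder : ∀ t, HasDerivAt g ((Wn K τ0).indicator G (sn x' t)) t := by
    intro t
    by_cases ht : K < t
    · rw [indicator_of_mem (show sn x' t ∈ Wn K τ0 from ⟨hS.1, hS.2, ht⟩)]
      refine (hd x' hS.1 t ht).congr_of_eventuallyEq ?_
      filter_upwards [lt_mem_nhds ht] with s hs
      rw [hg]; simp only [if_pos hs]
    · rw [indicator_of_notMem (fun hc => ht hc.2.2)]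
      refine (hasDerivAt_const t (0:ℝ)).congr_of_eventuallyEq ?_
      filter_upwards [gt_mem_nhds (lt_of_le_of_lt (not_lt.1 ht) ht1)] with s hs
      rw [hg]; simp only
      split_ifs with h
      · exact hz x' hS.1 s h (Or.inl hs)
      · rfl
  have hgc : Continuous g := continuous_iff_continuousAt.2 fun t => (hder t).continuousAt
  have hgs : HasCompactSupport g := by
    refine HasCompactSupport.intro (isCompact_Icc (a := t1) (b := t2)) fun t ht => ?_
    rw [hg]; simp only
    split_ifs with h
    · refine hz x' hS.1 t h ?_
      by_contra hc
      push Not at hc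
      exact ht hc
    · rfl
  exact integral_eq_zero_of_hasDerivAt_of_integrable hder hx' (hgc.integrable_of_hasCompactSupport hgs)
end

section
/-- test functions on the nozzle, supported in a slab -/
structure TS (f : ℝ → ℝ → ℝ) (K : ℝ) (ψ : (Fin 3 → ℝ) → ℝ) (t1 t2 B : ℝ) : Prop where
  lt : K < t1
  diff : ∀ x ∈ nozzleFrom f K, DifferentiableAt ℝ ψ x
  bd0 : ∀ x ∈ nozzleFrom f K, |ψ x| ≤ B
  bd : ∀ x ∈ nozzleFrom f K, ∀ j, |grad3 ψ x j| ≤ B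
  zero : ∀ x ∈ nozzleFrom f K, (x 2 < t1 ∨ t2 < x 2) → ψ x = 0

/-- `p2` as a function of the point -/
noncomputable def P2 (f : ℝ → ℝ → ℝ) (τ0 : ℝ) (x : Fin 3 → ℝ) : ℝ := p2 f (ang τ0 x) (x 2)

/-- `f` as a function of the point -/
noncomputable def FF (f : ℝ → ℝ → ℝ) (τ0 : ℝ) (x : Fin 3 → ℝ) : ℝ := f (ang τ0 x) (x 2)

namespace FN
variable {K a C₀ : ℝ} {f : ℝ → ℝ → ℝ}

lemma rad_le (h : FN K a C₀ f) {x : Fin 3 → ℝ} (hx : x ∈ nozzleFrom f K) : rad x ≤ C₀ := by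
  have := (h.mem_iff 0 x).1 hx
  linarith [(h.rng (ang 0 x) (x 2) this.1).2]

lemma abs0_le_rad (x : Fin 3 → ℝ) : |x 0| ≤ rad x := by
  rw [rad]; exact Real.abs_le_sqrt (by nlinarith [sq_nonneg (x 1)])

lemma abs1_le_rad (x : Fin 3 → ℝ) : |x 1| ≤ rad x := by
  rw [rad]; exact Real.abs_le_sqrt (by nlinarith [sq_nonneg (x 0)])

lemma slab_fin (h : FN K a C₀ f) (t1 t2 : ℝ) :
    volume (nozzleFrom f K ∩ {x | t1 ≤ x 2 ∧ x 2 ≤ t2}) < ⊤ := by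
  have hs : nozzleFrom f K ∩ {x | t1 ≤ x 2 ∧ x 2 ≤ t2} ⊆ Icc ![-C₀, -C₀, t1] ![C₀, C₀, t2] := by
    rintro x ⟨hx, h1, h2⟩
    have e0 := abs_le.1 ((abs0_le_rad x).trans (h.rad_le hx))
    have e1 := abs_le.1 ((abs1_le_rad x).trans (h.rad_le hx))
    constructor <;> intro i <;> fin_cases i <;> simp <;> linarith
  exact (measure_mono hs).trans_lt isCompact_Icc.measure_lt_top

lemma int_slab (h : FN K a C₀ f) {G : (Fin 3 → ℝ) → ℝ} {t1 t2 B : ℝ}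
    (hm : AEStronglyMeasurable G (volume.restrict (nozzleFrom f K)))
    (hb : ∀ x ∈ nozzleFrom f K, |G x| ≤ B)
    (hz : ∀ x ∈ nozzleFrom f K, (x 2 < t1 ∨ t2 < x 2) → G x = 0) : IntegrableOn G (nozzleFrom f K) := by
  have hms : MeasurableSet {x : Fin 3 → ℝ | t1 ≤ x 2 ∧ x 2 ≤ t2} :=
    (measurableSet_le measurable_const (measurable_pi_apply 2)).inter
      (measurableSet_le (measurable_pi_apply 2) measurable_const)
  have h1 : IntegrableOn G (nozzleFrom f K ∩ {x | t1 ≤ x 2 ∧ x 2 ≤ t2}) := by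
    have : IsFiniteMeasure (volume.restrict (nozzleFrom f K ∩ {x | t1 ≤ x 2 ∧ x 2 ≤ t2})) :=
      ⟨by simpa using h.slab_fin t1 t2⟩
    refine Integrable.of_bound (C := B) ?_ ?_
    · exact hm.mono_measure (Measure.restrict_mono inter_subset_left le_rfl)
    · filter_upwards [ae_restrict_mem (h.meas_noz.inter hms)] with x hx
      exact hb x hx.1
  refine IntegrableOn.of_forall_sdiff_eq_zero h1 h.meas_noz ?_
  rintro x ⟨hx, hn⟩
  refine hz x hx ?_
  by_contra hc
  push Not at hc
  exact hn ⟨hx, hc⟩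

lemma meas_ang (h : FN K a C₀ f) (τ0 : ℝ) {g : ℝ × ℝ → ℝ} (hg : ContinuousOn g {p | K < p.2}) :
    AEStronglyMeasurable (fun x => g (ang τ0 x, x 2)) (volume.restrict (nozzleFrom f K)) := by
  have hS : (nozzleFrom f K ∩ {x | zet τ0 x ∈ Complex.slitPlane} : Set (Fin 3 → ℝ)) =ᵐ[volume] nozzleFrom f K := by
    refine inter_ae_eq_left_of_ae_eq_univ ?_
    rw [ae_eq_univ]
    exact null_slit τ0
  rw [← Measure.restrict_congr_set hS]
  refine ContinuousOn.aestronglyMeasurable ?_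
    (h.isOpen_noz.inter (Complex.isOpen_slitPlane.preimage (zet_cont τ0))).measurableSet
  have hc : ContinuousOn (fun x : Fin 3 → ℝ => (ang τ0 x, x 2))
      (nozzleFrom f K ∩ {x | zet τ0 x ∈ Complex.slitPlane}) :=
    ContinuousOn.prodMk (fun x hx => (ang_contDiffAt τ0 x hx.2).continuousAt.continuousWithinAt)
      (continuous_apply 2).continuousOn
  exact hg.comp hc fun x hx => hx.1.1

lemma P2_meas (h : FN K a C₀ f) (τ0 : ℝ) :
    AEStronglyMeasurable (P2 f τ0) (volume.restrict (nozzleFrom f K)) := h.meas_ang τ0 h.p2_cont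

lemma FF_meas (h : FN K a C₀ f) (τ0 : ℝ) :
    AEStronglyMeasurable (FF f τ0) (volume.restrict (nozzleFrom f K)) := h.meas_ang τ0 h.c2.continuousOn

lemma sn_hasDerivAt (x' : Fin 2 → ℝ) (t : ℝ) : HasDerivAt (fun t => sn x' t) (Pi.single 2 1) t := by
  rw [hasDerivAt_pi]
  intro i
  fin_cases i
  · simpa [sn_zero] using hasDerivAt_const t (x' 0)
  · simpa [sn_one] using hasDerivAt_const t (x' 1)
  · simpa [sn_two] using hasDerivAt_id' t

lemma Th_curve (h : FN K a C₀ f) (x' : Fin 2 → ℝ) {t : ℝ} (ht : K < t) {ψ : (Fin 3 → ℝ) → ℝ}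
    (hψ : DifferentiableAt ℝ ψ (Th f (sn x' t))) :
    HasDerivAt (fun t => ψ (Th f (sn x' t)))
      (p2 f (x' 1) t * (Th f (sn x' t) 0 * grad3 ψ (Th f (sn x' t)) 0
        + Th f (sn x' t) 1 * grad3 ψ (Th f (sn x' t)) 1) + grad3 ψ (Th f (sn x' t)) 2) t := by
  have h1 := (h.hasFDerivAt_Th (y := sn x' t) ht).comp_hasDerivAt t (sn_hasDerivAt x' t)
  have h2 := hψ.hasFDerivAt.comp_hasDerivAt t h1
  refine h2.congr_deriv ?_
  rw [fderiv_eq_sum]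
  simp only [Fin.sum_univ_three, DTh, MTh, LinearMap.coe_toContinuousLinearMap', Matrix.toLin'_apply,
    Matrix.mulVec_single_one]
  simp [grad3, sn_one, sn_two, Matrix.col_apply]
  ring

lemma rho_curve (h : FN K a C₀ f) (x' : Fin 2 → ℝ) {t : ℝ} (ht : K < t) :
    HasDerivAt (fun t => rho f (sn x' t)) (p2 f (x' 1) t * rho f (sn x' t)) t := by
  have h1 := (h.hasFDerivAt_rho (y := sn x' t) ht).comp_hasDerivAt t (sn_hasDerivAt x' t)
  refine h1.congr_deriv ?_
  simp [sn_one, sn_two]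
  ring


lemma TS_grad_zero (h : FN K a C₀ f) {ψ : (Fin 3 → ℝ) → ℝ} {t1 t2 B : ℝ} (hψ : TS f K ψ t1 t2 B)
    {x : Fin 3 → ℝ} (hx : x ∈ nozzleFrom f K) (hx2 : x 2 < t1 ∨ t2 < x 2) (j : Fin 3) :
    grad3 ψ x j = 0 := by
  have : ψ =ᶠ[nhds x] fun _ => 0 := by
    have ho : IsOpen {y : Fin 3 → ℝ | y 2 < t1 ∨ t2 < y 2} :=
      (isOpen_lt (continuous_apply 2) continuous_const).union (isOpen_lt continuous_const (continuous_apply 2))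
    filter_upwards [ho.mem_nhds hx2, h.isOpen_noz.mem_nhds hx] with y hy1 hy2
    exact hψ.zero y hy2 hy1
  rw [grad3, this.fderiv_eq]; simp

lemma TS_meas (h : FN K a C₀ f) {ψ : (Fin 3 → ℝ) → ℝ} {t1 t2 B : ℝ} (hψ : TS f K ψ t1 t2 B) :
    AEStronglyMeasurable ψ (volume.restrict (nozzleFrom f K)) :=
  ContinuousOn.aestronglyMeasurable (fun x hx => (hψ.diff x hx).continuousAt.continuousWithinAt) h.meas_noz

lemma grad_aesm (g : (Fin 3 → ℝ) → ℝ) (i : Fin 3) (S : Set (Fin 3 → ℝ)) :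
    AEStronglyMeasurable (fun x => grad3 g x i) (volume.restrict S) := (grad_meas g i).aestronglyMeasurable

lemma coord_aesm (i : Fin 3) (S : Set (Fin 3 → ℝ)) :
    AEStronglyMeasurable (fun x : Fin 3 → ℝ => x i) (volume.restrict S) := (measurable_pi_apply i).aestronglyMeasurable

/-- bound on the axial combination -/
lemma comb_bd (h : FN K a C₀ f) {ψ : (Fin 3 → ℝ) → ℝ} {t1 t2 B : ℝ} (hψ : TS f K ψ t1 t2 B)
    {x : Fin 3 → ℝ} (hx : x ∈ nozzleFrom f K) :
    |x 0 * grad3 ψ x 0 + x 1 * grad3 ψ x 1| ≤ 2 * (C₀ * B) := by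
  have e0 := (abs0_le_rad x).trans (h.rad_le hx)
  have e1 := (abs1_le_rad x).trans (h.rad_le hx)
  have b0 := hψ.bd x hx 0
  have b1 := hψ.bd x hx 1
  have := abs_add_le (x 0 * grad3 ψ x 0) (x 1 * grad3 ψ x 1)
  rw [abs_mul, abs_mul] at this
  have k0 := mul_le_mul e0 b0 (abs_nonneg _) h.C0pos.le
  have k1 := mul_le_mul e1 b1 (abs_nonneg _) h.C0pos.le
  linarith

lemma I2_int (h : FN K a C₀ f) (τ0 : ℝ) {ψ : (Fin 3 → ℝ) → ℝ} {t1 t2 B : ℝ} (hψ : TS f K ψ t1 t2 B) :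
    IntegrableOn (fun x => grad3 ψ x 2 + P2 f τ0 x * ((x 0 * grad3 ψ x 0 + x 1 * grad3 ψ x 1) + 2 * ψ x))
      (nozzleFrom f K) := by
  refine h.int_slab (t1 := t1) (t2 := t2) (B := B + C₀ ^ 2 * (2 * (C₀ * B) + 2 * B)) ?_ ?_ ?_
  · exact (grad_aesm ψ 2 _).add ((h.P2_meas τ0).mul ((((coord_aesm 0 _).mul (grad_aesm ψ 0 _)).add
      ((coord_aesm 1 _).mul (grad_aesm ψ 1 _))).add ((h.TS_meas hψ).const_mul 2)))
  · intro x hx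
    refine (abs_add_le _ _).trans (add_le_add (hψ.bd x hx 2) ?_)
    rw [abs_mul]
    refine mul_le_mul (h.p2_bd _ hx.1) ?_ (abs_nonneg _) (sq_nonneg _)
    refine (abs_add_le _ _).trans (add_le_add (h.comb_bd hψ hx) ?_)
    rw [abs_mul, abs_two]
    linarith [hψ.bd0 x hx]
  · intro x hx h2
    simp [h.TS_grad_zero hψ hx h2, hψ.zero x hx h2]

lemma I2 (h : FN K a C₀ f) (τ0 : ℝ) {ψ : (Fin 3 → ℝ) → ℝ} {t1 t2 B : ℝ} (hψ : TS f K ψ t1 t2 B) :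
    ∫ x in nozzleFrom f K,
      (grad3 ψ x 2 + P2 f τ0 x * ((x 0 * grad3 ψ x 0 + x 1 * grad3 ψ x 1) + 2 * ψ x)) = 0 := by
  have hi := (h.integrable_chart τ0 _).1 (h.I2_int τ0 hψ)
  rw [h.integral_chart τ0]
  set G : (Fin 3 → ℝ) → ℝ := fun y => rho f y ^ 2 * (grad3 ψ (Th f y) 2 + p2 f (y 1) (y 2) *
    ((Th f y 0 * grad3 ψ (Th f y) 0 + Th f y 1 * grad3 ψ (Th f y) 1) + 2 * ψ (Th f y))) with hG
  have hEq : EqOn (fun y => rho f y ^ 2 * (grad3 ψ (Th f y) 2 + P2 f τ0 (Th f y) *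
    ((Th f y 0 * grad3 ψ (Th f y) 0 + Th f y 1 * grad3 ψ (Th f y) 1) + 2 * ψ (Th f y)))) G (Wn K τ0) := by
    intro y hy
    simp only [hG, P2]
    rw [h.ang_Th hy.2.2 hy.2.1]; rfl
  have hms := (isOpen_Wn K τ0).measurableSet
  rw [setIntegral_congr_fun hms hEq]
  refine int_d2 (H := fun y => rho f y ^ 2 * ψ (Th f y)) (t2 := t2) hψ.lt
    ((integrableOn_congr_fun hEq hms).1 hi) ?_ ?_
  · intro x' hx' t ht
    have h1 := ((h.rho_curve x' ht).pow 2).mul (h.Th_curve x' ht (hψ.diff _ (h.Th_mem (y := sn x' t) ht hx')))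
    refine h1.congr_deriv ?_
    simp only [hG, sn_one, sn_two, Pi.pow_apply]
    push_cast
    ring
  · intro x' hx' t ht h2
    have := hψ.zero _ (h.Th_mem (y := sn x' t) ht hx') h2
    simp only [this, mul_zero]

lemma V_int (h : FN K a C₀ f) (τ0 : ℝ) {ψ : (Fin 3 → ℝ) → ℝ} {t1 t2 B : ℝ} (hψ : TS f K ψ t1 t2 B) :
    IntegrableOn (fun x => (FF f τ0 x ^ 2)⁻¹ * (P2 f τ0 x * (x 0 * grad3 ψ x 0 + x 1 * grad3 ψ x 1) + grad3 ψ x 2))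
      (nozzleFrom f K) := by
  refine h.int_slab (t1 := t1) (t2 := t2) (B := C₀ ^ 2 * (C₀ ^ 2 * (2 * (C₀ * B)) + B)) ?_ ?_ ?_
  · have hF : AEStronglyMeasurable (fun x => (FF f τ0 x ^ 2)⁻¹) (volume.restrict (nozzleFrom f K)) :=
      (((h.FF_meas τ0).aemeasurable.pow_const 2).inv).aestronglyMeasurable
    exact hF.mul (((h.P2_meas τ0).mul (((coord_aesm 0 _).mul (grad_aesm ψ 0 _)).add
      ((coord_aesm 1 _).mul (grad_aesm ψ 1 _)))).add (grad_aesm ψ 2 _))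
  · intro x hx
    rw [abs_mul]
    refine mul_le_mul ?_ ?_ (abs_nonneg _) (sq_nonneg _)
    · have h1 := (h.rng (ang τ0 x) (x 2) hx.1).1
      have h2 := h.fpos (ang τ0 x) hx.1
      have h0 := h.C0pos
      rw [FF, abs_of_nonneg (by positivity), ← inv_pow]
      refine pow_le_pow_left₀ (by positivity) ?_ 2
      rw [one_div] at h1
      exact inv_le_of_inv_le₀ h0 h1
    · refine (abs_add_le _ _).trans (add_le_add ?_ (hψ.bd x hx 2))
      rw [abs_mul]
      exact mul_le_mul (h.p2_bd _ hx.1) (h.comb_bd hψ hx) (abs_nonneg _) (sq_nonneg _)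
  · intro x hx h2
    simp [h.TS_grad_zero hψ hx h2]

lemma Vid (h : FN K a C₀ f) (τ0 : ℝ) {ψ : (Fin 3 → ℝ) → ℝ} {t1 t2 B : ℝ} (hψ : TS f K ψ t1 t2 B) :
    ∫ x in nozzleFrom f K,
      (FF f τ0 x ^ 2)⁻¹ * (P2 f τ0 x * (x 0 * grad3 ψ x 0 + x 1 * grad3 ψ x 1) + grad3 ψ x 2) = 0 := by
  have hi := (h.integrable_chart τ0 _).1 (h.V_int τ0 hψ)
  rw [h.integral_chart τ0]
  set G : (Fin 3 → ℝ) → ℝ := fun y => exp (y 0) ^ 2 * (p2 f (y 1) (y 2) *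
    (Th f y 0 * grad3 ψ (Th f y) 0 + Th f y 1 * grad3 ψ (Th f y) 1) + grad3 ψ (Th f y) 2) with hG
  have hEq : EqOn (fun y => rho f y ^ 2 * ((FF f τ0 (Th f y) ^ 2)⁻¹ * (P2 f τ0 (Th f y) *
    (Th f y 0 * grad3 ψ (Th f y) 0 + Th f y 1 * grad3 ψ (Th f y) 1) + grad3 ψ (Th f y) 2))) G (Wn K τ0) := by
    intro y hy
    have e2 : Th f y 2 = y 2 := rfl
    have hf := (h.fpos (y 1) hy.2.2).ne'
    simp only [hG, P2, FF]
    rw [h.ang_Th hy.2.2 hy.2.1, e2, rho]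
    field_simp
  have hms := (isOpen_Wn K τ0).measurableSet
  rw [setIntegral_congr_fun hms hEq]
  refine int_d2 (H := fun y => exp (y 0) ^ 2 * ψ (Th f y)) (t2 := t2) hψ.lt
    ((integrableOn_congr_fun hEq hms).1 hi) ?_ ?_
  · intro x' hx' t ht
    have h1 := (h.Th_curve x' ht (hψ.diff _ (h.Th_mem (y := sn x' t) ht hx'))).const_mul (exp (x' 0) ^ 2)
    exact h1
  · intro x' hx' t ht h2
    have := hψ.zero _ (h.Th_mem (y := sn x' t) ht hx') h2
    simp only [this, mul_zero]

end FN
end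

section
/-- the full set of hypotheses -/
structure SP (K a C₀ m₀ M : ℝ) (f : ℝ → ℝ → ℝ) (φ : (Fin 3 → ℝ) → ℝ) : Prop where
  fn : FN K a C₀ f
  hM : 0 < M
  c1 : ContDiffOn ℝ 1 φ (closure (nozzleFrom f K))
  weak : ∀ ψ : (Fin 3 → ℝ) → ℝ, ContDiff ℝ 1 ψ → HasCompactSupport ψ →
        tsupport ψ ⊆ {x : Fin 3 → ℝ | K < x 2} →
        ∫ x in nozzleFrom f K, ∑ i, grad3 φ x i * grad3 ψ x i = 0
  flux : ∀ t : ℝ, K < t →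
        ∫ x' in {x' : Fin 2 → ℝ | (Fin.snoc x' t : Fin 3 → ℝ) ∈ nozzleFrom f K},
          grad3 φ (Fin.snoc x' t) 2 = m₀
  bd : ∀ x ∈ nozzleFrom f K, norm3 (grad3 φ x) ≤ M

/-- the perturbation of the uniform flow -/
noncomputable def uu (m₀ : ℝ) (φ : (Fin 3 → ℝ) → ℝ) (x : Fin 3 → ℝ) : ℝ := φ x - m₀ / π * x 2

lemma FN.int_prof {K a C₀ : ℝ} {f : ℝ → ℝ → ℝ} (h : FN K a C₀ f) {χ : ℝ → ℝ}
    (hz : ∀ t, t ≤ K → χ t = 0) :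
    ∫ x in nozzleFrom f K, χ (x 2) * (FF f 0 x ^ 2)⁻¹ = π * ∫ t, χ t := by
  rw [h.integral_chart 0]
  have hms := (FN.isOpen_Wn K 0).measurableSet
  have hEq : EqOn (fun y => rho f y ^ 2 * (χ (Th f y 2) * (FF f 0 (Th f y) ^ 2)⁻¹))
      (fun y => exp (2 * y 0) * χ (y 2)) (Wn K 0) := by
    intro y hy
    have e2 : Th f y 2 = y 2 := rfl
    have hf := (h.fpos (y 1) hy.2.2).ne'
    simp only [FF]
    rw [h.ang_Th hy.2.2 hy.2.1, e2, rho, two_mul, exp_add]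
    field_simp
  rw [setIntegral_congr_fun hms hEq, ← integral_indicator hms]
  set g : Fin 3 → ℝ → ℝ := ![(Iio 0).indicator (fun s => exp (2 * s)), (Ioo (-π) π).indicator (fun _ => 1), χ] with hg
  have e : (Wn K 0).indicator (fun y => exp (2 * y 0) * χ (y 2)) = fun y => ∏ i, g i (y i) := by
    funext y
    simp only [Fin.prod_univ_three, hg, Matrix.cons_val]
    by_cases hy : y ∈ Wn K 0
    · rw [indicator_of_mem hy, indicator_of_mem (show y 0 ∈ Iio 0 from hy.1),
        indicator_of_mem (show y 1 ∈ Ioo (-π) π from by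
          have := hy.2.1; rw [sub_zero, abs_lt] at this; exact this)]
      ring
    · rw [indicator_of_notMem hy]
      by_cases h0 : y 0 < 0
      · by_cases h1 : y 1 ∈ Ioo (-π) π
        · have : y 2 ≤ K := by
            by_contra hc
            exact hy ⟨h0, by rw [sub_zero, abs_lt]; exact h1, not_le.1 hc⟩
          rw [hz _ this]; ring
        · rw [indicator_of_notMem h1]; ring
      · rw [indicator_of_notMem (show y 0 ∉ Iio 0 from h0)]; ring
  rw [e, integral_fintype_prod_volume_eq_prod]
  simp only [Fin.prod_univ_three, hg, Matrix.cons_val]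
  rw [integral_indicator measurableSet_Iio, integral_indicator measurableSet_Ioo]
  have e1 : ∫ s in Iio (0:ℝ), exp (2 * s) = 1 / 2 := by
    rw [← integral_Iic_eq_integral_Iio, integral_exp_mul_Iic (by norm_num)]
    simp
  have e2 : ∫ _ in Ioo (-π) π, (1:ℝ) = 2 * π := by
    simp
    rw [max_eq_left (by positivity)]; ring
  rw [e1, e2]; ring

namespace SP
variable {K a C₀ m₀ M : ℝ} {f : ℝ → ℝ → ℝ} {φ : (Fin 3 → ℝ) → ℝ}

lemma phi_c1 (h : SP K a C₀ m₀ M f φ) {x : Fin 3 → ℝ} (hx : x ∈ nozzleFrom f K) : ContDiffAt ℝ 1 φ x :=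
  h.c1.contDiffAt (Filter.mem_of_superset (h.fn.isOpen_noz.mem_nhds hx) subset_closure)

lemma u_c1 (h : SP K a C₀ m₀ M f φ) {x : Fin 3 → ℝ} (hx : x ∈ nozzleFrom f K) :
    ContDiffAt ℝ 1 (uu m₀ φ) x :=
  (h.phi_c1 hx).sub (contDiffAt_const.mul (contDiff_apply ℝ ℝ (2 : Fin 3)).contDiffAt)

lemma u_diff (h : SP K a C₀ m₀ M f φ) {x : Fin 3 → ℝ} (hx : x ∈ nozzleFrom f K) :
    DifferentiableAt ℝ (uu m₀ φ) x := (h.u_c1 hx).differentiableAt (by norm_num)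

lemma u_grad (h : SP K a C₀ m₀ M f φ) {x : Fin 3 → ℝ} (hx : x ∈ nozzleFrom f K) :
    grad3 (uu m₀ φ) x = grad3 φ x - ![0, 0, m₀ / π] := by
  have h1 := ((h.phi_c1 hx).differentiableAt (by norm_num)).hasFDerivAt
  have h2 := (hasFDerivAt_apply (𝕜 := ℝ) (F' := fun _ : Fin 3 => ℝ) 2 x).const_mul (m₀ / π)
  have h3 : fderiv ℝ (uu m₀ φ) x = _ := (h1.sub h2).fderiv
  funext i
  simp only [grad3, h3, Pi.sub_apply]
  fin_cases i <;> simp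

lemma u_grad' (h : SP K a C₀ m₀ M f φ) {x : Fin 3 → ℝ} (hx : x ∈ nozzleFrom f K) :
    grad3 (uu m₀ φ) x 0 = grad3 φ x 0 ∧ grad3 (uu m₀ φ) x 1 = grad3 φ x 1 ∧
    grad3 (uu m₀ φ) x 2 = grad3 φ x 2 - m₀ / π := by
  rw [h.u_grad hx]; simp

lemma phi_bd (h : SP K a C₀ m₀ M f φ) {x : Fin 3 → ℝ} (hx : x ∈ nozzleFrom f K) (j : Fin 3) :
    |grad3 φ x j| ≤ M := by
  refine le_trans ?_ (h.bd x hx)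
  rw [norm3]
  refine Real.abs_le_sqrt ?_
  exact Finset.single_le_sum (f := fun i => grad3 φ x i ^ 2) (fun i _ => sq_nonneg _) (Finset.mem_univ j)

lemma u_bd (h : SP K a C₀ m₀ M f φ) {x : Fin 3 → ℝ} (hx : x ∈ nozzleFrom f K) (j : Fin 3) :
    |grad3 (uu m₀ φ) x j| ≤ M + |m₀ / π| := by
  have hb := h.phi_bd hx j
  have h0 := abs_nonneg (m₀ / π)
  rw [h.u_grad hx]
  refine (abs_sub _ _).trans (add_le_add hb ?_)
  fin_cases j <;> simp [h0]

lemma u_grad_cont (h : SP K a C₀ m₀ M f φ) {x : Fin 3 → ℝ} (hx : x ∈ nozzleFrom f K) (j : Fin 3) :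
    ContinuousAt (fun x => grad3 (uu m₀ φ) x j) x :=
  ((h.u_c1 hx).fderiv_right (m := 0) (by norm_num)).continuousAt.clm_apply continuousAt_const

lemma flux_int (h : SP K a C₀ m₀ M f φ) {χ : ℝ → ℝ} {t1 t2 : ℝ} (ht : K < t1) (hχ : Continuous χ)
    (hz : ∀ t, (t < t1 ∨ t2 < t) → χ t = 0) :
    ∫ x in nozzleFrom f K, χ (x 2) * grad3 φ x 2 = m₀ * ∫ t, χ t := by
  have hcs : HasCompactSupport χ := HasCompactSupport.intro (isCompact_Icc (a := t1) (b := t2))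
    fun t ht => hz t (by by_contra hc; push Not at hc; exact ht hc)
  obtain ⟨B, hB⟩ := hcs.exists_bound_of_continuous hχ
  have hB0 : 0 ≤ B := (norm_nonneg _).trans (hB 0)
  have hi : IntegrableOn (fun x => χ (x 2) * grad3 φ x 2) (nozzleFrom f K) := by
    refine h.fn.int_slab (t1 := t1) (t2 := t2) (B := B * M) ?_ ?_ ?_
    · exact ((hχ.comp (continuous_apply 2)).aestronglyMeasurable).mul (FN.grad_aesm φ 2 _)
    · intro x hx
      rw [abs_mul]
      exact mul_le_mul (hB _) (h.phi_bd hx 2) (abs_nonneg _) hB0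
    · intro x _ h2
      rw [hz _ h2, zero_mul]
  rw [← integral_indicator h.fn.meas_noz]
  rw [← integrable_indicator_iff h.fn.meas_noz] at hi
  rw [fub_t hi, ← integral_const_mul]
  congr 1
  funext t
  by_cases htK : K < t
  · have hm : MeasurableSet {x' : Fin 2 → ℝ | (Fin.snoc x' t : Fin 3 → ℝ) ∈ nozzleFrom f K} :=
      (sn_me.measurable.comp measurable_prodMk_left) h.fn.meas_noz
    rw [← h.flux t htK, mul_comm, ← integral_const_mul, ← integral_indicator hm]
    congr 1
  · rw [hz t (Or.inl (by linarith)), mul_zero]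
    rw [← integral_zero (Fin 2 → ℝ) ℝ]
    congr 1
    funext x'
    rw [indicator_of_notMem]
    intro hc; exact htK hc.1

end SP
end

section
lemma ell_sq_le {n : Fin 3 → ℝ} (hn : sq3 n = 1) (z : Fin 3 → ℝ) : ell n z ^ 2 ≤ sq3 z := by
  have : ell n z ^ 2 ≤ sq3 n * sq3 z := by
    unfold ell sq3
    nlinarith [sq_nonneg (n 0 * z 1 - n 1 * z 0), sq_nonneg (n 0 * z 2 - n 2 * z 0),
      sq_nonneg (n 1 * z 2 - n 2 * z 1)]
  rwa [hn, one_mul] at this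

lemma B3_volr {ε : ℝ} (hε : 0 < ε) : volume.real (B3 ε) ≤ 8 * ε ^ 3 := by
  have hs : B3 ε ⊆ Icc (fun _ => -ε) (fun _ => ε) := by
    intro z hz
    have hz' : sq3 z < ε ^ 2 := hz
    have h : ∀ i, |z i| ≤ ε := fun i => abs_le_of_sq_le_sq ((coord_sq_le z i).trans hz'.le) hε.le
    exact ⟨fun i => (abs_le.1 (h i)).1, fun i => (abs_le.1 (h i)).2⟩
  have h1 : volume.real (B3 ε) ≤ volume.real (Icc (fun _ : Fin 3 => -ε) (fun _ => ε)) :=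
    measureReal_mono hs isCompact_Icc.measure_lt_top.ne
  refine h1.trans ?_
  rw [measureReal_def, Real.volume_Icc_pi_toReal (fun i => by simp; linarith)]
  simp only [Fin.prod_univ_three]
  nlinarith

lemma Psi_bd : ∃ G : ℝ, 1 ≤ G ∧ ∀ i z, |Psi i z| ≤ G ∧ ∀ j, |grad3 (Psi i) z j| ≤ G := by
  have h1 : ∀ i : Fin 3, ∃ G, ∀ z, |Psi i z| ≤ G := fun i =>
    (Psi_cs i).exists_bound_of_continuous (Psi_contDiff i).continuous
  have h2 : ∀ i j : Fin 3, ∃ G, ∀ z, |grad3 (Psi i) z j| ≤ G := fun i j =>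
    (gradPsi_cs i j).exists_bound_of_continuous (grad3_cont ((Psi_contDiff i).of_le (by norm_num)) j)
  choose G1 h1 using h1
  choose G2 h2 using h2
  have n1 : ∀ i, 0 ≤ G1 i := fun i => (abs_nonneg _).trans (h1 i 0)
  have n2 : ∀ i j, 0 ≤ G2 i j := fun i j => (abs_nonneg _).trans (h2 i j 0)
  have n3 : ∀ i, 0 ≤ ∑ j, G2 i j := fun i => Finset.sum_nonneg fun j _ => n2 i j
  have n4 : 0 ≤ ∑ i, G1 i := Finset.sum_nonneg fun j _ => n1 j
  have n5 : 0 ≤ ∑ i, ∑ j, G2 i j := Finset.sum_nonneg fun j _ => n3 j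
  refine ⟨1 + ∑ i, G1 i + ∑ i, ∑ j, G2 i j, by linarith, fun i z => ⟨?_, fun j => ?_⟩⟩
  · have := Finset.single_le_sum (f := G1) (fun i _ => n1 i) (Finset.mem_univ i)
    linarith [h1 i z]
  · have := Finset.single_le_sum (f := fun i => ∑ j, G2 i j) (fun i _ => n3 i) (Finset.mem_univ i)
    have := Finset.single_le_sum (f := fun j => G2 i j) (fun j _ => n2 i j) (Finset.mem_univ j)
    linarith [h2 i j z]

lemma Pst_bd : ∃ G : ℝ, 1 ≤ G ∧ ∀ (n : Fin 3 → ℝ) (d : ℝ) (i : Fin 3) (ε : ℝ) (z : Fin 3 → ℝ), sq3 n = 1 → 0 < ε →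
    |Pst n d i ε z| ≤ G * ε ∧ ∀ j, |grad3 (Pst n d i ε) z j| ≤ G := by
  obtain ⟨G, hG1, hG⟩ := Psi_bd
  refine ⟨10 * G, by linarith, fun n d i ε z hn hε => ⟨?_, fun j => ?_⟩⟩
  · have h : ∀ z, |Pse i ε z| ≤ ε * G := fun z => by
      rw [Pse, abs_mul, abs_of_pos hε]
      exact mul_le_mul_of_nonneg_left (hG i _).1 hε.le
    have := abs_add_le (Pse i ε z) (Pse i ε (ref n d z))
    rw [Pst]
    nlinarith [h z, h (ref n d z), mul_pos hε (by linarith : (0:ℝ) < G)]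
  · have h : ∀ z j, |grad3 (Pse i ε) z j| ≤ G := fun z j => by
      rw [grad_Pse i hε]; exact (hG i _).2 j
    rw [grad_Pst]
    have hk : ∀ k, |grad3 (Pse i ε) (ref n d z) k * RM n k j| ≤ G * 3 := fun k => by
      rw [abs_mul]
      exact mul_le_mul (h _ _) (RM_bd hn k j) (abs_nonneg _) (by linarith)
    have h1 := abs_add_le (grad3 (Pse i ε) z j) (∑ k, grad3 (Pse i ε) (ref n d z) k * RM n k j)
    have h2 := Finset.abs_sum_le_sum_abs (fun k => grad3 (Pse i ε) (ref n d z) k * RM n k j) Finset.univ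
    simp only [Fin.sum_univ_three] at h1 h2 ⊢
    linarith [h z j, hk 0, hk 1, hk 2]

lemma Pst_zero_HS {n : Fin 3 → ℝ} (hn : sq3 n = 1) {d : ℝ} (hd : 0 < d) (i : Fin 3) {ε : ℝ} (hε : 0 < ε)
    {z : Fin 3 → ℝ} (hz : z ∈ HS n d) (h : ε ^ 2 ≤ sq3 z) :
    Pst n d i ε z = 0 ∧ ∀ j, grad3 (Pst n d i ε) z j = 0 := by
  have hz' : ell n z < d := hz
  have h2 : ε ^ 2 ≤ sq3 (ref n d z) := by
    rw [sq3_ref hn]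
    nlinarith
  constructor
  · rw [Pst, Pse_zero i hε h, Pse_zero i hε h2, add_zero]
  · intro j
    rw [grad_Pst, gradPse_zero i hε h]
    simp [gradPse_zero i hε h2]

lemma Pst_ts {n : Fin 3 → ℝ} (hn : sq3 n = 1) {d : ℝ} (hd : 0 < d) (i : Fin 3) {ε : ℝ} (hε : 0 < ε) :
    tsupport (Pst n d i ε) ⊆ {z | sq3 z ≤ (2 * d + ε) ^ 2} := by
  refine closure_minimal ?_ (isClosed_le sq3_contDiff.continuous continuous_const)
  intro z hz
  by_contra hc
  have hc' : (2 * d + ε) ^ 2 < sq3 z := not_le.1 hc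
  refine hz ?_
  have h1 : ε ^ 2 ≤ sq3 z := by nlinarith
  have h2 : ε ^ 2 ≤ sq3 (ref n d z) := by
    by_contra hlt
    rw [not_le] at hlt
    have e := sq3_ref hn d (ref n d z)
    rw [ref_ref hn] at e
    have hl := abs_le_of_sq_le_sq ((ell_sq_le hn (ref n d z)).trans hlt.le) hε.le
    have := (abs_le.1 hl).1
    nlinarith
  rw [Pst, Pse_zero i hε h1, Pse_zero i hε h2, add_zero]

lemma Pst_cs {n : Fin 3 → ℝ} (hn : sq3 n = 1) {d : ℝ} (hd : 0 < d) (i : Fin 3) {ε : ℝ} (hε : 0 < ε) :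
    HasCompactSupport (Pst n d i ε) := by
  refine HasCompactSupport.of_support_subset_isCompact
    (isCompact_closedBall (0 : Fin 3 → ℝ) (2 * d + ε)) ?_
  intro z hz
  have h1 : sq3 z ≤ (2 * d + ε) ^ 2 := Pst_ts hn hd i hε (subset_tsupport _ hz)
  rw [mem_closedBall_zero_iff]
  exact abs_le_of_sq_le_sq ((norm_sq_le z).trans h1) (by linarith) |>.trans' (le_abs_self _)

namespace FN
variable {K a C₀ : ℝ} {f : ℝ → ℝ → ℝ}

lemma TS_of_cs {ψ : (Fin 3 → ℝ) → ℝ} (hψ : ContDiff ℝ 1 ψ) (hc : HasCompactSupport ψ)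
    (hs : tsupport ψ ⊆ {x : Fin 3 → ℝ | K < x 2}) : ∃ t1 t2 B, TS f K ψ t1 t2 B := by
  obtain ⟨B0, hB0⟩ := hc.exists_bound_of_continuous hψ.continuous
  have hj : ∀ j : Fin 3, ∃ B, ∀ z, |grad3 ψ z j| ≤ B := fun j =>
    HasCompactSupport.exists_bound_of_continuous (f := fun z => grad3 ψ z j)
      (hc.fderiv_apply (𝕜 := ℝ) (Pi.single j 1)) (grad3_cont hψ j)
  choose B1 hB1 using hj
  have n1 : ∀ i, 0 ≤ B1 i := fun i => (abs_nonneg _).trans (hB1 i 0)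
  have n0 : 0 ≤ B0 := (norm_nonneg _).trans (hB0 0)
  have him : IsCompact ((fun x : Fin 3 → ℝ => x 2) '' tsupport ψ) := hc.isCompact.image (continuous_apply 2)
  have ht1 : ∃ t1, K < t1 ∧ ∀ x ∈ tsupport ψ, t1 ≤ x 2 := by
    rcases (tsupport ψ).eq_empty_or_nonempty with he | hne
    · exact ⟨K + 1, by linarith, by simp [he]⟩
    · obtain ⟨x, hx, hm⟩ := hc.isCompact.exists_isMinOn hne (continuous_apply (2 : Fin 3)).continuousOn
      exact ⟨x 2, hs hx, fun y hy => hm hy⟩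
  obtain ⟨t1, hK, ht1⟩ := ht1
  obtain ⟨t2, ht2⟩ := him.bddAbove
  refine ⟨t1, t2, B0 + ∑ i, B1 i, hK, fun x _ => hψ.differentiable (by norm_num) x, fun x _ => ?_,
    fun x _ j => ?_, fun x _ h => ?_⟩
  · have := Finset.sum_nonneg (s := Finset.univ) fun i (_ : i ∈ Finset.univ) => n1 i
    have h2 : |ψ x| ≤ B0 := hB0 x
    linarith
  · have := Finset.single_le_sum (f := B1) (fun i _ => n1 i) (Finset.mem_univ j)
    linarith [hB1 j x]
  · by_contra hne
    have hx := subset_tsupport ψ hne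
    have h1 := ht1 x hx
    have h2 := ht2 ⟨x, hx, rfl⟩
    simp only at h2
    rcases h with h | h <;> linarith

end FN

/-- the integrand of the weak formulation in the normalized chart -/
noncomputable def WW (f : ℝ → ℝ → ℝ) (q : ℝ) (o : Fin 3 → ℝ) (v Ψ : (Fin 3 → ℝ) → ℝ) (z : Fin 3 → ℝ) : ℝ :=
  grad3 v z 0 * grad3 Ψ z 0
  + (grad3 v z 1 - (p1 f (aff f o z 1) (aff f o z 2) - p1 f (o 1) (o 2)) * grad3 v z 0)
    * (grad3 Ψ z 1 - (p1 f (aff f o z 1) (aff f o z 2) - p1 f (o 1) (o 2)) * grad3 Ψ z 0)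
  + (rho f (aff f o z) ^ 2 / rho f o ^ 2)
    * ((grad3 v z 2 - rho f o * (p2 f (aff f o z 1) (aff f o z 2) - p2 f (o 1) (o 2)) * grad3 v z 0)
    * (grad3 Ψ z 2 - rho f o * (p2 f (aff f o z 1) (aff f o z 2) - p2 f (o 1) (o 2)) * grad3 Ψ z 0))
  - q * (rho f (aff f o z) ^ 2 * p2 f (aff f o z 1) (aff f o z 2)) * (grad3 Ψ z 0 + 2 * Ψ z)

lemma SP.weak_int {K a C₀ m₀ M : ℝ} {f : ℝ → ℝ → ℝ} {φ : (Fin 3 → ℝ) → ℝ} (h : SP K a C₀ m₀ M f φ)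
    {ψ : (Fin 3 → ℝ) → ℝ} {t1 t2 B : ℝ} (hψ : TS f K ψ t1 t2 B) :
    IntegrableOn (fun x => ∑ i, grad3 φ x i * grad3 ψ x i) (nozzleFrom f K) := by
  refine h.fn.int_slab (t1 := t1) (t2 := t2) (B := ∑ _i : Fin 3, M * B) ?_ ?_ ?_
  · exact Measurable.aestronglyMeasurable (Finset.measurable_sum _ fun i _ => (grad_meas φ i).mul (grad_meas ψ i))
  · intro x hx
    refine (Finset.abs_sum_le_sum_abs _ _).trans (Finset.sum_le_sum fun i _ => ?_)
    rw [abs_mul]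
    exact mul_le_mul (h.phi_bd hx i) (hψ.bd x hx i) (abs_nonneg _) h.hM.le
  · intro x hx h2
    simp [h.fn.TS_grad_zero hψ hx h2]

lemma SP.EQ {K a C₀ m₀ M : ℝ} {f : ℝ → ℝ → ℝ} {φ : (Fin 3 → ℝ) → ℝ} (h : SP K a C₀ m₀ M f φ)
    {o : Fin 3 → ℝ} (ho : K < o 2) {Ψ : (Fin 3 → ℝ) → ℝ}
    (hΨ : ContDiff ℝ 1 Ψ) (hc : HasCompactSupport Ψ) (hs : tsupport Ψ ⊆ ZU f K o) :
    IntegrableOn (WW f (m₀ / π) o (fun z => uu m₀ φ (PH f o z)) Ψ) (ZW f K o) ∧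
    ∫ z in ZW f K o, WW f (m₀ / π) o (fun z => uu m₀ φ (PH f o z)) Ψ z = 0 := by
  obtain ⟨ψ, hψ1, hψc, hψs, hψ⟩ := h.fn.exists_test ho hΨ hc hs
  obtain ⟨t1, t2, B, hT⟩ := FN.TS_of_cs (f := f) hψ1 hψc hψs
  set q := m₀ / π with hq
  have hR := h.fn.rho_pos ho
  have i1 := h.weak_int hT
  have i2 := (h.fn.I2_int (o 1) hT).const_mul q
  have e1 := h.weak ψ hψ1 hψc hψs
  have e2 := h.fn.I2 (o 1) hT
  have e3 : ∫ x in nozzleFrom f K, ((∑ i, grad3 φ x i * grad3 ψ x i) - q * (grad3 ψ x 2 + P2 f (o 1) x *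
      ((x 0 * grad3 ψ x 0 + x 1 * grad3 ψ x 1) + 2 * ψ x))) = 0 := by
    rw [integral_sub i1 i2, e1, integral_const_mul, e2]; ring
  have i3 := (h.fn.integrable_PH ho _).1 (Integrable.sub i1 i2)
  rw [h.fn.integral_PH ho] at e3
  have hms := (FN.isOpen_ZW f K o).measurableSet
  have hEq : EqOn (fun z => rho f o * (rho f (aff f o z) ^ 2 * ((∑ i, grad3 φ (PH f o z) i * grad3 ψ (PH f o z) i)
      - q * (grad3 ψ (PH f o z) 2 + P2 f (o 1) (PH f o z) *
      ((PH f o z 0 * grad3 ψ (PH f o z) 0 + PH f o z 1 * grad3 ψ (PH f o z) 1) + 2 * ψ (PH f o z))))))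
      (fun z => rho f o * WW f q o (fun z => uu m₀ φ (PH f o z)) Ψ z) (ZW f K o) := by
    intro z hz
    have hzU := hz.2
    have h2 : K < aff f o z 2 := by rw [FN.aff_two]; exact hzU.2
    have h1 : |aff f o z 1 - o 1| < π := by simpa [aff] using hzU.1
    have hX : PH f o z ∈ nozzleFrom f K := h.fn.Th_mem h2 hz.1
    have hev : Ψ =ᶠ[nhds z] fun z => ψ (PH f o z) := by
      filter_upwards [(FN.isOpen_ZU f K o).mem_nhds hzU] with y hy
      exact (hψ y hy).symm
    have hg : ∀ j, grad3 Ψ z j = grad3 (fun z => ψ (PH f o z)) z j := fun j => by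
      rw [grad3, hev.fderiv_eq]; rfl
    obtain ⟨a0, a1, a2⟩ := h.fn.grad_PH hzU.2 (h.u_diff hX)
    obtain ⟨b0, b1, b2⟩ := h.fn.grad_PH hzU.2 (hψ1.differentiable (by norm_num) (PH f o z))
    simp only [← hg] at b0 b1 b2
    obtain ⟨c0, c1, c2⟩ := h.u_grad' hX
    have hP2 : P2 f (o 1) (PH f o z) = p2 f (aff f o z 1) (aff f o z 2) := by
      rw [P2, PH, h.fn.ang_Th h2 h1]; rfl
    have hrad : rho f (aff f o z) ^ 2 = PH f o z 0 ^ 2 + PH f o z 1 ^ 2 := by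
      rw [PH, Th]; simp only [Matrix.cons_val]
      linear_combination (- rho f (aff f o z) ^ 2) * sin_sq_add_cos_sq (aff f o z 1)
    simp only [WW]
    rw [a1, a2, b1, b2, b0, a0, ← hψ z hzU, hP2, c0, c1, c2, Fin.sum_univ_three]
    congr 1
    have hRR : rho f (aff f o z) ^ 2 / rho f o ^ 2 * (rho f o * rho f o) = rho f (aff f o z) ^ 2 := by
      field_simp
    generalize rho f (aff f o z) ^ 2 / rho f o ^ 2 = k at hRR ⊢
    generalize p2 f (aff f o z 1) (aff f o z 2) = s2
    generalize p1 f (aff f o z 1) (aff f o z 2) - p1 f (o 1) (o 2) = s1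
    generalize grad3 φ (PH f o z) = gφ
    generalize grad3 ψ (PH f o z) = gψ
    rw [← hq, hrad]
    rw [hrad] at hRR
    linear_combination (-(gφ 2 - q) * gψ 2) * hRR
  constructor
  · have := (integrableOn_congr_fun hEq hms).1 i3
    have h2 := this.const_mul (rho f o)⁻¹
    refine h2.congr (Filter.Eventually.of_forall fun z => ?_)
    simp only
    field_simp
  · rw [setIntegral_congr_fun hms hEq, integral_const_mul] at e3
    exact (mul_eq_zero.1 e3).resolve_left hR.ne'
end

section
namespace FN
variable {K a C₀ : ℝ} {f : ℝ → ℝ → ℝ}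

lemma rho_rng (h : FN K a C₀ f) {o : Fin 3 → ℝ} (ho : K < o 2) (h0 : o 0 < 0) (h1 : 1 / 2 ≤ exp (o 0)) :
    1 / (2 * C₀) ≤ rho f o ∧ rho f o ≤ C₀ := by
  have hC := h.C0pos
  obtain ⟨r1, r2⟩ := h.rng (o 1) (o 2) ho
  have he : exp (o 0) ≤ 1 := by rw [exp_le_one_iff]; exact h0.le
  have hf := h.fpos (o 1) ho
  constructor
  · calc 1 / (2 * C₀) = 1 / 2 * (1 / C₀) := by field_simp
      _ ≤ exp (o 0) * f (o 1) (o 2) := mul_le_mul h1 r1 (by positivity) (exp_pos _).le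
  · rw [rho]; nlinarith

lemma prod_near {A B w : ℝ} (hw0 : 0 ≤ w) (hw1 : w ≤ 1 / 64) (hE : |A - 1| ≤ 12 * w) (hG : |B - 1| ≤ 3 * w) :
    |A * B - 1| ≤ 16 * w := by
  have e : A * B - 1 = (A - 1) * (B - 1) + (A - 1) + (B - 1) := by ring
  have k1 : |A * B - 1| ≤ |A - 1| * |B - 1| + |A - 1| + |B - 1| := by
    rw [e, ← abs_mul]
    exact (abs_add_le _ _).trans (add_le_add (abs_add_le _ _) le_rfl)
  have k2 : |A - 1| * |B - 1| ≤ 12 * w * (3 * w) := mul_le_mul hE hG (abs_nonneg _) (by positivity)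
  nlinarith

set_option maxHeartbeats 1000000 in
lemma chart_bd (h : FN K a C₀ f) {o z : Fin 3 → ℝ} (ho : K < o 2) (h0 : o 0 < 0) (h1 : 1 / 2 ≤ exp (o 0))
    {s : ℝ} (hs : ∀ i, |z i| ≤ s) (hs1 : 32 * C₀ ^ 7 * s ≤ 1 / 2) (hz : K < o 2 + rho f o * z 2) :
    |p1 f (aff f o z 1) (aff f o z 2) - p1 f (o 1) (o 2)| ≤ 32 * C₀ ^ 7 * s ∧
    |rho f o * (p2 f (aff f o z 1) (aff f o z 2) - p2 f (o 1) (o 2))| ≤ 32 * C₀ ^ 7 * s ∧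
    |rho f (aff f o z) ^ 2 / rho f o ^ 2 - 1| ≤ 32 * C₀ ^ 7 * s ∧
    |p2 f (aff f o z 1) (aff f o z 2) - p2 f (o 1) (o 2)| ≤ 2 * C₀ ^ 5 * s := by
  have hC := h.C0pos
  have hC1 := h.C1
  obtain ⟨hR1, hR2⟩ := h.rho_rng ho h0 h1
  have hR := h.rho_pos ho
  have hs0 : 0 ≤ s := (abs_nonneg _).trans (hs 0)
  have e1 : aff f o z 1 = o 1 + z 1 := by simp [aff]
  have e2 : aff f o z 2 = o 2 + rho f o * z 2 := by simp [aff]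
  have hD : ‖((o 1 + z 1, o 2 + rho f o * z 2) : ℝ × ℝ) - (o 1, o 2)‖ ≤ C₀ * s := by
    rw [Prod.mk_sub_mk, Prod.norm_def]
    refine max_le ?_ ?_
    · simp only [add_sub_cancel_left, Real.norm_eq_abs]; nlinarith [hs 1]
    · simp only [add_sub_cancel_left, Real.norm_eq_abs]
      rw [abs_mul, abs_of_pos hR]
      exact mul_le_mul hR2 (hs 2) (abs_nonneg _) hC.le
  have q1 := h.p1_lip (o 1, o 2) (o 1 + z 1, o 2 + rho f o * z 2) ho hz
  have q2 := h.p2_lip (o 1, o 2) (o 1 + z 1, o 2 + rho f o * z 2) ho hz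
  have q3 := h.f_lip (o 1, o 2) (o 1 + z 1, o 2 + rho f o * z 2) ho hz
  simp only at q1 q2 q3
  have c57 : C₀ ^ 5 ≤ C₀ ^ 7 := pow_le_pow_right₀ hC1 (by norm_num)
  have c67 : C₀ ^ 6 ≤ C₀ ^ 7 := pow_le_pow_right₀ hC1 (by norm_num)
  have c37 : C₀ ^ 3 ≤ C₀ ^ 7 := pow_le_pow_right₀ hC1 (by norm_num)
  have c23 : C₀ ^ 2 ≤ C₀ ^ 3 := pow_le_pow_right₀ hC1 (by norm_num)
  have c03 : 1 ≤ C₀ ^ 3 := one_le_pow₀ hC1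
  have q1' : |p1 f (o 1 + z 1) (o 2 + rho f o * z 2) - p1 f (o 1) (o 2)| ≤ 2 * C₀ ^ 5 * s := by
    refine q1.trans ?_
    calc 2 * C₀ ^ 4 * _ ≤ 2 * C₀ ^ 4 * (C₀ * s) := by gcongr
      _ = _ := by ring
  have q2' : |p2 f (o 1 + z 1) (o 2 + rho f o * z 2) - p2 f (o 1) (o 2)| ≤ 2 * C₀ ^ 5 * s := by
    refine q2.trans ?_
    calc 2 * C₀ ^ 4 * _ ≤ 2 * C₀ ^ 4 * (C₀ * s) := by gcongr
      _ = _ := by ring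
  have q3' : |f (o 1 + z 1) (o 2 + rho f o * z 2) - f (o 1) (o 2)| ≤ C₀ ^ 2 * s := by
    refine q3.trans ?_
    calc C₀ * _ ≤ C₀ * (C₀ * s) := by gcongr
      _ = _ := by ring
  rw [e1, e2]
  refine ⟨q1'.trans ?_, ?_, ?_, q2'⟩
  · have := mul_le_mul_of_nonneg_right c57 hs0
    nlinarith [mul_nonneg (pow_nonneg hC.le 7) hs0]
  · rw [abs_mul, abs_of_pos hR]
    calc rho f o * _ ≤ C₀ * (2 * C₀ ^ 5 * s) := mul_le_mul hR2 q2' (abs_nonneg _) hC.le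
      _ = 2 * (C₀ ^ 6 * s) := by ring
      _ ≤ _ := by
        have := mul_le_mul_of_nonneg_right c67 hs0
        nlinarith [mul_nonneg (pow_nonneg hC.le 7) hs0]
  · have hfo := h.fpos (o 1) ho
    have hfl := (h.rng (o 1) (o 2) ho).1
    set X := z 0 - p1 f (o 1) (o 2) * z 1 - rho f o * p2 f (o 1) (o 2) * z 2 with hX
    set g := f (o 1 + z 1) (o 2 + rho f o * z 2) / f (o 1) (o 2) with hg
    have hrat : rho f (aff f o z) ^ 2 / rho f o ^ 2 = exp (2 * X) * g ^ 2 := by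
      have : exp (aff f o z 0) = exp (o 0) * exp X := by
        rw [← exp_add]; congr 1; simp [aff, hX]; ring
      have h2X : exp (2 * X) = exp X ^ 2 := by rw [← exp_nat_mul]; norm_num
      rw [rho, rho, this, e1, e2, h2X, hg]
      have := (exp_pos (o 0)).ne'
      field_simp
    rw [hrat]
    have b1 := h.p1_bd (o 1) ho
    have b2 := h.p2_bd (o 1) ho
    have cs0 : s ≤ C₀ ^ 3 * s := le_mul_of_one_le_left hs0 c03
    have hXb : |X| ≤ 3 * (C₀ ^ 3 * s) := by
      have i1 : |p1 f (o 1) (o 2) * z 1| ≤ C₀ ^ 3 * s := by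
        rw [abs_mul]
        exact mul_le_mul (b1.trans c23) (hs 1) (abs_nonneg _) (by positivity)
      have i2 : |rho f o * p2 f (o 1) (o 2) * z 2| ≤ C₀ ^ 3 * s := by
        rw [abs_mul, abs_mul, abs_of_pos hR]
        refine mul_le_mul ?_ (hs 2) (abs_nonneg _) (by positivity)
        calc rho f o * _ ≤ C₀ * C₀ ^ 2 := mul_le_mul hR2 b2 (abs_nonneg _) hC.le
          _ = _ := by ring
      have j1 := abs_sub (z 0 - p1 f (o 1) (o 2) * z 1) (rho f o * p2 f (o 1) (o 2) * z 2)
      have j2 := abs_sub (z 0) (p1 f (o 1) (o 2) * z 1)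
      linarith [hs 0]
    have hgb : |g - 1| ≤ C₀ ^ 3 * s := by
      rw [hg, div_sub_one hfo.ne', abs_div, abs_of_pos hfo, div_le_iff₀ hfo]
      refine q3'.trans ?_
      have : 1 ≤ C₀ * f (o 1) (o 2) := by rwa [div_le_iff₀' hC] at hfl
      have hq : 0 ≤ C₀ ^ 2 * s := by positivity
      nlinarith
    have hm : C₀ ^ 3 * s ≤ C₀ ^ 7 * s := mul_le_mul_of_nonneg_right c37 hs0
    set w := C₀ ^ 3 * s with hw
    have hw0 : 0 ≤ w := by positivity
    have hw1 : w ≤ 1 / 64 := by linarith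
    have hE : |exp (2 * X) - 1| ≤ 12 * w := by
      have : |2 * X| ≤ 6 * w := by rw [abs_mul]; norm_num; linarith
      have := Real.abs_exp_sub_one_le (x := 2 * X) (by linarith)
      linarith
    have hG : |g ^ 2 - 1| ≤ 3 * w := by
      rw [show g ^ 2 - 1 = (g - 1) * ((g - 1) + 2) by ring, abs_mul]
      have : |g - 1 + 2| ≤ 3 := by
        have := abs_add_le (g - 1) 2
        norm_num at this; linarith
      nlinarith [abs_nonneg (g - 1), abs_nonneg (g - 1 + 2)]
    have := FN.prod_near hw0 hw1 hE hG
    linarith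

/-- Hölder type interpolation for `p2` -/
lemma p2_interp (h : FN K a C₀ f) {τ τ' t T D : ℝ} (hT : K + 1 ≤ T) (hT2 : 2 ≤ T) (ht : |t - T| ≤ 1) (htK : K < t) (hD : 0 ≤ D)
    (hl : |p2 f τ' t - p2 f τ T| ≤ 2 * C₀ ^ 5 * D) :
    |p2 f τ' t| ≤ 2 ^ (a + 3) * C₀ ^ 7 * T ^ (-a) ∧
    |p2 f τ T| ≤ 2 ^ (a + 3) * C₀ ^ 7 * T ^ (-a) ∧
    |p2 f τ' t - p2 f τ T| ≤ 2 ^ (a + 3) * C₀ ^ 7 * T ^ (-a) * D ^ (1 / (a + 1)) := by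
  have hC := h.C0pos
  have hC1 := h.C1
  have ha := h.a0
  have hT0 : 0 < T := by linarith
  have ht' : T / 2 ≤ t := by linarith [(abs_le.1 ht).1]
  have c27 : C₀ ^ 2 ≤ C₀ ^ 7 := pow_le_pow_right₀ hC1 (by norm_num)
  have two : (0:ℝ) < 2 ^ (a + 1) := by positivity
  have e1 : t ^ (-a - 1) ≤ 2 ^ (a + 1) * T ^ (-a - 1) := by
    calc t ^ (-a - 1) ≤ (T / 2) ^ (-a - 1) := rpow_le_rpow_of_nonpos (by linarith) ht' (by linarith)
      _ = _ := by
        rw [Real.div_rpow hT0.le (by norm_num), div_eq_mul_inv, ← Real.rpow_neg (by norm_num), mul_comm]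
        congr 2; ring
  have e2 : T ^ (-a - 1) ≤ T ^ (-a) := rpow_le_rpow_of_exponent_le (by linarith) (by linarith)
  have e3 : T ^ (-a - 1) ≤ 2 ^ (a + 1) * T ^ (-a - 1) := by
    have : (1:ℝ) ≤ 2 ^ (a + 1) := one_le_rpow (by norm_num) (by linarith)
    exact le_mul_of_one_le_left (by positivity) this
  have e4 : (2:ℝ) ^ (a + 3) = 4 * 2 ^ (a + 1) := by
    rw [show a + 3 = a + 1 + 2 by ring, rpow_add (by norm_num)]; norm_num; ring
  have e5 : (2:ℝ) ^ (a + 2) = 2 * 2 ^ (a + 1) := by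
    rw [show a + 2 = a + 1 + 1 by ring, rpow_add (by norm_num)]; norm_num; ring
  have d1 : |p2 f τ' t| ≤ C₀ ^ 2 * (2 ^ (a + 1) * T ^ (-a - 1)) :=
    (h.dec_p2 τ' htK).trans (by gcongr)
  have d2 : |p2 f τ T| ≤ C₀ ^ 2 * (2 ^ (a + 1) * T ^ (-a - 1)) :=
    (h.dec_p2 τ (by linarith)).trans (by gcongr)
  have d3 : C₀ ^ 2 * (2 ^ (a + 1) * T ^ (-a - 1)) ≤ 2 ^ (a + 3) * C₀ ^ 7 * T ^ (-a) := by
    calc C₀ ^ 2 * (2 ^ (a + 1) * T ^ (-a - 1)) ≤ C₀ ^ 7 * (2 ^ (a + 3) * T ^ (-a)) := by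
          rw [e4]
          gcongr
          linarith
      _ = _ := by ring
  refine ⟨d1.trans d3, d2.trans d3, ?_⟩
  set m := |p2 f τ' t - p2 f τ T| with hm
  have hm0 : 0 ≤ m := abs_nonneg _
  set X := C₀ ^ 2 * 2 ^ (a + 2) * T ^ (-a - 1) with hX
  have hmX : m ≤ X := by
    have := abs_sub (p2 f τ' t) (p2 f τ T)
    rw [hX, e5]; linarith
  have hX0 : 0 < X := by positivity
  set β := 1 / (a + 1) with hβ
  have hβ0 : 0 < β := by positivity
  have hβ1 : β ≤ 1 := by rw [hβ, div_le_one (by positivity)]; linarith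
  have i1 : m = m ^ (1 - β) * m ^ β := by
    rcases hm0.eq_or_lt with h0 | h0
    · rw [← h0, Real.zero_rpow hβ0.ne', mul_zero]
    · rw [← Real.rpow_add h0]; simp
  have i2 : m ^ (1 - β) ≤ C₀ ^ 2 * 2 ^ (a + 2) * T ^ (-a) := by
    refine (rpow_le_rpow hm0 hmX (by linarith)).trans ?_
    rw [hX, Real.mul_rpow (by positivity) (by positivity), ← Real.rpow_mul hT0.le]
    have : (-a - 1) * (1 - β) = -a := by rw [hβ]; field_simp; ring
    rw [this]
    gcongr
    have : 1 ≤ C₀ ^ 2 * 2 ^ (a + 2) := by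
      have : (1:ℝ) ≤ 2 ^ (a + 2) := one_le_rpow (by norm_num) (by linarith)
      have : 1 ≤ C₀ ^ 2 := one_le_pow₀ hC1
      nlinarith
    calc _ ≤ (C₀ ^ 2 * 2 ^ (a + 2)) ^ (1:ℝ) := rpow_le_rpow_of_exponent_le this (by linarith)
      _ = _ := Real.rpow_one _
  have i3 : m ^ β ≤ 2 * C₀ ^ 5 * D ^ β := by
    refine (rpow_le_rpow hm0 hl hβ0.le).trans ?_
    rw [Real.mul_rpow (by positivity) hD]
    gcongr
    have : 1 ≤ 2 * C₀ ^ 5 := by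
      have : 1 ≤ C₀ ^ 5 := one_le_pow₀ hC1
      linarith
    calc _ ≤ (2 * C₀ ^ 5) ^ (1:ℝ) := rpow_le_rpow_of_exponent_le this hβ1
      _ = _ := Real.rpow_one _
  calc m = m ^ (1 - β) * m ^ β := i1
    _ ≤ (C₀ ^ 2 * 2 ^ (a + 2) * T ^ (-a)) * (2 * C₀ ^ 5 * D ^ β) := mul_le_mul i2 i3 (by positivity) (by positivity)
    _ = _ := by rw [e4, e5]; ring

end FN
end

section
lemma alg3 {v0 v1 v2 s0 s1 s2 r1 r2 k lam V G : ℝ} (hr1 : |r1| ≤ lam) (hr2 : |r2| ≤ lam) (hk : |k - 1| ≤ lam)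
    (hl : lam ≤ 1 / 2) (h0 : |v0| ≤ V) (h1 : |v1| ≤ V) (h2 : |v2| ≤ V) (g0 : |s0| ≤ G) (g1 : |s1| ≤ G) (g2 : |s2| ≤ G) :
    |(v0 * s0 + v1 * s1 + v2 * s2) - (v0 * s0 + (v1 - r1 * v0) * (s1 - r1 * s0)
      + k * ((v2 - r2 * v0) * (s2 - r2 * s0)))| ≤ 10 * lam * (V * G) := by
  have l0 : 0 ≤ lam := (abs_nonneg _).trans hr1
  have V0 : 0 ≤ V := (abs_nonneg _).trans h0
  have G0 : 0 ≤ G := (abs_nonneg _).trans g0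
  have p : ∀ {x y : ℝ}, |x| ≤ V → |y| ≤ G → |x * y| ≤ V * G := fun hx hy => by
    rw [abs_mul]; exact mul_le_mul hx hy (abs_nonneg _) V0
  have Q0 : 0 ≤ V * G := by positivity
  have m : ∀ {x y L : ℝ}, |x| ≤ L → |y| ≤ V * G → |x * y| ≤ L * (V * G) := fun hx hy => by
    rw [abs_mul]; exact mul_le_mul hx hy (abs_nonneg _) ((abs_nonneg _).trans hx)
  have q1 : |r1 * r1| ≤ lam := by rw [abs_mul]; nlinarith [abs_nonneg r1]
  have q2 : |r2 * r2| ≤ lam := by rw [abs_mul]; nlinarith [abs_nonneg r2]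
  have hk2 : |k| ≤ 2 := by
    have : |k - 1 + 1| ≤ |k - 1| + 1 := by simpa using abs_add_le (k - 1) 1
    rw [sub_add_cancel] at this; linarith
  have kl : ∀ {x : ℝ}, |x| ≤ lam → |k * x| ≤ 2 * lam := fun hx => by
    rw [abs_mul]; exact mul_le_mul hk2 hx (abs_nonneg _) (by norm_num)
  have a1 := abs_le.1 (m hr1 (p h0 g1))
  have a2 := abs_le.1 (m hr1 (p h1 g0))
  have a3 := abs_le.1 (m q1 (p h0 g0))
  have a4 := abs_le.1 (m hk (p h2 g2))
  have a5 := abs_le.1 (m (kl hr2) (p h0 g2))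
  have a6 := abs_le.1 (m (kl hr2) (p h2 g0))
  have a7 := abs_le.1 (m (kl q2) (p h0 g0))
  have e : (v0 * s0 + v1 * s1 + v2 * s2) - (v0 * s0 + (v1 - r1 * v0) * (s1 - r1 * s0)
      + k * ((v2 - r2 * v0) * (s2 - r2 * s0))) = r1 * (v0 * s1) + r1 * (v1 * s0) - (r1 * r1) * (v0 * s0)
      - (k - 1) * (v2 * s2) + (k * r2) * (v0 * s2) + (k * r2) * (v2 * s0) - (k * (r2 * r2)) * (v0 * s0) := by ring
  rw [e, abs_le]
  constructor <;> linarith [a1.1, a1.2, a2.1, a2.2, a3.1, a3.2, a4.1, a4.2, a5.1, a5.2, a6.1, a6.2, a7.1, a7.2]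

/-- normalization of the boundary normal -/
noncomputable def nN (f : ℝ → ℝ → ℝ) (o : Fin 3 → ℝ) : ℝ :=
  Real.sqrt (1 + p1 f (o 1) (o 2) ^ 2 + (rho f o * p2 f (o 1) (o 2)) ^ 2)
/-- boundary normal in the chart -/
noncomputable def nn (f : ℝ → ℝ → ℝ) (o : Fin 3 → ℝ) : Fin 3 → ℝ :=
  ![1 / nN f o, - p1 f (o 1) (o 2) / nN f o, - (rho f o * p2 f (o 1) (o 2)) / nN f o]
/-- distance to the boundary plane in the chart -/
noncomputable def dd (f : ℝ → ℝ → ℝ) (o : Fin 3 → ℝ) : ℝ := - o 0 / nN f o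

lemma nN_ge (f : ℝ → ℝ → ℝ) (o : Fin 3 → ℝ) : 1 ≤ nN f o := by
  rw [nN, Real.one_le_sqrt]; nlinarith [sq_nonneg (p1 f (o 1) (o 2)), sq_nonneg (rho f o * p2 f (o 1) (o 2))]

lemma sq3_nn (f : ℝ → ℝ → ℝ) (o : Fin 3 → ℝ) : sq3 (nn f o) = 1 := by
  have h1 := nN_ge f o
  have h2 : nN f o ^ 2 = 1 + p1 f (o 1) (o 2) ^ 2 + (rho f o * p2 f (o 1) (o 2)) ^ 2 :=
    Real.sq_sqrt (by positivity)
  have : nN f o ≠ 0 := by linarith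
  simp only [sq3, nn, Matrix.cons_val]
  field_simp
  linarith

lemma mem_HS (f : ℝ → ℝ → ℝ) (o z : Fin 3 → ℝ) : z ∈ HS (nn f o) (dd f o) ↔ aff f o z 0 < 0 := by
  have h1 : 0 < nN f o := by linarith [nN_ge f o]
  have e : ell (nn f o) z - dd f o = (nN f o)⁻¹ * aff f o z 0 := by
    simp only [ell, nn, dd, aff, Matrix.cons_val]; field_simp; ring
  change ell (nn f o) z < dd f o ↔ _
  rw [← sub_neg, e]
  have hi := inv_pos.2 h1
  refine ⟨fun h => ?_, fun h => mul_neg_of_pos_of_neg hi h⟩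
  by_contra hc
  push Not at hc
  linarith [mul_nonneg hi.le hc]

lemma B3_abs {δ : ℝ} (hδ : 0 < δ) {z : Fin 3 → ℝ} (hz : z ∈ B3 δ) (i : Fin 3) : |z i| < δ := by
  have hz' : sq3 z < δ ^ 2 := hz
  exact abs_lt_of_sq_lt_sq ((coord_sq_le z i).trans_lt hz') hδ.le

namespace FN
variable {K a C₀ : ℝ} {f : ℝ → ℝ → ℝ}

lemma B3_ZU (h : FN K a C₀ f) {o : Fin 3 → ℝ} (hT : K + 3 * C₀ + 2 ≤ o 2) (h0 : o 0 < 0) (h1 : 1 / 2 ≤ exp (o 0))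
    {z : Fin 3 → ℝ} (hz : ∀ i, |z i| ≤ 3) : z ∈ ZU f K o := by
  have hC := h.C0pos
  obtain ⟨hR1, hR2⟩ := h.rho_rng (by linarith : K < o 2) h0 h1
  have hR := h.rho_pos (by linarith : K < o 2)
  refine ⟨?_, ?_⟩
  · linarith [hz 1, pi_gt_three]
  · have : |rho f o * z 2| ≤ C₀ * 3 := by
      rw [abs_mul, abs_of_pos hR]; exact mul_le_mul hR2 (hz 2) (abs_nonneg _) hC.le
    linarith [(abs_le.1 this).1]

lemma exp_half {x : ℝ} (h1 : 1 / 2 ≤ exp x) : -x ≤ 7 / 10 := by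
  have := Real.log_two_lt_d9
  have h2 : Real.log (1 / 2) ≤ x := by
    rw [← Real.log_exp x]; exact Real.log_le_log (by norm_num) h1
  rw [one_div, Real.log_inv] at h2
  linarith

lemma dd_bd {o : Fin 3 → ℝ} (f : ℝ → ℝ → ℝ) (h0 : o 0 < 0) (h1 : 1 / 2 ≤ exp (o 0)) :
    0 < dd f o ∧ dd f o ≤ 7 / 10 := by
  have hN := nN_ge f o
  have := exp_half h1
  refine ⟨div_pos (by linarith) (by linarith), ?_⟩
  rw [dd, div_le_iff₀ (by linarith)]; nlinarith

lemma Pst_ZU (h : FN K a C₀ f) {o : Fin 3 → ℝ} (hT : K + 3 * C₀ + 2 ≤ o 2) (h0 : o 0 < 0) (h1 : 1 / 2 ≤ exp (o 0))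
    (i : Fin 3) {ε : ℝ} (hε : 0 < ε) (hε1 : ε ≤ 1) : tsupport (Pst (nn f o) (dd f o) i ε) ⊆ ZU f K o := by
  obtain ⟨d0, d1⟩ := dd_bd f h0 h1
  intro z hz
  have := Pst_ts (sq3_nn f o) d0 i hε hz
  have h2 : sq3 z ≤ (2 * dd f o + ε) ^ 2 := this
  refine h.B3_ZU hT h0 h1 fun i => ?_
  have := abs_le_of_sq_le_sq ((coord_sq_le z i).trans h2) (by positivity)
  linarith

/-- local data of the chart on a small ball -/
lemma loc_chart (h : FN K a C₀ f) {o : Fin 3 → ℝ} (hT : K + 3 * C₀ + 2 ≤ o 2) (h0 : o 0 < 0) (h1 : 1 / 2 ≤ exp (o 0))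
    {ε : ℝ} (hε0 : 0 < ε) (hε : 64 * C₀ ^ 7 * ε ≤ 1) :
    HS (nn f o) (dd f o) ∩ B3 ε = ZW f K o ∩ B3 ε ∧ ∀ z ∈ ZW f K o ∩ B3 ε,
      PH f o z ∈ nozzleFrom f K ∧ |PH f o z 2 - o 2| ≤ 1 ∧ |PH f o z 0| ≤ C₀ ∧ |PH f o z 1| ≤ C₀ ∧
      |p1 f (aff f o z 1) (aff f o z 2) - p1 f (o 1) (o 2)| ≤ 32 * C₀ ^ 7 * ε ∧
      |rho f o * (p2 f (aff f o z 1) (aff f o z 2) - p2 f (o 1) (o 2))| ≤ 32 * C₀ ^ 7 * ε ∧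
      |rho f (aff f o z) ^ 2 / rho f o ^ 2 - 1| ≤ 32 * C₀ ^ 7 * ε ∧
      |p2 f (aff f o z 1) (aff f o z 2)| ≤ 2 ^ (a + 3) * C₀ ^ 7 * o 2 ^ (-a) ∧
      |p2 f (aff f o z 1) (aff f o z 2) - p2 f (o 1) (o 2)| ≤
        2 ^ (a + 3) * C₀ ^ 7 * o 2 ^ (-a) * ε ^ (1 / (a + 1)) ∧
      |p2 f (o 1) (o 2)| ≤ 2 ^ (a + 3) * C₀ ^ 7 * o 2 ^ (-a) := by
  have hC := h.C0pos
  have hC1 := h.C1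
  have hK := h.K1
  have ho : K < o 2 := by linarith
  obtain ⟨hR1, hR2⟩ := h.rho_rng ho h0 h1
  have hR := h.rho_pos ho
  have c7 : C₀ ≤ C₀ ^ 7 := le_self_pow₀ hC1 (by norm_num)
  have hCe : C₀ * ε ≤ 1 := by nlinarith
  have hε1 : ε ≤ 1 := by nlinarith
  constructor
  · ext z
    constructor
    · rintro ⟨z1, z2⟩
      exact ⟨⟨(mem_HS f o z).1 z1, h.B3_ZU hT h0 h1 fun i => (B3_abs hε0 z2 i).le.trans (by linarith)⟩, z2⟩
    · rintro ⟨z1, z2⟩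
      exact ⟨(mem_HS f o z).2 z1.1, z2⟩
  · rintro z ⟨z1, z2⟩
    have hz : ∀ i, |z i| ≤ ε := fun i => (B3_abs hε0 z2 i).le
    have h2 : K < aff f o z 2 := by rw [aff_two]; exact z1.2.2
    have hX : PH f o z ∈ nozzleFrom f K := h.Th_mem h2 z1.1
    obtain ⟨b1, b2, b3, b4⟩ := h.chart_bd ho h0 h1 hz (by linarith) z1.2.2
    have hP2 : PH f o z 2 = aff f o z 2 := rfl
    have ht : |aff f o z 2 - o 2| ≤ 1 := by
      rw [aff_two, add_sub_cancel_left, abs_mul, abs_of_pos hR]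
      exact (mul_le_mul hR2 (hz 2) (abs_nonneg _) hC.le).trans hCe
    obtain ⟨c1, c2, c3⟩ := h.p2_interp (τ := o 1) (T := o 2) (by linarith) (by linarith) ht h2 hε0.le b4
    exact ⟨hX, by rw [hP2]; exact ht, (abs0_le_rad _).trans (h.rad_le hX), (abs1_le_rad _).trans (h.rad_le hX),
      b1, b2, b3, c1, c3, c2⟩

end FN
end

section
/-- local L1 norm of the gradient of `u` -/
noncomputable def II (K m₀ : ℝ) (f : ℝ → ℝ → ℝ) (φ : (Fin 3 → ℝ) → ℝ) (T : ℝ) : ℝ :=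
  ∫ y in nozzleFrom f K ∩ {y | |y 2 - T| ≤ 1}, ∑ j, |grad3 (uu m₀ φ) y j|

lemma meas_slab1 (T : ℝ) : MeasurableSet {y : Fin 3 → ℝ | |y 2 - T| ≤ 1} :=
  (isClosed_le (f := fun y : Fin 3 → ℝ => |y 2 - T|) (by fun_prop) continuous_const).measurableSet

namespace SP
variable {K a C₀ m₀ M : ℝ} {f : ℝ → ℝ → ℝ} {φ : (Fin 3 → ℝ) → ℝ}

/-- the corrected function in the chart -/
noncomputable def vc (m₀ : ℝ) (f : ℝ → ℝ → ℝ) (φ : (Fin 3 → ℝ) → ℝ) (o : Fin 3 → ℝ) (z : Fin 3 → ℝ) : ℝ :=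
  uu m₀ φ (PH f o z) - m₀ / π * (rho f o ^ 2 * p2 f (o 1) (o 2)) * z 0

lemma v_diff (h : SP K a C₀ m₀ M f φ) {o z : Fin 3 → ℝ} (hz : K < o 2 + rho f o * z 2)
    (hX : PH f o z ∈ nozzleFrom f K) : DifferentiableAt ℝ (fun z => uu m₀ φ (PH f o z)) z :=
  DifferentiableAt.comp z (h.u_diff hX) (h.fn.PH_hasFDerivAt hz).differentiableAt

lemma vc_grad (h : SP K a C₀ m₀ M f φ) {o z : Fin 3 → ℝ} (hz : K < o 2 + rho f o * z 2)
    (hX : PH f o z ∈ nozzleFrom f K) : DifferentiableAt ℝ (vc m₀ f φ o) z ∧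
    grad3 (vc m₀ f φ o) z 0 = grad3 (fun z => uu m₀ φ (PH f o z)) z 0 - m₀ / π * (rho f o ^ 2 * p2 f (o 1) (o 2)) ∧
    grad3 (vc m₀ f φ o) z 1 = grad3 (fun z => uu m₀ φ (PH f o z)) z 1 ∧
    grad3 (vc m₀ f φ o) z 2 = grad3 (fun z => uu m₀ φ (PH f o z)) z 2 := by
  have h1 := (h.v_diff hz hX).hasFDerivAt
  have h2 := (hasFDerivAt_apply (𝕜 := ℝ) (F' := fun _ : Fin 3 => ℝ) 0 z).const_mul
    (m₀ / π * (rho f o ^ 2 * p2 f (o 1) (o 2)))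
  have h3 : HasFDerivAt (vc m₀ f φ o) _ z := h1.sub h2
  refine ⟨h3.differentiableAt, ?_, ?_, ?_⟩ <;> rw [grad3, h3.fderiv] <;> simp [grad3]

lemma v_bd (h : SP K a C₀ m₀ M f φ) {o : Fin 3 → ℝ} (hT : K + 3 * C₀ + 2 ≤ o 2) (h0 : o 0 < 0) (h1 : 1 / 2 ≤ exp (o 0))
    {ε : ℝ} (hε0 : 0 < ε) (hε : 64 * C₀ ^ 7 * ε ≤ 1) {z : Fin 3 → ℝ} (hz : z ∈ ZW f K o ∩ B3 ε) (j : Fin 3) :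
    |grad3 (fun z => uu m₀ φ (PH f o z)) z j| ≤ 2 * C₀ * ∑ j, |grad3 (uu m₀ φ) (PH f o z) j| := by
  have ho : K < o 2 := by linarith [h.fn.C0pos]
  have hC := h.fn.C0pos
  obtain ⟨hR1, hR2⟩ := h.fn.rho_rng ho h0 h1
  have hR := h.fn.rho_pos ho
  obtain ⟨hX, ht, x0, x1, b1, b2, b3, -⟩ := (h.fn.loc_chart hT h0 h1 hε0 hε).2 z hz
  obtain ⟨a0, a1, a2⟩ := h.fn.grad_PH hz.1.2.2 (h.u_diff hX)
  rw [Fin.sum_univ_three]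
  set U := grad3 (uu m₀ φ) (PH f o z) with hU
  set v := grad3 (fun z => uu m₀ φ (PH f o z)) z with hv
  have m0 : |v 0| ≤ C₀ * (|U 0| + |U 1|) := by
    rw [a0]
    refine (abs_add_le _ _).trans ?_
    rw [abs_mul, abs_mul]
    nlinarith [abs_nonneg (U 0), abs_nonneg (U 1)]
  have m1 : |- PH f o z 1 * U 0 + PH f o z 0 * U 1| ≤ C₀ * (|U 0| + |U 1|) := by
    refine (abs_add_le _ _).trans ?_
    rw [abs_mul, abs_mul, abs_neg]
    nlinarith [abs_nonneg (U 0), abs_nonneg (U 1)]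
  have m2 : |rho f o * U 2| ≤ C₀ * |U 2| := by
    rw [abs_mul, abs_of_pos hR]; nlinarith [abs_nonneg (U 2)]
  have hh : ∀ {r : ℝ}, |r| ≤ 32 * C₀ ^ 7 * ε → |r * v 0| ≤ 1 / 2 * |v 0| := fun hr => by
    rw [abs_mul]; exact mul_le_mul_of_nonneg_right (by linarith) (abs_nonneg _)
  have n0 := mul_nonneg hC.le (abs_nonneg (U 0))
  have n1 := mul_nonneg hC.le (abs_nonneg (U 1))
  have n2 := mul_nonneg hC.le (abs_nonneg (U 2))
  fin_cases j
  · change |v 0| ≤ _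
    linarith
  · change |v 1| ≤ _
    rw [a1]
    refine (abs_add_le _ _).trans ?_
    linarith [hh b1]
  · change |v 2| ≤ _
    rw [a2]
    refine (abs_add_le _ _).trans ?_
    linarith [hh b2]

lemma H_bd (h : SP K a C₀ m₀ M f φ) {o : Fin 3 → ℝ} (hT : K + 3 * C₀ + 2 ≤ o 2) (h0 : o 0 < 0) (h1 : 1 / 2 ≤ exp (o 0))
    {S : ℝ} (hS : ∀ y ∈ nozzleFrom f K, |y 2 - o 2| ≤ 1 → ∀ j, |grad3 (uu m₀ φ) y j| ≤ S) {G : ℝ} (hG1 : 1 ≤ G)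
    (hG : ∀ (n : Fin 3 → ℝ) (d : ℝ) (i : Fin 3) (ε : ℝ) (z : Fin 3 → ℝ), sq3 n = 1 → 0 < ε →
    |Pst n d i ε z| ≤ G * ε ∧ ∀ j, |grad3 (Pst n d i ε) z j| ≤ G) (i : Fin 3)
    {ε : ℝ} (hε0 : 0 < ε) (hε : 64 * C₀ ^ 7 * ε ≤ 1) {P : ℝ} (hP : P = 2 ^ (a + 3) * C₀ ^ 7 * o 2 ^ (-a)) :
    |∫ z in HS (nn f o) (dd f o), ∑ j, grad3 (vc m₀ f φ o) z j * grad3 (Pst (nn f o) (dd f o) i ε) z j| ≤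
      ε ^ 3 * ((8 * (320 * C₀ ^ 7 * (6 * C₀ * S * G) + |m₀ / π| * G * (C₀ ^ 2 * P * (32 * C₀ ^ 7 + 4)))) * ε
        + (8 * |m₀ / π| * G * C₀ ^ 2 * P) * ε ^ (1 / (a + 1))) := by
  have hC := h.fn.C0pos
  have ho : K < o 2 := by linarith
  have hK := h.fn.K1
  obtain ⟨d0, d1⟩ := FN.dd_bd f h0 h1
  have hn := sq3_nn f o
  obtain ⟨hR1, hR2⟩ := h.fn.rho_rng ho h0 h1
  have hR := h.fn.rho_pos ho
  have c7 : 1 ≤ C₀ ^ 7 := one_le_pow₀ h.fn.C1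
  have hε1 : ε ≤ 1 := by nlinarith
  set Ψ := Pst (nn f o) (dd f o) i ε with hΨ
  set D := ZW f K o ∩ B3 ε with hD
  have P0 : 0 ≤ P := by rw [hP]; have : 0 < o 2 := by linarith
                        positivity
  obtain ⟨hDe, hloc⟩ := h.fn.loc_chart hT h0 h1 hε0 hε
  have hS0 : 0 ≤ S := by
    have hz0 : (0 : Fin 3 → ℝ) ∈ ZW f K o ∩ B3 ε := by
      rw [← hDe]
      refine ⟨?_, ?_⟩
      · change ell (nn f o) 0 < dd f o; simpa [ell] using d0
      · change sq3 0 < ε ^ 2; simp [sq3]; positivity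
    obtain ⟨hX, ht, -⟩ := hloc 0 hz0
    exact (abs_nonneg _).trans (hS _ hX ht 0)
  obtain ⟨EI, EE⟩ := h.EQ ho ((Pst_contDiff (nn f o) (dd f o) i ε).of_le (by norm_num))
    (Pst_cs hn d0 i hε0) (h.fn.Pst_ZU hT h0 h1 i hε0 hε1)
  rw [← hΨ] at EI EE
  set W := WW f (m₀ / π) o (fun z => uu m₀ φ (PH f o z)) Ψ with hW
  have hDm : MeasurableSet D := ((FN.isOpen_ZW f K o).inter (B3_open ε)).measurableSet
  have hDv : volume D < ⊤ := (measure_mono inter_subset_right).trans_lt (B3_vol ε)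
  have hDr : volume.real D ≤ 8 * ε ^ 3 :=
    (measureReal_mono inter_subset_right (B3_vol ε).ne).trans (B3_volr hε0)
  have e1 : ∫ z in HS (nn f o) (dd f o), ∑ j, grad3 (vc m₀ f φ o) z j * grad3 Ψ z j
      = ∫ z in D, ∑ j, grad3 (vc m₀ f φ o) z j * grad3 Ψ z j := by
    rw [hD, ← hDe]
    refine setIntegral_eq_of_subset_of_forall_sdiff_eq_zero (HS_open _ _).measurableSet inter_subset_left ?_
    rintro z ⟨z1, z2⟩
    have : ε ^ 2 ≤ sq3 z := by
      by_contra hc; push Not at hc; exact z2 ⟨z1, hc⟩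
    refine Finset.sum_eq_zero fun j _ => ?_
    rw [(Pst_zero_HS hn d0 i hε0 z1 this).2 j, mul_zero]
  have e2 : ∫ z in D, W z = 0 := by
    rw [← EE]
    symm
    refine setIntegral_eq_of_subset_of_forall_sdiff_eq_zero (FN.isOpen_ZW _ _ _).measurableSet inter_subset_left ?_
    rintro z ⟨z1, z2⟩
    have : ε ^ 2 ≤ sq3 z := by
      by_contra hc; push Not at hc; exact z2 ⟨z1, hc⟩
    obtain ⟨q1, q2⟩ := Pst_zero_HS hn d0 i hε0 ((mem_HS f o z).2 z1.1) this
    rw [← hΨ] at q1 q2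
    simp only [hW, WW, q1, q2]
    ring
  rw [e1]
  have hpt : ∀ z ∈ D, ‖(∑ j, grad3 (vc m₀ f φ o) z j * grad3 Ψ z j) - W z‖ ≤
      (320 * C₀ ^ 7 * (6 * C₀ * S * G) + |m₀ / π| * G * (C₀ ^ 2 * P * (32 * C₀ ^ 7 + 4))) * ε
        + (|m₀ / π| * G * C₀ ^ 2 * P) * ε ^ (1 / (a + 1)) := by
    intro z hz
    obtain ⟨hX, ht, x0, x1, b1, b2, b3, b4, b5, b6⟩ := hloc z hz
    obtain ⟨-, c0, c1, c2⟩ := h.vc_grad hz.1.2.2 hX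
    obtain ⟨G1, G2⟩ := hG (nn f o) (dd f o) i ε z hn hε0
    rw [← hΨ] at G1 G2
    have hV : ∀ j, |grad3 (fun z => uu m₀ φ (PH f o z)) z j| ≤ 6 * C₀ * S := fun j => by
      refine (h.v_bd hT h0 h1 hε0 hε hz j).trans ?_
      have : ∑ j, |grad3 (uu m₀ φ) (PH f o z) j| ≤ ∑ _j : Fin 3, S := Finset.sum_le_sum fun j _ => hS _ hX ht j
      simp at this
      nlinarith
    have A1 := alg3 b1 b2 b3 (by linarith) (hV 0) (hV 1) (hV 2) (G2 0) (G2 1) (G2 2)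
    rw [Fin.sum_univ_three, c0, c1, c2, Real.norm_eq_abs]
    simp only [hW, WW]
    rw [← hP] at b4 b5
    set k := rho f (aff f o z) ^ 2 / rho f o ^ 2 with hk
    have hkr : rho f (aff f o z) ^ 2 = k * rho f o ^ 2 := by rw [hk]; field_simp
    rw [hkr]
    set v := grad3 (fun z => uu m₀ φ (PH f o z)) z
    set g := grad3 Ψ z
    set s2 := p2 f (aff f o z 1) (aff f o z 2)
    set c := p2 f (o 1) (o 2)
    set s1 := p1 f (aff f o z 1) (aff f o z 2) - p1 f (o 1) (o 2)
    set R := rho f o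
    set q := m₀ / π
    set β := ε ^ (1 / (a + 1))
    have hβ : 0 ≤ β := by positivity
    have hRR : R ^ 2 ≤ C₀ ^ 2 := by gcongr
    have k2 : |k| ≤ 2 := by
      have : |k - 1 + 1| ≤ |k - 1| + 1 := by simpa using abs_add_le (k - 1) 1
      rw [sub_add_cancel] at this; linarith
    have A2 : |q * R ^ 2 * ((k - 1) * s2 + (s2 - c)) * g 0| ≤ |q| * C₀ ^ 2 * (32 * C₀ ^ 7 * ε * P + P * β) * G := by
      rw [abs_mul, abs_mul, abs_mul, abs_of_nonneg (sq_nonneg R)]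
      have : |(k - 1) * s2 + (s2 - c)| ≤ 32 * C₀ ^ 7 * ε * P + P * β := by
        refine (abs_add_le _ _).trans (add_le_add ?_ b5)
        rw [abs_mul]; exact mul_le_mul b3 b4 (abs_nonneg _) (by positivity)
      gcongr
      exact G2 0
    have A3 : |q * R ^ 2 * (k * s2) * (2 * Ψ z)| ≤ |q| * C₀ ^ 2 * (2 * P) * (2 * (G * ε)) := by
      rw [abs_mul, abs_mul, abs_mul, abs_of_nonneg (sq_nonneg R)]
      have : |k * s2| ≤ 2 * P := by
        rw [abs_mul]; exact mul_le_mul k2 b4 (abs_nonneg _) (by positivity)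
      have h2 : |2 * Ψ z| ≤ 2 * (G * ε) := by rw [abs_mul]; norm_num; exact G1
      gcongr
    have e : (v 0 - q * (R ^ 2 * c)) * g 0 + v 1 * g 1 + v 2 * g 2 -
        (v 0 * g 0 + (v 1 - s1 * v 0) * (g 1 - s1 * g 0)
        + k * ((v 2 - R * (s2 - c) * v 0) * (g 2 - R * (s2 - c) * g 0)) - q * (k * R ^ 2 * s2) * (g 0 + 2 * Ψ z))
        = ((v 0 * g 0 + v 1 * g 1 + v 2 * g 2) - (v 0 * g 0 + (v 1 - s1 * v 0) * (g 1 - s1 * g 0)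
        + k * ((v 2 - R * (s2 - c) * v 0) * (g 2 - R * (s2 - c) * g 0))))
        + q * R ^ 2 * ((k - 1) * s2 + (s2 - c)) * g 0 + q * R ^ 2 * (k * s2) * (2 * Ψ z) := by ring
    rw [e]
    refine (abs_add_le _ _).trans ((add_le_add ((abs_add_le _ _).trans (add_le_add A1 A2)) A3).trans (le_of_eq ?_))
    ring
  by_cases hI : IntegrableOn (fun z => ∑ j, grad3 (vc m₀ f φ o) z j * grad3 Ψ z j) D
  · have hW2 : Integrable W (volume.restrict D) := EI.mono_set inter_subset_left
    have hsub := integral_sub hI hW2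
    rw [e2, sub_zero] at hsub
    rw [← hsub]
    have := norm_setIntegral_le_of_norm_le_const hDv hpt
    rw [Real.norm_eq_abs] at this
    refine this.trans ?_
    refine (mul_le_mul_of_nonneg_left hDr (by positivity)).trans (le_of_eq ?_)
    ring
  · rw [integral_undef hI, abs_zero]
    positivity

end SP
end

section
lemma FN.PH_contDiffAt {K a C₀ : ℝ} {f : ℝ → ℝ → ℝ} (h : FN K a C₀ f) {o z : Fin 3 → ℝ}
    (hz : K < o 2 + rho f o * z 2) : ContDiffAt ℝ 1 (PH f o) z := by
  have h1 : K < aff f o z 2 := by rw [FN.aff_two]; exact hz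
  have ha : ContDiffAt ℝ 1 (aff f o) z := by
    have : aff f o = fun z => AL f o z + o := by funext z; exact FN.aff_eq f o z
    rw [this]; exact ((AL f o).contDiff.add contDiff_const).contDiffAt
  refine ContDiffAt.comp z (g := Th f) ?_ ha
  set y := aff f o z
  have c : ∀ i : Fin 3, ContDiffAt ℝ 1 (fun y : Fin 3 → ℝ => y i) y := fun i => (contDiff_apply ℝ ℝ i).contDiffAt
  have hf : ContDiffAt ℝ 1 (fun y : Fin 3 → ℝ => f (y 1) (y 2)) y := by
    have h2 : ContDiffAt ℝ 1 (fun p : ℝ × ℝ => f p.1 p.2) (y 1, y 2) :=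
      (h.c2.contDiffAt ((FN.isOpenS K).mem_nhds h1)).of_le (by norm_num)
    exact ContDiffAt.comp y (f := fun y : Fin 3 → ℝ => (y 1, y 2)) h2 ((c 1).prodMk (c 2))
  have hr : ContDiffAt ℝ 1 (rho f) y := (c 0).exp.mul hf
  rw [contDiffAt_pi]
  intro i
  fin_cases i
  · exact hr.mul (c 1).cos
  · exact hr.mul (c 1).sin
  · exact c 2

namespace SP
variable {K a C₀ m₀ M : ℝ} {f : ℝ → ℝ → ℝ} {φ : (Fin 3 → ℝ) → ℝ}

lemma vc_cont (h : SP K a C₀ m₀ M f φ) {o z : Fin 3 → ℝ} (hz : K < o 2 + rho f o * z 2)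
    (hX : PH f o z ∈ nozzleFrom f K) (j : Fin 3) : ContinuousAt (fun z => grad3 (vc m₀ f φ o) z j) z := by
  have h1 : ContDiffAt ℝ 1 (vc m₀ f φ o) z :=
    (ContDiffAt.comp z (h.u_c1 hX) (h.fn.PH_contDiffAt hz)).sub
      (contDiffAt_const.mul (contDiff_apply ℝ ℝ (0 : Fin 3)).contDiffAt)
  exact (h1.fderiv_right (m := 0) (by norm_num)).continuousAt.clm_apply continuousAt_const

lemma u_int_slab (h : SP K a C₀ m₀ M f φ) (T : ℝ) :
    IntegrableOn (fun y => {y : Fin 3 → ℝ | |y 2 - T| ≤ 1}.indicator (fun y => ∑ j, |grad3 (uu m₀ φ) y j|) y)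
      (nozzleFrom f K) := by
  refine h.fn.int_slab (t1 := T - 1) (t2 := T + 1) (B := ∑ _j : Fin 3, (M + |m₀ / π|)) ?_ ?_ ?_
  · exact ((Finset.measurable_sum _ fun i _ => (grad_meas _ i).abs).indicator (meas_slab1 T)).aestronglyMeasurable
  · intro x hx
    by_cases hs : x ∈ {y : Fin 3 → ℝ | |y 2 - T| ≤ 1}
    · rw [indicator_of_mem hs, abs_of_nonneg (Finset.sum_nonneg fun j _ => abs_nonneg _)]
      exact Finset.sum_le_sum fun j _ => h.u_bd hx j
    · rw [indicator_of_notMem hs, abs_zero]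
      have := (abs_nonneg _).trans (h.u_bd hx 0)
      exact Finset.sum_nonneg fun _ _ => this
  · intro x hx hs
    refine indicator_of_notMem ?_ _
    intro hc
    have := abs_le.1 (show |x 2 - T| ≤ 1 from hc)
    rcases hs with hs | hs <;> linarith

lemma int_v (h : SP K a C₀ m₀ M f φ) {o : Fin 3 → ℝ} (hT : K + 3 * C₀ + 2 ≤ o 2) (h0 : o 0 < 0) (h1 : 1 / 2 ≤ exp (o 0))
    {ε : ℝ} (hε0 : 0 < ε) (hε : 64 * C₀ ^ 7 * ε ≤ 1) {E : ℝ} (hE : |m₀ / π * (rho f o ^ 2 * p2 f (o 1) (o 2))| ≤ E) :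
    ∫ z in HS (nn f o) (dd f o) ∩ B3 ε, ∑ j, |grad3 (vc m₀ f φ o) z j| ≤
      96 * C₀ ^ 4 * II K m₀ f φ (o 2) + 8 * ε ^ 3 * E := by
  have hC := h.fn.C0pos
  have ho : K < o 2 := by linarith
  obtain ⟨hDe, hloc⟩ := h.fn.loc_chart hT h0 h1 hε0 hε
  obtain ⟨hR1, hR2⟩ := h.fn.rho_rng ho h0 h1
  have hR := h.fn.rho_pos ho
  have hE0 := (abs_nonneg _).trans hE
  set D := ZW f K o ∩ B3 ε with hD
  rw [hDe]
  have hDm : MeasurableSet D := ((FN.isOpen_ZW f K o).inter (B3_open ε)).measurableSet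
  have hDv : volume D < ⊤ := (measure_mono inter_subset_right).trans_lt (B3_vol ε)
  have hDr : volume.real D ≤ 8 * ε ^ 3 :=
    (measureReal_mono inter_subset_right (B3_vol ε).ne).trans (B3_volr hε0)
  set g : (Fin 3 → ℝ) → ℝ := fun y => {y : Fin 3 → ℝ | |y 2 - o 2| ≤ 1}.indicator
    (fun y => ∑ j, |grad3 (uu m₀ φ) y j|) y with hg
  have hg0 : ∀ y, 0 ≤ g y := fun y => indicator_nonneg (fun y _ => Finset.sum_nonneg fun j _ => abs_nonneg _) y
  have i1 := h.u_int_slab (o 2)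
  have i2 := (h.fn.integrable_PH ho g).1 i1
  have e1 : II K m₀ f φ (o 2) = ∫ z in ZW f K o, rho f o * (rho f (aff f o z) ^ 2 * g (PH f o z)) := by
    rw [← h.fn.integral_PH ho g, hg, setIntegral_indicator (meas_slab1 _)]; rfl
  have i3 : IntegrableOn (fun z => rho f o * (rho f (aff f o z) ^ 2 * g (PH f o z))) D := i2.mono_set inter_subset_left
  have i4 : IntegrableOn (fun z => 96 * C₀ ^ 4 * (rho f o * (rho f (aff f o z) ^ 2 * g (PH f o z))) + E) D := by
    refine Integrable.add (i3.const_mul _) ?_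
    exact integrableOn_const hDv.ne
  have hpt : ∀ z ∈ D, ∑ j, |grad3 (vc m₀ f φ o) z j| ≤
      96 * C₀ ^ 4 * (rho f o * (rho f (aff f o z) ^ 2 * g (PH f o z))) + E := by
    intro z hz
    obtain ⟨hX, ht, x0, x1, b1, b2, b3, -⟩ := hloc z hz
    obtain ⟨-, c0, c1, c2⟩ := h.vc_grad hz.1.2.2 hX
    have v := h.v_bd hT h0 h1 hε0 hε hz
    have hgz : g (PH f o z) = ∑ j, |grad3 (uu m₀ φ) (PH f o z) j| := indicator_of_mem (show PH f o z ∈ {y : Fin 3 → ℝ | |y 2 - o 2| ≤ 1} from ht) _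
    rw [← hgz] at v
    rw [Fin.sum_univ_three, c0, c1, c2]
    have s1 := abs_sub (grad3 (fun z => uu m₀ φ (PH f o z)) z 0) (m₀ / π * (rho f o ^ 2 * p2 f (o 1) (o 2)))
    have hk : 1 / 2 ≤ rho f (aff f o z) ^ 2 / rho f o ^ 2 := by
      linarith [(abs_le.1 b3).1]
    have hJ : 1 ≤ 16 * C₀ ^ 3 * (rho f o * rho f (aff f o z) ^ 2) := by
      rw [le_div_iff₀ (by positivity)] at hk
      have h3 : 1 ≤ 2 * C₀ * rho f o := by rwa [div_le_iff₀' (by positivity)] at hR1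
      have h4 : 1 ≤ (2 * C₀ * rho f o) ^ 3 := one_le_pow₀ h3
      have h5 : 0 < C₀ ^ 3 * rho f o := by positivity
      nlinarith
    have := v 0
    have := v 1
    have := v 2
    have h6 : C₀ * g (PH f o z) ≤ (16 * C₀ ^ 3 * (rho f o * rho f (aff f o z) ^ 2)) * (C₀ * g (PH f o z)) :=
      le_mul_of_one_le_left (mul_nonneg hC.le (hg0 _)) hJ
    nlinarith
  have hm : AEStronglyMeasurable (fun z => ∑ j, |grad3 (vc m₀ f φ o) z j|) (volume.restrict D) :=
    (Finset.measurable_sum _ fun i _ => (grad_meas _ i).abs).aestronglyMeasurable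
  have i5 : IntegrableOn (fun z => ∑ j, |grad3 (vc m₀ f φ o) z j|) D := by
    refine Integrable.mono' i4 hm ?_
    filter_upwards [ae_restrict_mem hDm] with z hz
    rw [Real.norm_eq_abs, abs_of_nonneg (Finset.sum_nonneg fun j _ => abs_nonneg _)]
    exact hpt z hz
  refine (setIntegral_mono_on i5 i4 hDm hpt).trans ?_
  rw [integral_add (i3.const_mul _) (integrableOn_const hDv.ne), integral_const_mul, setIntegral_const, smul_eq_mul]
  refine add_le_add ?_ (mul_le_mul_of_nonneg_right hDr hE0)
  rw [e1]
  refine mul_le_mul_of_nonneg_left ?_ (by positivity)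
  refine setIntegral_mono_set i2 ?_ (LE.le.eventuallyLE inter_subset_left)
  refine Filter.Eventually.of_forall fun z => ?_
  have := hg0 (PH f o z)
  simp only [Pi.zero_apply]
  positivity

set_option maxHeartbeats 3000000 in
/-- boundary estimate -/
lemma bdry (a C₀ m₀ : ℝ) (ha : 0 < a) (hC1 : 1 ≤ C₀) : ∃ N > 0, ∀ (K M : ℝ) (f : ℝ → ℝ → ℝ) (φ : (Fin 3 → ℝ) → ℝ),
    SP K a C₀ m₀ M f φ → ∀ o : Fin 3 → ℝ, K + 3 * C₀ + 2 ≤ o 2 → o 0 < 0 → 1 / 2 ≤ exp (o 0) → ∀ S : ℝ,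
    (∀ y ∈ nozzleFrom f K, |y 2 - o 2| ≤ 1 → ∀ j, |grad3 (uu m₀ φ) y j| ≤ S) → ∀ ε : ℝ, 0 < ε →
    100 * C₀ ^ 7 * ε ≤ 1 → ∀ j, |grad3 (uu m₀ φ) (Th f o) j| ≤
      N * ((ε ^ 3)⁻¹ * II K m₀ f φ (o 2) + ε * S + o 2 ^ (-a)) := by
  obtain ⟨G, hG1, hG⟩ := Pst_bd
  have hck := cK_pos
  have hC : 0 < C₀ := by linarith
  set q := m₀ / π with hq
  set Q := (2:ℝ) ^ (a + 3) * C₀ ^ 7 with hQ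
  set β := 1 / (a + 1) with hβ
  have hβ0 : 0 < β := by positivity
  have hQ0 : 0 < Q := by positivity
  set A1 := 8 * (320 * C₀ ^ 7 * (6 * C₀ * G)) with hA1
  set A2 := 8 * (|q| * G * (C₀ ^ 2 * Q * (32 * C₀ ^ 7 + 4))) with hA2
  set B2 := 8 * |q| * G * C₀ ^ 2 * Q with hB2
  set E2 := |q| * (C₀ ^ 2 * Q) with hE2
  set X := 960 * C₀ ^ 4 + A1 + (A2 + B2 / β + 80 * E2) with hX
  have G0 : 0 < G := by linarith
  have A10 : 0 ≤ A1 := by positivity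
  have A20 : 0 ≤ A2 := by positivity
  have B20 : 0 ≤ B2 / β := by positivity
  have E20 : 0 ≤ E2 := by positivity
  refine ⟨4 * C₀ * (X / cK + E2 + 1), by positivity, ?_⟩
  intro K M f φ h o hT h0 h1 S hS ε hε hεC j
  have ho : K < o 2 := by linarith
  have hK := h.fn.K1
  have hT1 : 1 ≤ o 2 := by linarith
  obtain ⟨d0, d1⟩ := FN.dd_bd f h0 h1
  obtain ⟨hR1, hR2⟩ := h.fn.rho_rng ho h0 h1
  have hR := h.fn.rho_pos ho
  have hz2 : 64 * C₀ ^ 7 * (1.5 * ε) ≤ 1 := by linarith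
  obtain ⟨hDe, hloc⟩ := h.fn.loc_chart hT h0 h1 (by positivity : 0 < 1.5 * ε) hz2
  have hz0 : (0 : Fin 3 → ℝ) ∈ ZW f K o ∩ B3 (1.5 * ε) := by
    rw [← hDe]
    refine ⟨?_, ?_⟩
    · change ell (nn f o) 0 < dd f o; simpa [ell] using d0
    · change sq3 0 < (1.5 * ε) ^ 2; simp [sq3]; positivity
  obtain ⟨hX0, ht0, -, -, -, -, -, -, -, c6⟩ := hloc 0 hz0
  have hS0 : 0 ≤ S := (abs_nonneg _).trans (hS _ hX0 ht0 0)
  set P := Q * o 2 ^ (-a) with hP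
  have hTa : 0 ≤ o 2 ^ (-a) := by positivity
  have hP0 : 0 ≤ P := by positivity
  set E := |q| * (C₀ ^ 2 * P) with hE
  have hEb : |q * (rho f o ^ 2 * p2 f (o 1) (o 2))| ≤ E := by
    rw [abs_mul, abs_mul, abs_of_nonneg (sq_nonneg (rho f o))]
    refine mul_le_mul_of_nonneg_left (mul_le_mul ?_ c6 (abs_nonneg _) (by positivity)) (abs_nonneg _)
    exact pow_le_pow_left₀ hR.le hR2 2
  have sm : ∀ e, e ≤ ε → 64 * C₀ ^ 7 * e ≤ 1 := fun e he => by
    have h7 : 0 < C₀ ^ 7 := pow_pos hC 7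
    have := mul_le_mul_of_nonneg_left he h7.le
    have := mul_pos h7 hε
    linarith
  have hE0 : 0 ≤ E := by positivity
  have hIv := h.int_v hT h0 h1 hε (sm ε le_rfl) hEb
  have hII0 : 0 ≤ II K m₀ f φ (o 2) := integral_nonneg fun y => Finset.sum_nonneg fun j _ => abs_nonneg _
  have hε1 : ε ≤ 1 := by
    have : 1 ≤ C₀ ^ 7 := one_le_pow₀ hC1
    nlinarith
  have key : ∀ i, |grad3 (vc m₀ f φ o) 0 i| ≤ X / cK * ((ε ^ 3)⁻¹ * II K m₀ f φ (o 2) + ε * S + o 2 ^ (-a)) := by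
    intro i
    have := KLH (sq3_nn f o) d0 (v := vc m₀ f φ o) (δ := 1.5 * ε) (L := 2 * C₀ * (3 * S) + E)
      (fun z hz => by
        rw [hDe] at hz
        exact (h.vc_grad hz.1.2.2 (hloc z hz).1).1)
      (fun z hz j => by
        rw [hDe] at hz
        obtain ⟨hXz, htz, -⟩ := hloc z hz
        obtain ⟨-, c0, c1, c2⟩ := h.vc_grad hz.1.2.2 hXz
        have hv : ∀ j, |grad3 (fun z => uu m₀ φ (PH f o z)) z j| ≤ 2 * C₀ * (3 * S) := fun j => by
          refine (h.v_bd hT h0 h1 (by positivity) hz2 hz j).trans ?_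
          have : ∑ j, |grad3 (uu m₀ φ) (PH f o z) j| ≤ ∑ _j : Fin 3, S := Finset.sum_le_sum fun j _ => hS _ hXz htz j
          simp at this
          gcongr
        have n0 := hv 0
        have n1 := hv 1
        have n2 := hv 2
        fin_cases j
        · change |grad3 (vc m₀ f φ o) z 0| ≤ _
          rw [c0]
          exact (abs_sub _ _).trans (add_le_add n0 hEb)
        · change |grad3 (vc m₀ f φ o) z 1| ≤ _
          rw [c1]; linarith
        · change |grad3 (vc m₀ f φ o) z 2| ≤ _
          rw [c2]; linarith) i
      (h.vc_cont hz0.1.2.2 hX0 i) hβ0 hε (by linarith)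
      (A := 8 * (320 * C₀ ^ 7 * (6 * C₀ * S * G) + |q| * G * (C₀ ^ 2 * P * (32 * C₀ ^ 7 + 4))))
      (B := 8 * |q| * G * C₀ ^ 2 * P)
      (fun e he hee => h.H_bd hT h0 h1 hS hG1 hG i he (sm e hee) hP)
    rw [div_mul_eq_mul_div, le_div_iff₀ hck]
    refine this.trans ?_
    have e3 : 0 < ε ^ 3 := by positivity
    have t1 : 10 * (ε ^ 3)⁻¹ * (∫ z in HS (nn f o) (dd f o) ∩ B3 ε, ∑ j, |grad3 (vc m₀ f φ o) z j|) ≤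
        960 * C₀ ^ 4 * ((ε ^ 3)⁻¹ * II K m₀ f φ (o 2)) + 80 * E := by
      refine (mul_le_mul_of_nonneg_left hIv (by positivity)).trans (le_of_eq ?_)
      field_simp; ring
    have hεβ : ε ^ β ≤ 1 := rpow_le_one hε.le hε1 hβ0.le
    have t2 : 8 * |q| * G * C₀ ^ 2 * P / β * ε ^ β ≤ B2 / β * o 2 ^ (-a) := by
      have : 8 * |q| * G * C₀ ^ 2 * P / β * ε ^ β = B2 / β * o 2 ^ (-a) * ε ^ β := by
        rw [hB2, hP]; ring
      rw [this]
      exact mul_le_of_le_one_right (by positivity) hεβ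
    have t3 : 8 * (320 * C₀ ^ 7 * (6 * C₀ * S * G) + |q| * G * (C₀ ^ 2 * P * (32 * C₀ ^ 7 + 4))) * ε ≤
        A1 * (ε * S) + A2 * o 2 ^ (-a) := by
      have : 8 * (320 * C₀ ^ 7 * (6 * C₀ * S * G) + |q| * G * (C₀ ^ 2 * P * (32 * C₀ ^ 7 + 4))) * ε =
        A1 * (ε * S) + A2 * o 2 ^ (-a) * ε := by rw [hA1, hA2, hP]; ring
      rw [this]
      have := mul_le_of_le_one_right (mul_nonneg A20 hTa) hε1
      linarith
    have t4 : 80 * E = 80 * E2 * o 2 ^ (-a) := by rw [hE, hE2, hP]; ring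
    have i0 : 0 ≤ (ε ^ 3)⁻¹ * II K m₀ f φ (o 2) := by positivity
    have i1 : 0 ≤ ε * S := by positivity
    set w1 := (ε ^ 3)⁻¹ * II K m₀ f φ (o 2)
    set w2 := ε * S
    set w3 := o 2 ^ (-a)
    have hc4 : 0 ≤ 960 * C₀ ^ 4 := by positivity
    have j1 : (960 * C₀ ^ 4) * w1 ≤ X * w1 := mul_le_mul_of_nonneg_right (by linarith) i0
    have j2 : A1 * w2 ≤ X * w2 := mul_le_mul_of_nonneg_right (by linarith) i1
    have j3 : (A2 + B2 / β + 80 * E2) * w3 ≤ X * w3 := mul_le_mul_of_nonneg_right (by linarith) hTa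
    linarith
  set Y := (ε ^ 3)⁻¹ * II K m₀ f φ (o 2) + ε * S + o 2 ^ (-a) with hY
  have hYT : o 2 ^ (-a) ≤ Y := by
    have : 0 ≤ (ε ^ 3)⁻¹ * II K m₀ f φ (o 2) := by positivity
    have : 0 ≤ ε * S := by positivity
    linarith
  have hY0 : 0 ≤ Y := hTa.trans hYT
  obtain ⟨-, c0, c1, c2⟩ := h.vc_grad hz0.1.2.2 hX0
  obtain ⟨a0, a1, a2⟩ := h.fn.grad_PH hz0.1.2.2 (h.u_diff hX0)
  have haff : aff f o 0 = o := by
    funext i; fin_cases i <;> simp [aff]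
  have hPH : PH f o 0 = Th f o := by rw [PH, haff]
  rw [haff, hPH] at a1 a2
  rw [hPH] at a0
  simp only [sub_self, mul_zero, zero_mul, zero_add] at a1 a2
  set v := grad3 (fun z => uu m₀ φ (PH f o z)) 0
  set Z := (X / cK + E2) * Y with hZ
  have hEY : E ≤ E2 * Y := by
    have : E = E2 * o 2 ^ (-a) := by rw [hE, hE2, hP]; ring
    rw [this]; gcongr
  have hE2Y : 0 ≤ E2 * Y := by positivity
  have hv : ∀ i, |v i| ≤ Z := by
    intro i
    have ki := key i
    have hZ' : Z = X / cK * Y + E2 * Y := by rw [hZ]; ring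
    fin_cases i
    · change |v 0| ≤ Z
      change |grad3 (vc m₀ f φ o) 0 0| ≤ _ at ki
      rw [c0] at ki
      have : |v 0| ≤ |v 0 - q * (rho f o ^ 2 * p2 f (o 1) (o 2))| + |q * (rho f o ^ 2 * p2 f (o 1) (o 2))| := by
        have := abs_add_le (v 0 - q * (rho f o ^ 2 * p2 f (o 1) (o 2))) (q * (rho f o ^ 2 * p2 f (o 1) (o 2)))
        rwa [sub_add_cancel] at this
      linarith
    · change |v 1| ≤ Z
      change |grad3 (vc m₀ f φ o) 0 1| ≤ _ at ki
      rw [c1] at ki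
      linarith
    · change |v 2| ≤ Z
      change |grad3 (vc m₀ f φ o) 0 2| ≤ _ at ki
      rw [c2] at ki
      linarith
  have hZ0 : 0 ≤ Z := (abs_nonneg _).trans (hv 0)
  have hfin : ∀ {x : ℝ}, |x| * rho f o ≤ 2 * Z → |x| ≤ 4 * C₀ * (X / cK + E2 + 1) * Y := by
    intro x hx
    have h3 : 1 ≤ 2 * C₀ * rho f o := by rwa [div_le_iff₀' (by positivity)] at hR1
    have h4 : |x| ≤ 2 * C₀ * (|x| * rho f o) := by nlinarith [abs_nonneg x]
    have h5 : 2 * C₀ * (|x| * rho f o) ≤ 2 * C₀ * (2 * Z) := by gcongr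
    have h6 : 4 * C₀ * (X / cK + E2 + 1) * Y = 4 * C₀ * Z + 4 * C₀ * Y := by rw [hZ]; ring
    have : 0 ≤ 4 * C₀ * Y := by positivity
    linarith
  set c := cos (o 1)
  set s := sin (o 1)
  have t0 : Th f o 0 = rho f o * c := rfl
  have t1 : Th f o 1 = rho f o * s := rfl
  rw [t0, t1] at a0 a1
  have hcs : s ^ 2 + c ^ 2 = 1 := sin_sq_add_cos_sq _
  have hc1 : |c| ≤ 1 := abs_cos_le_one _
  have hs1 : |s| ≤ 1 := abs_sin_le_one _
  set U := grad3 (uu m₀ φ) (Th f o) with hU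
  have z0 := hv 0
  have z1 := hv 1
  have z2 := hv 2
  fin_cases j
  · refine hfin (x := U 0) ?_
    have : U 0 * rho f o = c * v 0 - s * v 1 := by
      rw [a0, a1]; linear_combination (- U 0 * rho f o) * hcs
    rw [← abs_of_pos hR, ← abs_mul, this]
    refine (abs_sub _ _).trans ?_
    rw [abs_mul, abs_mul]
    nlinarith [abs_nonneg (v 0), abs_nonneg (v 1)]
  · refine hfin (x := U 1) ?_
    have : U 1 * rho f o = s * v 0 + c * v 1 := by
      rw [a0, a1]; linear_combination (- U 1 * rho f o) * hcs
    rw [← abs_of_pos hR, ← abs_mul, this]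
    refine (abs_add_le _ _).trans ?_
    rw [abs_mul, abs_mul]
    nlinarith [abs_nonneg (v 0), abs_nonneg (v 1)]
  · refine hfin (x := U 2) ?_
    have : U 2 * rho f o = v 2 := by rw [a2]; ring
    rw [← abs_of_pos hR, ← abs_mul, this]
    linarith

end SP
end

section
lemma int_grad_zero {ψ : (Fin 3 → ℝ) → ℝ} (hψ : ContDiff ℝ 1 ψ) (hc : HasCompactSupport ψ) (j : Fin 3) :
    ∫ z, grad3 ψ z j = 0 := by
  obtain ⟨D, hD⟩ := lipschitz_of_cs hψ hc
  have h := (LipschitzWith.const (1:ℝ) : LipschitzWith 0 (fun _ : Fin 3 → ℝ => (1:ℝ))).integral_lineDeriv_mul_eq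
    (μ := volume) hD hc (- Pi.single j 1)
  have e : ∀ x : Fin 3 → ℝ, lineDeriv ℝ (fun _ : Fin 3 → ℝ => (1:ℝ)) x (- Pi.single j 1) = 0 := fun x => by
    simp [lineDeriv]
  simp only [e, zero_mul, integral_zero, mul_one, neg_neg] at h
  rw [h]
  congr 1; funext z
  exact ((hψ.differentiable (by norm_num) z).lineDeriv_eq_fderiv).symm

lemma grad_shift (u : (Fin 3 → ℝ) → ℝ) (x z : Fin 3 → ℝ) (j : Fin 3) :
    grad3 (fun z => u (x + z)) z j = grad3 u (x + z) j := by
  rw [grad3, fderiv_comp_add_left]; rfl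

lemma SP.inter {K a C₀ m₀ M : ℝ} {f : ℝ → ℝ → ℝ} {φ : (Fin 3 → ℝ) → ℝ} (h : SP K a C₀ m₀ M f φ)
    {x : Fin 3 → ℝ} (hb : ∀ z ∈ B3 (3 / 10), x + z ∈ nozzleFrom f K)
    {ε0 : ℝ} (hε0 : 0 < ε0) (hε1 : ε0 ≤ 1 / 10) (i : Fin 3) :
    |grad3 (uu m₀ φ) x i| * cK ≤ 10 * (ε0 ^ 3)⁻¹ * II K m₀ f φ (x 2) := by
  set n : Fin 3 → ℝ := ![1, 0, 0] with hn
  have hn1 : sq3 n = 1 := by simp [sq3, hn]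
  have hel : ∀ z, ell n z = z 0 := fun z => by simp [ell, hn]
  have hx : x ∈ nozzleFrom f K := by
    have := hb 0 (by simp [B3, sq3]); simpa using this
  have hsub : ∀ {r s : ℝ}, 0 < r → r ≤ s → B3 r ⊆ B3 s := fun hr hrs z hz => by
    have : sq3 z < _ := hz
    exact this.trans_le (by gcongr)
  have hxt : ∀ {ε}, 0 < ε → ε ≤ 1 / 10 → ∀ {z}, sq3 z < ε ^ 2 → x + z ∈ nozzleFrom f K :=
    fun {ε} h1 h2 {z} hz => hb z (hsub h1 (by linarith) hz)
  have key := KLH (n := n) hn1 (d := 1 / 4) (by norm_num) (v := fun z => uu m₀ φ (x + z)) (δ := 24 / 100)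
    (L := M + |m₀ / π|) ?_ ?_ i ?_ (A := 0) (B := 0) (β := 1) one_pos hε0 (by linarith) ?_
  · rw [grad_shift, add_zero] at key
    refine key.trans ?_
    rw [zero_mul, zero_div, zero_mul, add_zero, add_zero]
    refine mul_le_mul_of_nonneg_left ?_ (by positivity)
    simp only [grad_shift]
    have e1 : HS n (1 / 4) ∩ B3 ε0 = B3 ε0 := by
      refine inter_eq_right.2 fun z hz => ?_
      change ell n z < _
      rw [hel]
      have := (abs_lt.1 (B3_abs hε0 hz 0)).2
      linarith
    rw [e1, II, ← (MeasureTheory.measurePreserving_add_left volume x).setIntegral_image_emb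
      (measurableEmbedding_addLeft x) (fun y => ∑ j, |grad3 (uu m₀ φ) y j|)]
    have i1 := h.u_int_slab (x 2)
    rw [IntegrableOn, integrable_indicator_iff (meas_slab1 _), IntegrableOn,
      Measure.restrict_restrict (meas_slab1 _), inter_comm] at i1
    refine setIntegral_mono_set i1 (Filter.Eventually.of_forall fun y => Finset.sum_nonneg fun j _ => abs_nonneg _) ?_
    refine LE.le.eventuallyLE ?_
    rintro y ⟨z, hz, rfl⟩
    refine ⟨hxt hε0 hε1 hz, ?_⟩
    have := B3_abs hε0 hz 2
    change |(x 2 + z 2) - x 2| ≤ 1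
    rw [add_sub_cancel_left]; linarith
  · intro z hz
    have := (h.u_diff (hb z (hsub (by norm_num) (by norm_num) hz.2)))
    exact DifferentiableAt.comp z this (by fun_prop)
  · intro z hz j
    rw [grad_shift]
    exact h.u_bd (hb z (hsub (by norm_num) (by norm_num) hz.2)) j
  · simp only [grad_shift]
    have := h.u_grad_cont hx i
    refine ContinuousAt.comp (g := fun y => grad3 (uu m₀ φ) y i) ?_ (by fun_prop)
    simpa using this
  · intro ε hε hεε
    have hε' : ε ≤ 1 / 10 := hεε.trans hε1
    set ψ : (Fin 3 → ℝ) → ℝ := fun y => Pse i ε (-x + y) with hψd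
    have hψ1 : ContDiff ℝ 1 ψ := ((Pse_contDiff i ε).of_le (by norm_num)).comp (by fun_prop)
    have hψg : ∀ z j, grad3 ψ (x + z) j = grad3 (Pse i ε) z j := fun z j => by
      rw [hψd, grad_shift, neg_add_cancel_left]
    have hts : tsupport ψ ⊆ {y | sq3 (-x + y) ≤ ε ^ 2} := by
      refine closure_minimal ?_ (isClosed_le (sq3_contDiff.continuous.comp (by fun_prop)) continuous_const)
      intro y hy
      by_contra hc
      exact hy (Pse_zero i hε (not_le.1 hc).le)
    have hts2 : tsupport ψ ⊆ {x : Fin 3 → ℝ | K < x 2} := by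
      intro y hy
      have h1 : sq3 (-x + y) ≤ ε ^ 2 := hts hy
      have h2 := hb (-x + y) (h1.trans_lt (by gcongr; linarith))
      rw [add_neg_cancel_left] at h2
      exact h2.1
    have hψc : HasCompactSupport ψ := by
      refine IsCompact.of_isClosed_subset (isCompact_closedBall x ε) (isClosed_tsupport _) ?_
      intro y hy
      have h1 : sq3 (-x + y) ≤ ε ^ 2 := hts hy
      have h2 := (norm_sq_le (-x + y)).trans h1
      rw [Metric.mem_closedBall, dist_eq_norm, ← neg_add_eq_sub]
      exact abs_le_of_sq_le_sq' h2 hε.le |>.2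
    have hw := h.weak ψ hψ1 hψc hts2
    obtain ⟨t1, t2, B, hTS⟩ := FN.TS_of_cs (f := f) hψ1 hψc hts2
    have iw := h.weak_int hTS
    have hzero : ∀ y ∉ nozzleFrom f K, ∀ j, grad3 ψ y j = 0 := by
      intro y hy j
      have e : y = x + (-x + y) := by simp
      rw [e, hψg]
      refine gradPse_zero i hε ?_ j
      by_contra hc
      refine hy ?_
      rw [e]; exact hxt hε hε' (not_le.1 hc)
    have ig : ∫ y in nozzleFrom f K, grad3 ψ y 2 = 0 := by
      rw [setIntegral_eq_integral_of_forall_compl_eq_zero (fun y hy => hzero y hy 2)]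
      exact int_grad_zero hψ1 hψc 2
    have igi : IntegrableOn (fun y => grad3 ψ y 2) (nozzleFrom f K) :=
      ((grad3_cont hψ1 2).integrable_of_hasCompactSupport (hψc.fderiv_apply (𝕜 := ℝ) (Pi.single 2 1))).integrableOn
    have hu : ∫ y in nozzleFrom f K, ∑ j, grad3 (uu m₀ φ) y j * grad3 ψ y j = 0 := by
      have e : EqOn (fun y => ∑ j, grad3 (uu m₀ φ) y j * grad3 ψ y j)
          (fun y => (∑ j, grad3 φ y j * grad3 ψ y j) - m₀ / π * grad3 ψ y 2) (nozzleFrom f K) := by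
        intro y hy
        simp only [h.u_grad hy, Fin.sum_univ_three]
        simp
        ring
      rw [setIntegral_congr_fun h.fn.meas_noz e, integral_sub iw (igi.const_mul _), hw, integral_const_mul, ig]
      simp
    have e0 : ∫ z in HS n (1 / 4), ∑ j, grad3 (fun z => uu m₀ φ (x + z)) z j * grad3 (Pst n (1 / 4) i ε) z j = 0 := by
      have e1 : EqOn (fun z => ∑ j, grad3 (fun z => uu m₀ φ (x + z)) z j * grad3 (Pst n (1 / 4) i ε) z j)
          (fun z => ∑ j, grad3 (uu m₀ φ) (x + z) j * grad3 ψ (x + z) j) (HS n (1 / 4)) := by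
        intro z hz
        refine Finset.sum_congr rfl fun j _ => ?_
        have hz1 : ell n z < 1 / 4 := hz
        rw [grad_shift, grad_Pst, hψg]
        have : ∀ k, grad3 (Pse i ε) (ref n (1 / 4) z) k = 0 := by
          refine fun k => gradPse_zero i hε ?_ k
          have a1 := ell_sq_le hn1 (ref n (1 / 4) z)
          rw [ell_ref hn1] at a1
          have : (1 / 4 : ℝ) ≤ 2 * (1 / 4) - ell n z := by linarith
          nlinarith
        simp only [this, zero_mul, Finset.sum_const_zero, add_zero]
      rw [setIntegral_congr_fun (HS_open _ _).measurableSet e1, setIntegral_eq_integral_of_forall_compl_eq_zero]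
      · rw [integral_add_left_eq_self (fun y => ∑ j, grad3 (uu m₀ φ) y j * grad3 ψ y j) x, ← hu,
          setIntegral_eq_integral_of_forall_compl_eq_zero]
        intro y hy
        simp [hzero y hy]
      · intro z hz
        refine Finset.sum_eq_zero fun j _ => ?_
        rw [hψg, gradPse_zero i hε ?_ j, mul_zero]
        by_contra hc
        refine hz ?_
        change ell n z < _
        rw [hel]
        have := (abs_lt.1 (B3_abs hε (show z ∈ B3 ε from not_le.1 hc) 0)).2
        linarith
    rw [e0]; simp
end

section
/-- threshold beyond which the nozzle is close to the unit cylinder -/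
def NR (K a C₀ Tc : ℝ) : Prop := K + 3 * C₀ + 3 ≤ Tc ∧ ∀ t, Tc - 1 ≤ t → C₀ * t ^ (-a) ≤ 1 / 10

lemma exists_NR (K a C₀ : ℝ) (ha : 0 < a) : ∃ Tc, NR K a C₀ Tc := by
  have h := (tendsto_rpow_neg_atTop ha).const_mul C₀
  rw [mul_zero] at h
  have h2 := h.eventually (Iic_mem_nhds (show (0:ℝ) < 1 / 10 by norm_num))
  obtain ⟨T, hT⟩ := Filter.eventually_atTop.1 h2
  refine ⟨max (K + 3 * C₀ + 3) (T + 1), le_max_left _ _, fun t ht => hT t ?_⟩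
  linarith [le_max_right (K + 3 * C₀ + 3) (T + 1)]

lemma rad_sq (x : Fin 3 → ℝ) : rad x ^ 2 = x 0 ^ 2 + x 1 ^ 2 := Real.sq_sqrt (by positivity)

lemma FN.f_near {K a C₀ : ℝ} {f : ℝ → ℝ → ℝ} (h : FN K a C₀ f) {Tc : ℝ} (hT : NR K a C₀ Tc) (τ : ℝ) {t : ℝ}
    (ht : Tc - 1 ≤ t) : 9 / 10 ≤ f τ t ∧ f τ t ≤ 11 / 10 := by
  have hC := h.C0pos
  have := (h.dec_f τ (show K < t by linarith [hT.1])).trans (hT.2 t ht)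
  rw [abs_le] at this
  constructor <;> linarith [this.1, this.2]

lemma rad_add (x z : Fin 3 → ℝ) {s : ℝ} (hs : 0 ≤ s) (hz : z 0 ^ 2 + z 1 ^ 2 ≤ s ^ 2) : rad (x + z) ≤ rad x + s := by
  have h1 := rad_nonneg x
  have h2 := rad_sq x
  refine Real.sqrt_le_iff.2 ⟨by positivity, ?_⟩
  simp only [Pi.add_apply]
  have h3 : (x 0 * z 0 + x 1 * z 1) ^ 2 ≤ (rad x * s) ^ 2 := by
    rw [mul_pow, h2]
    nlinarith [sq_nonneg (x 0 * z 1 - x 1 * z 0), mul_le_mul_of_nonneg_left hz (add_nonneg (sq_nonneg (x 0)) (sq_nonneg (x 1)))]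
  have h4 := (abs_le_of_sq_le_sq' h3 (by positivity)).2
  nlinarith

lemma II_nonneg (K m₀ : ℝ) (f : ℝ → ℝ → ℝ) (φ : (Fin 3 → ℝ) → ℝ) (T : ℝ) : 0 ≤ II K m₀ f φ T :=
  integral_nonneg fun _ => Finset.sum_nonneg fun _ _ => abs_nonneg _

lemma SP.local_est (a C₀ m₀ : ℝ) (ha : 0 < a) (hC1 : 1 ≤ C₀) : ∃ N > 0, ∀ (K M : ℝ) (f : ℝ → ℝ → ℝ) (φ : (Fin 3 → ℝ) → ℝ),
    SP K a C₀ m₀ M f φ → ∀ Tc, NR K a C₀ Tc → ∀ x ∈ nozzleFrom f K, Tc ≤ x 2 → ∀ S : ℝ,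
    (∀ y ∈ nozzleFrom f K, |y 2 - x 2| ≤ 1 → ∀ j, |grad3 (uu m₀ φ) y j| ≤ S) → ∀ ε : ℝ, 0 < ε →
    100 * C₀ ^ 7 * ε ≤ 1 → ∀ j, |grad3 (uu m₀ φ) x j| ≤
      N * ((ε ^ 3)⁻¹ * II K m₀ f φ (x 2) + ε * S + x 2 ^ (-a)) := by
  obtain ⟨N, hN, hb⟩ := SP.bdry a C₀ m₀ ha hC1
  have hck := cK_pos
  refine ⟨max N (10 / cK), lt_max_of_lt_left hN, ?_⟩
  intro K M f φ h Tc hT x hx hxT S hS ε hε hε1 j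
  have hS0 : 0 ≤ S := (abs_nonneg _).trans (hS x hx (by simp) 0)
  have hI := II_nonneg K m₀ f φ (x 2)
  have hx2 : 0 < x 2 := by linarith [hx.1, h.fn.K1]
  have hpos : 0 ≤ (ε ^ 3)⁻¹ * II K m₀ f φ (x 2) + ε * S + x 2 ^ (-a) := by positivity
  obtain ⟨hxK, hxf⟩ := (h.fn.mem_iff 0 x).1 hx
  obtain ⟨f1, f2⟩ := h.fn.f_near hT (ang 0 x) (show Tc - 1 ≤ x 2 by linarith)
  by_cases hr : rad x < 1 / 2 * f (ang 0 x) (x 2)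
  · have hε2 : ε ≤ 1 / 10 := by
      have : 1 ≤ C₀ ^ 7 := one_le_pow₀ hC1
      nlinarith
    have hball : ∀ z ∈ B3 (3 / 10), x + z ∈ nozzleFrom f K := by
      intro z hz
      have hz2 := abs_lt.1 (B3_abs (by norm_num) hz 2)
      have hz' : sq3 z < (3 / 10) ^ 2 := hz
      have hz3 : z 0 ^ 2 + z 1 ^ 2 ≤ (3 / 10) ^ 2 := by rw [sq3] at hz'; nlinarith [sq_nonneg (z 2)]
      rw [h.fn.mem_iff 0]
      have e2 : (x + z) 2 = x 2 + z 2 := rfl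
      rw [e2]
      refine ⟨by linarith [hT.1], ?_⟩
      have := rad_add x z (by norm_num) hz3
      have := (h.fn.f_near hT (ang 0 (x + z)) (show Tc - 1 ≤ x 2 + z 2 by linarith)).1
      linarith
    have key := h.inter hball hε hε2 j
    rw [← le_div_iff₀ hck] at key
    refine key.trans ?_
    calc 10 * (ε ^ 3)⁻¹ * II K m₀ f φ (x 2) / cK = 10 / cK * ((ε ^ 3)⁻¹ * II K m₀ f φ (x 2)) := by ring
      _ ≤ 10 / cK * ((ε ^ 3)⁻¹ * II K m₀ f φ (x 2) + ε * S + x 2 ^ (-a)) := by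
        refine mul_le_mul_of_nonneg_left ?_ (by positivity)
        have : 0 ≤ ε * S := by positivity
        have : 0 ≤ x 2 ^ (-a) := by positivity
        linarith
      _ ≤ _ := mul_le_mul_of_nonneg_right (le_max_right _ _) hpos
  · push Not at hr
    have hf0 := h.fn.fpos (ang 0 x) hxK
    have hrad : 0 < rad x := by linarith
    have e := h.fn.rightInv (τ0 := 0) hxK hrad
    have e2 : ThInv f 0 x 2 = x 2 := rfl
    have e0 : ThInv f 0 x 0 = Real.log (rad x / f (ang 0 x) (x 2)) := rfl
    have key := hb K M f φ h (ThInv f 0 x) (by rw [e2]; linarith [hT.1]) ?_ ?_ S (by rw [e2]; exact hS) ε hε hε1 j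
    · rw [e, e2] at key
      exact key.trans (mul_le_mul_of_nonneg_right (le_max_left _ _) hpos)
    · rw [e0]
      exact Real.log_neg (div_pos hrad hf0) ((div_lt_one hf0).2 hxf)
    · rw [e0, Real.exp_log (div_pos hrad hf0), le_div_iff₀ hf0]; exact hr
end

section
/-- dilation weights -/
noncomputable def cc (θ : ℝ) : Fin 3 → ℝ := ![θ, θ, 1]
/-- dilation of the cross-section -/
noncomputable def TT (θ : ℝ) (x : Fin 3 → ℝ) : Fin 3 → ℝ := fun i => cc θ i * x i

/-- dilation as a continuous linear map -/
noncomputable def TL (θ : ℝ) : (Fin 3 → ℝ) →L[ℝ] (Fin 3 → ℝ) :=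
  ContinuousLinearMap.pi fun i => cc θ i • ContinuousLinearMap.proj i

lemma TT_eq (θ : ℝ) : TT θ = TL θ := by
  funext x i; simp [TT, TL]

lemma TL_single (θ : ℝ) (j : Fin 3) : TL θ (Pi.single j 1) = cc θ j • Pi.single j 1 := by
  ext i
  simp only [TL, ContinuousLinearMap.coe_pi', _root_.smul_apply, ContinuousLinearMap.proj_apply, Pi.smul_apply, smul_eq_mul]
  rcases eq_or_ne i j with rfl | hij
  · rfl
  · simp [Pi.single_eq_of_ne hij]

lemma grad_TT {ψ : (Fin 3 → ℝ) → ℝ} {θ : ℝ} {x : Fin 3 → ℝ} (hψ : DifferentiableAt ℝ ψ (TT θ x)) (j : Fin 3) :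
    grad3 (fun x => ψ (TT θ x)) x j = cc θ j * grad3 ψ (TT θ x) j := by
  rw [TT_eq] at hψ ⊢
  have := (hψ.hasFDerivAt.comp x (TL θ).hasFDerivAt).fderiv
  have e : (fun x => ψ (TL θ x)) = ψ ∘ TL θ := rfl
  rw [grad3, e, this, ContinuousLinearMap.comp_apply, TL_single, map_smul, smul_eq_mul]; rfl

lemma TT_cont (θ : ℝ) : Continuous (TT θ) := by rw [TT_eq]; exact (TL θ).continuous
lemma TT_contDiff (θ : ℝ) : ContDiff ℝ 1 (TT θ) := by rw [TT_eq]; exact (TL θ).contDiff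
lemma TT_zero (θ : ℝ) (x : Fin 3 → ℝ) : TT θ x 0 = θ * x 0 := by simp [TT, cc]
lemma TT_oneC (θ : ℝ) (x : Fin 3 → ℝ) : TT θ x 1 = θ * x 1 := by simp [TT, cc]
lemma TT_two (θ : ℝ) (x : Fin 3 → ℝ) : TT θ x 2 = x 2 := by simp [TT, cc]
lemma TT_id (x : Fin 3 → ℝ) : TT 1 x = x := by
  funext i; fin_cases i <;> simp [TT, cc]
lemma TT_cont2 : Continuous (fun p : ℝ × (Fin 3 → ℝ) => TT p.1 p.2) := by
  refine continuous_pi fun i => ?_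
  fin_cases i <;> simp [TT, cc] <;> fun_prop

lemma cc_abs {θ : ℝ} (h0 : 0 ≤ θ) (h1 : θ ≤ 1) (j : Fin 3) : |cc θ j| ≤ 1 := by
  fin_cases j <;> simp [cc, abs_of_nonneg h0, h1]

/-- dilation keeps the nozzle -/
lemma TT_mem {f : ℝ → ℝ → ℝ} {K θ : ℝ} (h0 : 0 ≤ θ) (h1 : θ ≤ 1) {x : Fin 3 → ℝ} (hx : x ∈ nozzleFrom f K) :
    TT θ x ∈ nozzleFrom f K := by
  obtain ⟨hK, r, τ, hr, hrf, e0, e1⟩ := hx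
  refine ⟨by rwa [TT_two], θ * r, τ, by positivity, ?_, ?_, ?_⟩
  · rw [TT_two]; nlinarith
  · rw [TT_zero, e0]; ring
  · rw [TT_oneC, e1]; ring

lemma exists_cutoff {A U : Set (Fin 3 → ℝ)} (hA : IsCompact A) (hU : IsOpen U) (hAU : A ⊆ U) :
    ∃ ζ : (Fin 3 → ℝ) → ℝ, ContDiff ℝ 1 ζ ∧ HasCompactSupport ζ ∧ tsupport ζ ⊆ U ∧ ∀ x ∈ A, ζ x = 1 := by
  obtain ⟨V, hV, hAV, hVU, hVc⟩ := exists_open_between_and_isCompact_closure hA hU hAU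
  obtain ⟨ζ, h0, h1, -⟩ := exists_contMDiffMap_zero_one_of_isClosed (n := 1) (modelWithCornersSelf ℝ (Fin 3 → ℝ))
    hV.isClosed_compl hA.isClosed (disjoint_compl_left_iff_subset.2 hAV)
  have hts : tsupport ζ ⊆ closure V := by
    refine closure_mono fun x hx => ?_
    by_contra hc
    exact hx (h0 hc)
  exact ⟨ζ, ζ.contMDiff.contDiff, hVc.of_isClosed_subset (isClosed_tsupport _) hts, hts.trans hVU, fun x hx => h1 hx⟩

lemma FN.exists_A {K a C₀ : ℝ} {f : ℝ → ℝ → ℝ} (h : FN K a C₀ f) {t1 t2 : ℝ} (ht : K < t1) :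
    ∃ A : Set (Fin 3 → ℝ), IsCompact A ∧ (∀ x ∈ nozzleFrom f K, t1 ≤ x 2 → x 2 ≤ t2 → x ∈ A) ∧
      ∀ θ, 0 < θ → θ < 1 → ∀ x ∈ A, TT θ x ∈ nozzleFrom f K := by
  set S : Set (ℝ × ℝ × ℝ) := Icc 0 1 ×ˢ Icc (-π) π ×ˢ Icc t1 t2 with hS
  set P : ℝ × ℝ × ℝ → (Fin 3 → ℝ) := fun p => ![p.1 * f p.2.1 p.2.2 * cos p.2.1, p.1 * f p.2.1 p.2.2 * sin p.2.1, p.2.2] with hP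
  have hc : IsCompact S := isCompact_Icc.prod (isCompact_Icc.prod isCompact_Icc)
  have hK2 : ∀ p ∈ S, K < p.2.2 := fun p hp => ht.trans_le hp.2.2.1
  have hf : ContinuousOn (fun p : ℝ × ℝ × ℝ => f p.2.1 p.2.2) S :=
    h.c2.continuousOn.comp (f := fun p : ℝ × ℝ × ℝ => p.2) (by fun_prop) (fun p hp => hK2 p hp)
  refine ⟨P '' S, hc.image_of_continuousOn ?_, ?_, ?_⟩
  · refine continuousOn_pi.2 fun i => ?_
    fin_cases i <;> simp only [hP] <;> simp
    · exact (continuousOn_fst.mul hf).mul (by fun_prop : Continuous fun p : ℝ × ℝ × ℝ => cos p.2.1).continuousOn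
    · exact (continuousOn_fst.mul hf).mul (by fun_prop : Continuous fun p : ℝ × ℝ × ℝ => sin p.2.1).continuousOn
    · fun_prop
  · intro x hx h1 h2
    obtain ⟨hxK, hr⟩ := (h.mem_iff 0 x).1 hx
    have hfp := h.fpos (ang 0 x) hxK
    obtain ⟨e0, e1⟩ := x_eq_ang 0 x
    refine ⟨(rad x / f (ang 0 x) (x 2), ang 0 x, x 2), ⟨⟨?_, ?_⟩, ?_, h1, h2⟩, ?_⟩
    · exact div_nonneg (rad_nonneg x) hfp.le
    · exact ((div_lt_one hfp).2 hr).le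
    · have := Complex.arg_mem_Ioc (zet 0 x)
      simp only [ang, zero_add]
      exact ⟨this.1.le, this.2⟩
    · simp only [hP]
      rw [div_mul_cancel₀ _ hfp.ne', ← e0, ← e1]
      funext i; fin_cases i <;> rfl
  · rintro θ h0 h1 _ ⟨p, hp, rfl⟩
    have hK := hK2 p hp
    have hfp := h.fpos p.2.1 hK
    refine ⟨by rw [TT_two]; exact hK, θ * (p.1 * f p.2.1 p.2.2), p.2.1, ?_, ?_, ?_, ?_⟩
    · have := hp.1.1; positivity
    · rw [TT_two]
      change θ * (p.1 * f p.2.1 p.2.2) < f p.2.1 p.2.2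
      have : p.1 * f p.2.1 p.2.2 ≤ f p.2.1 p.2.2 := mul_le_of_le_one_left hfp.le hp.1.2
      nlinarith
    · rw [TT_zero]; simp only [hP, Matrix.cons_val]; ring
    · rw [TT_oneC]; simp only [hP, Matrix.cons_val]; ring

lemma SP.weak_lam {K a C₀ m₀ M : ℝ} {f : ℝ → ℝ → ℝ} {φ : (Fin 3 → ℝ) → ℝ} (h : SP K a C₀ m₀ M f φ)
    {ψ : (Fin 3 → ℝ) → ℝ} {t1 t2 B : ℝ} (hψ : TS f K ψ t1 t2 B) (hc : ∀ x ∈ nozzleFrom f K, ContDiffAt ℝ 1 ψ x)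
    {θ : ℝ} (h0 : 0 < θ) (h1 : θ < 1) :
    ∫ x in nozzleFrom f K, ∑ i, grad3 φ x i * (cc θ i * grad3 ψ (TT θ x) i) = 0 := by
  obtain ⟨A, hA, hA1, hA2⟩ := h.fn.exists_A (t2 := t2) hψ.lt
  have hU : IsOpen (TT θ ⁻¹' nozzleFrom f K) := h.fn.isOpen_noz.preimage (TT_cont θ)
  obtain ⟨ζ, hζ1, hζc, hζs, hζ⟩ := exists_cutoff hA hU (fun x hx => hA2 θ h0 h1 x hx)
  set Ψ : (Fin 3 → ℝ) → ℝ := fun x => ζ x * ψ (TT θ x) with hΨ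
  have hts : tsupport Ψ ⊆ tsupport ζ := tsupport_mul_subset_left
  have hw := h.weak Ψ ?_ (hζc.mul_right) ?_
  · rw [← hw]
    refine setIntegral_congr_fun h.fn.meas_noz fun x hx => ?_
    have hx' := TT_mem h0.le h1.le hx
    have e : Ψ =ᶠ[nhds x] fun x => ψ (TT θ x) := by
      filter_upwards [h.fn.isOpen_noz.mem_nhds hx] with y hy
      by_cases hy2 : t1 ≤ y 2 ∧ y 2 ≤ t2
      · simp [hΨ, hζ y (hA1 y hy hy2.1 hy2.2)]
      · have : ψ (TT θ y) = 0 := by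
          refine hψ.zero _ (TT_mem h0.le h1.le hy) ?_
          rw [TT_two]
          by_contra hn; push Not at hn; exact hy2 hn
        simp [hΨ, this]
    refine Finset.sum_congr rfl fun i _ => ?_
    rw [← grad_TT (hψ.diff _ hx'), grad3, grad3, grad3, e.fderiv_eq]
  · rw [contDiff_iff_contDiffAt]
    intro x
    by_cases hx : x ∈ tsupport ζ
    · exact hζ1.contDiffAt.mul (ContDiffAt.comp x (hc _ (hζs hx)) (TT_contDiff θ).contDiffAt)
    · have : Ψ =ᶠ[nhds x] fun _ => 0 := by
        filter_upwards [(isClosed_tsupport ζ).isOpen_compl.mem_nhds hx] with y hy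
        simp [hΨ, image_eq_zero_of_notMem_tsupport hy]
      exact contDiffAt_const.congr_of_eventuallyEq this
  · intro x hx
    have : TT θ x ∈ nozzleFrom f K := hζs (hts hx)
    have h2 := this.1
    rwa [TT_two] at h2

lemma SP.weak_ext {K a C₀ m₀ M : ℝ} {f : ℝ → ℝ → ℝ} {φ : (Fin 3 → ℝ) → ℝ} (h : SP K a C₀ m₀ M f φ)
    {ψ : (Fin 3 → ℝ) → ℝ} {t1 t2 B : ℝ} (hψ : TS f K ψ t1 t2 B) (hc : ∀ x ∈ nozzleFrom f K, ContDiffAt ℝ 1 ψ x) :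
    ∫ x in nozzleFrom f K, ∑ i, grad3 φ x i * grad3 ψ x i = 0 := by
  set θ : ℕ → ℝ := fun n => 1 - ((n:ℝ) + 2)⁻¹ with hθ
  have hp : ∀ n : ℕ, 0 < ((n:ℝ) + 2)⁻¹ ∧ ((n:ℝ) + 2)⁻¹ < 1 := fun n => by
    constructor
    · positivity
    · exact inv_lt_one_of_one_lt₀ (by linarith [n.cast_nonneg (α := ℝ)])
  have h0 : ∀ n, 0 < θ n := fun n => by simp only [hθ]; linarith [(hp n).2]
  have h1 : ∀ n, θ n < 1 := fun n => by simp only [hθ]; linarith [(hp n).1]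
  have ht : Filter.Tendsto θ Filter.atTop (nhds 1) := by
    have : Filter.Tendsto (fun n : ℕ => ((n:ℝ) + 2)⁻¹) Filter.atTop (nhds 0) :=
      tendsto_inv_atTop_zero.comp (Filter.tendsto_atTop_add_const_right _ _ tendsto_natCast_atTop_atTop)
    simpa using this.const_sub 1
  set F : ℕ → (Fin 3 → ℝ) → ℝ := fun n x => ∑ i, grad3 φ x i * (cc (θ n) i * grad3 ψ (TT (θ n) x) i) with hF
  have hF0 : ∀ n, ∫ x in nozzleFrom f K, F n x = 0 := fun n => h.weak_lam hψ hc (h0 n) (h1 n)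
  set S : Set (Fin 3 → ℝ) := {x | t1 ≤ x 2 ∧ x 2 ≤ t2} with hS
  have hSm : MeasurableSet S := (measurableSet_le measurable_const (measurable_pi_apply 2)).inter
      (measurableSet_le (measurable_pi_apply 2) measurable_const)
  have hB : ∀ x ∈ nozzleFrom f K, 0 ≤ M * B := fun x hx => mul_nonneg h.hM.le ((abs_nonneg _).trans (hψ.bd0 x hx))
  have key := tendsto_integral_of_dominated_convergence (μ := volume.restrict (nozzleFrom f K)) (F := F)
    (f := fun x => ∑ i, grad3 φ x i * grad3 ψ x i) (S.indicator fun _ => 3 * (M * B)) ?_ ?_ ?_ ?_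
  · simp only [hF0] at key
    exact (tendsto_nhds_unique tendsto_const_nhds key).symm
  · intro n
    refine Measurable.aestronglyMeasurable (Finset.measurable_sum _ fun i _ => (grad_meas φ i).mul (Measurable.const_mul ?_ _))
    exact (grad_meas ψ i).comp (TT_cont _).measurable
  · rw [integrable_indicator_iff hSm, IntegrableOn, Measure.restrict_restrict hSm, inter_comm]
    exact integrableOn_const (h.fn.slab_fin t1 t2).ne
  · intro n
    filter_upwards [ae_restrict_mem h.fn.meas_noz] with x hx
    have hx' := TT_mem (h0 n).le (h1 n).le hx
    by_cases hs : x ∈ S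
    · rw [indicator_of_mem hs]
      refine (Finset.abs_sum_le_sum_abs _ _).trans ?_
      have : ∀ i ∈ Finset.univ, |grad3 φ x i * (cc (θ n) i * grad3 ψ (TT (θ n) x) i)| ≤ M * B := by
        intro i _
        rw [abs_mul, abs_mul]
        refine mul_le_mul (h.phi_bd hx i) ?_ (by positivity) h.hM.le
        calc _ ≤ 1 * B := mul_le_mul (cc_abs (h0 n).le (h1 n).le i) (hψ.bd _ hx' i) (abs_nonneg _) one_pos.le
          _ = B := one_mul _
      refine (Finset.sum_le_card_nsmul _ _ _ this).trans ?_
      simp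
    · rw [indicator_of_notMem hs]
      have : ∀ i, grad3 ψ (TT (θ n) x) i = 0 := by
        refine fun i => h.fn.TS_grad_zero hψ hx' ?_ i
        rw [TT_two]; by_contra hn; push Not at hn; exact hs hn
      simp [hF, this]
  · filter_upwards [ae_restrict_mem h.fn.meas_noz] with x hx
    refine tendsto_finsetSum _ fun i _ => Filter.Tendsto.const_mul _ ?_
    have e1 : Filter.Tendsto (fun n => TT (θ n) x) Filter.atTop (nhds x) := by
      have := (TT_cont2.comp (Continuous.prodMk continuous_id continuous_const : Continuous fun s : ℝ => (s, x))).tendsto 1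
      simp only [Function.comp_def, TT_id] at this
      exact this.comp ht
    have e2 : ContinuousAt (fun x => grad3 ψ x i) x :=
      ((hc x hx).fderiv_right (m := 0) (by norm_num)).continuousAt.clm_apply continuousAt_const
    have e3 : Filter.Tendsto (fun n => cc (θ n) i) Filter.atTop (nhds 1) := by
      fin_cases i <;> simp [cc] <;> assumption
    simpa using e3.mul (e2.tendsto.comp e1)
end

section
open scoped ENNReal

lemma lint_diag {G : (Fin 3 → ℝ) → ℝ≥0∞} (hG : Measurable G) (d p : Fin 3 → ℝ) (hd : 1 / 32 ≤ d 0 * d 1 * d 2) :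
    ∫⁻ x : Fin 3 → ℝ, G (p + fun i => d i * x i) ≤ 32 * ∫⁻ x, G x := by
  have hdet : Matrix.det (Matrix.diagonal d) = d 0 * d 1 * d 2 := by
    rw [Matrix.det_diagonal, Fin.prod_univ_three]
  have h := Real.smul_map_diagonal_volume_pi (D := d) (by rw [hdet]; linarith)
  set L := Matrix.toLin' (Matrix.diagonal d) with hL
  have hLa : ∀ x, L x = fun i => d i * x i := fun x => by
    funext i; simp [hL, Matrix.mulVec_diagonal]
  have hLm : Measurable L := (LinearMap.continuous_of_finiteDimensional L).measurable
  have e1 : ∫⁻ x, G x = ∫⁻ x, G (p + x) := (lintegral_add_left_eq_self G p).symm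
  have hGp : Measurable fun x => G (p + x) := hG.comp (measurable_const_add p)
  have e2 : ∫⁻ x, G (p + x) = ENNReal.ofReal |d 0 * d 1 * d 2| * ∫⁻ x : Fin 3 → ℝ, G (p + fun i => d i * x i) := by
    conv_lhs => rw [← h]
    rw [lintegral_smul_measure, lintegral_map hGp hLm, hdet]
    simp only [hLa]; rfl
  rw [e1, e2, ← mul_assoc]
  refine le_mul_of_one_le_left' ?_
  have : ENNReal.ofReal 1 ≤ 32 * ENNReal.ofReal |d 0 * d 1 * d 2| := by
    have e : (32:ℝ≥0∞) = ENNReal.ofReal 32 := by norm_num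
    rw [e, ← ENNReal.ofReal_mul (by norm_num), abs_of_nonneg (by linarith)]
    exact ENNReal.ofReal_le_ofReal (by linarith)
  simpa using this

lemma sq_int_le {v' : ℝ → ℝ} (hc : ContinuousOn v' (Icc (1 / 2) 1)) :
    (∫ θ in (1 / 2 : ℝ)..1, v' θ) ^ 2 ≤ 1 / 2 * ∫ θ in (1 / 2 : ℝ)..1, v' θ ^ 2 := by
  have hc' : ContinuousOn v' (uIcc (1 / 2) 1) := by rwa [uIcc_of_le (by norm_num)]
  have i1 := hc'.intervalIntegrable (μ := volume)
  have i2 : IntervalIntegrable (fun θ => v' θ ^ 2) volume (1 / 2) 1 := (hc'.pow 2).intervalIntegrable (μ := volume)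
  set m := ∫ θ in (1 / 2 : ℝ)..1, v' θ with hm
  have h0 : 0 ≤ ∫ θ in (1 / 2 : ℝ)..1, (v' θ ^ 2 - 4 * m * v' θ + 4 * m ^ 2) := by
    refine intervalIntegral.integral_nonneg (by norm_num) fun θ _ => ?_
    nlinarith [sq_nonneg (v' θ - 2 * m)]
  rw [intervalIntegral.integral_add (i2.sub (i1.const_mul _)) (by simp),
    intervalIntegral.integral_sub i2 (i1.const_mul _), intervalIntegral.integral_const_mul, ← hm,
    intervalIntegral.integral_const, smul_eq_mul] at h0
  nlinarith

lemma leg {u : (Fin 3 → ℝ) → ℝ} {D : Set (Fin 3 → ℝ)} (hu : ∀ x ∈ D, ContDiffAt ℝ 1 u x) (p w : Fin 3 → ℝ)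
    (hw : sq3 w ≤ 4) (hγ : ∀ θ : ℝ, 1 / 2 ≤ θ → θ ≤ 1 → p + θ • w ∈ D) {x y : Fin 3 → ℝ}
    (hx : x = p + (1:ℝ) • w) (hy : y = p + (1 / 2 : ℝ) • w) :
    ENNReal.ofReal ((u x - u y) ^ 2) ≤ 2 * ∫⁻ θ in Ioc (1 / 2 : ℝ) 1,
      D.indicator (fun x => ENNReal.ofReal (∑ j, grad3 u x j ^ 2)) (p + θ • w) := by
  set v' : ℝ → ℝ := fun θ => ∑ j, grad3 u (p + θ • w) j * w j with hv
  have hgd : ∀ θ, HasDerivAt (fun θ : ℝ => p + θ • w) w θ := fun θ => by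
    simpa using ((hasDerivAt_id θ).smul_const w).const_add p
  have hd : ∀ θ ∈ Icc (1 / 2 : ℝ) 1, HasDerivAt (fun θ => u (p + θ • w)) (v' θ) θ := by
    intro θ hθ
    have := ((hu _ (hγ θ hθ.1 hθ.2)).differentiableAt (by norm_num)).hasFDerivAt.comp_hasDerivAt θ (hgd θ)
    rw [fderiv_eq_sum] at this
    exact this
  have hg : ∀ j, ContinuousOn (fun θ : ℝ => grad3 u (p + θ • w) j) (Icc (1 / 2) 1) := fun j θ hθ => by
    have : ContinuousAt (fun x => grad3 u x j) (p + θ • w) :=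
      ((hu _ (hγ θ hθ.1 hθ.2)).fderiv_right (m := 0) (by norm_num)).continuousAt.clm_apply continuousAt_const
    exact (ContinuousAt.comp (f := fun θ : ℝ => p + θ • w) this (hgd θ).continuousAt).continuousWithinAt
  have hc : ContinuousOn v' (Icc (1 / 2) 1) := continuousOn_finsetSum _ fun j _ => (hg j).mul continuousOn_const
  have hu' : uIcc (1 / 2 : ℝ) 1 = Icc (1 / 2) 1 := uIcc_of_le (by norm_num)
  have ftc := intervalIntegral.integral_eq_sub_of_hasDerivAt (a := 1 / 2) (b := 1) (f := fun θ => u (p + θ • w)) (f' := v')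
    (by rw [hu']; exact hd) ((by rw [hu']; exact hc : ContinuousOn v' _).intervalIntegrable)
  rw [hx, hy, ← ftc]
  refine (ENNReal.ofReal_le_ofReal (sq_int_le hc)).trans ?_
  set s : ℝ → ℝ := fun θ => ∑ j, grad3 u (p + θ • w) j ^ 2 with hs
  have hsc : ContinuousOn s (Icc (1 / 2) 1) := continuousOn_finsetSum _ fun j _ => (hg j).pow 2
  have hle : ∀ θ, v' θ ^ 2 ≤ 4 * s θ := by
    intro θ
    have := Finset.sum_mul_sq_le_sq_mul_sq Finset.univ (grad3 u (p + θ • w)) w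
    refine this.trans ?_
    have e : ∑ i, w i ^ 2 = sq3 w := by rw [Fin.sum_univ_three]; rfl
    rw [e, mul_comm 4]
    exact mul_le_mul_of_nonneg_left hw (Finset.sum_nonneg fun _ _ => sq_nonneg _)
  have h1 : 1 / 2 * ∫ θ in (1 / 2 : ℝ)..1, v' θ ^ 2 ≤ 2 * ∫ θ in Ioc (1 / 2 : ℝ) 1, s θ := by
    have := intervalIntegral.integral_mono_on (a := 1 / 2) (b := 1) (μ := volume) (by norm_num)
      ((by rw [hu']; exact hc.pow 2 : ContinuousOn (fun θ => v' θ ^ 2) _).intervalIntegrable)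
      ((by rw [hu']; exact hsc.const_mul 4 : ContinuousOn (fun θ => 4 * s θ) _).intervalIntegrable) (fun θ _ => hle θ)
    rw [intervalIntegral.integral_const_mul, intervalIntegral.integral_of_le (f := s) (by norm_num)] at this
    linarith
  refine (ENNReal.ofReal_le_ofReal h1).trans ?_
  rw [ENNReal.ofReal_mul (by norm_num), ofReal_integral_eq_lintegral_ofReal
    (hsc.integrableOn_Icc.mono_set Ioc_subset_Icc_self)
    (Filter.Eventually.of_forall fun θ => Finset.sum_nonneg fun _ _ => sq_nonneg _)]
  have e2 : ENNReal.ofReal 2 = 2 := by norm_num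
  rw [e2]
  refine mul_le_mul_right (le_of_eq ?_) _
  refine setLIntegral_congr_fun measurableSet_Ioc fun θ hθ => ?_
  rw [indicator_of_mem (hγ θ hθ.1.le hθ.2)]

/-- open box -/
def Qb (s : ℝ) : Set (Fin 3 → ℝ) := Set.pi univ fun i => Ioo (![-(6 / 10), -(6 / 10), s] i) (![6 / 10, 6 / 10, s + 1] i)

lemma mem_Qb {s : ℝ} {x : Fin 3 → ℝ} : x ∈ Qb s ↔ (|x 0| < 6 / 10 ∧ |x 1| < 6 / 10) ∧ s < x 2 ∧ x 2 < s + 1 := by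
  simp only [Qb, Set.mem_pi, mem_univ, true_implies, Fin.forall_fin_succ]
  simp [abs_lt, and_assoc]

lemma Qb_convex (s : ℝ) : Convex ℝ (Qb s) := convex_pi fun _ _ => convex_Ioo _ _

lemma Qb_vol (s : ℝ) : 1 ≤ volume (Qb s) := by
  rw [Qb, Real.volume_pi_Ioo, Fin.prod_univ_three]
  simp only [Matrix.cons_val]
  rw [← ENNReal.ofReal_mul (by norm_num), ← ENNReal.ofReal_mul (by norm_num)]
  rw [← ENNReal.ofReal_one]
  exact ENNReal.ofReal_le_ofReal (by norm_num)

lemma Qb_diff {s : ℝ} {x y : Fin 3 → ℝ} (hx : x ∈ Qb s) (hy : y ∈ Qb s) : sq3 (x - y) ≤ 4 := by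
  rw [mem_Qb] at hx hy
  obtain ⟨⟨a0, a1⟩, a2, a3⟩ := hx
  obtain ⟨⟨b0, b1⟩, b2, b3⟩ := hy
  rw [abs_lt] at a0 a1 b0 b1
  simp only [sq3, Pi.sub_apply]
  have h0 : (x 0 - y 0) ^ 2 ≤ (12 / 10) ^ 2 := sq_le_sq' (by linarith) (by linarith)
  have h1 : (x 1 - y 1) ^ 2 ≤ (12 / 10) ^ 2 := sq_le_sq' (by linarith) (by linarith)
  have h2 : (x 2 - y 2) ^ 2 ≤ 1 ^ 2 := sq_le_sq' (by linarith) (by linarith)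
  linarith

/-- squared gradient density -/
noncomputable def GD (u : (Fin 3 → ℝ) → ℝ) (D : Set (Fin 3 → ℝ)) : (Fin 3 → ℝ) → ℝ≥0∞ :=
  D.indicator fun x => ENNReal.ofReal (∑ j, grad3 u x j ^ 2)

lemma GD_meas (u : (Fin 3 → ℝ) → ℝ) {D : Set (Fin 3 → ℝ)} (hD : MeasurableSet D) : Measurable (GD u D) := by
  refine Measurable.indicator ?_ hD
  refine ENNReal.measurable_ofReal.comp ?_
  exact Finset.measurable_sum _ fun j _ => (grad_meas u j).pow_const 2

lemma vol_half : volume (Ioc (1 / 2 : ℝ) 1) ≤ 1 := by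
  rw [Real.volume_Ioc, ← ENNReal.ofReal_one]
  exact ENNReal.ofReal_le_ofReal (by norm_num)

lemma cube_ge {θ : ℝ} (h : 1 / 2 ≤ θ) : 1 / 8 ≤ θ * θ * θ := by
  have h1 : 1 / 4 ≤ θ * θ := by nlinarith
  nlinarith

lemma poinc {u : (Fin 3 → ℝ) → ℝ} {D : Set (Fin 3 → ℝ)} (hD : IsOpen D) (hu : ∀ x ∈ D, ContDiffAt ℝ 1 u x) {s : ℝ}
    (hT : ∀ θ : ℝ, 1 / 2 ≤ θ → θ ≤ 1 → ∀ x ∈ D, TT θ x ∈ D) (hQ : Qb s ⊆ D) (hTQ : ∀ x ∈ D, TT (1 / 2) x ∈ Qb s)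
    (hv : volume D ≤ 5) (hr : ∀ x ∈ D, x 0 ^ 2 + x 1 ^ 2 ≤ 4) :
    ∃ y ∈ D, ∫⁻ x in D, ENNReal.ofReal ((u x - u y) ^ 2) ≤ 1344 * ∫⁻ x, GD u D x := by
  set G := GD u D with hG
  have hGm : Measurable G := GD_meas u hD.measurableSet
  set I := ∫⁻ x, G x with hI
  set J := volume.restrict (Ioc (1 / 2 : ℝ) 1) with hJ
  have hJ1 : J univ ≤ 1 := by rw [hJ, Measure.restrict_apply_univ]; exact vol_half
  have : IsFiniteMeasure J := ⟨hJ1.trans_lt (by simp)⟩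
  have : IsFiniteMeasure (volume.restrict D) := ⟨by
    rw [Measure.restrict_apply_univ]; exact hv.trans_lt (by simp)⟩
  have hJae : ∀ᵐ θ ∂J, θ ∈ Ioc (1 / 2 : ℝ) 1 := ae_restrict_mem measurableSet_Ioc
  have cT : Continuous (TT (1 / 2)) := TT_cont _
  -- measurability
  have mm : ∀ g : (Fin 3 → ℝ) × ℝ → (Fin 3 → ℝ), Continuous g → Measurable fun z => G (g z) :=
    fun g hg => hGm.comp hg.measurable
  -- leg one
  have b1 : ∫⁻ x in D, ∫⁻ θ, G (TT θ x) ∂J ≤ 32 * I := by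
    rw [lintegral_lintegral_swap (mm (fun z => TT z.2 z.1) (TT_cont2.comp continuous_swap)).aemeasurable]
    calc _ ≤ ∫⁻ _θ : ℝ, 32 * I ∂J := by
          refine lintegral_mono_ae ?_
          filter_upwards [hJae] with θ hθ
          refine (lintegral_mono' Measure.restrict_le_self le_rfl).trans ?_
          have := lint_diag hGm (cc θ) 0 (by simp [cc]; nlinarith [hθ.1])
          simp only [zero_add] at this
          exact this
      _ ≤ 32 * I := by rw [lintegral_const]; exact mul_le_of_le_one_right' hJ1
  have b2 : ∀ y : Fin 3 → ℝ, ∫⁻ x in D, ∫⁻ θ, G (y + θ • (TT (1 / 2) x - y)) ∂J ≤ 32 * I := by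
    intro y
    rw [lintegral_lintegral_swap (mm (fun z => y + z.2 • (TT (1 / 2) z.1 - y)) (by fun_prop)).aemeasurable]
    calc _ ≤ ∫⁻ _θ : ℝ, 32 * I ∂J := by
          refine lintegral_mono_ae ?_
          filter_upwards [hJae] with θ hθ
          refine (lintegral_mono' Measure.restrict_le_self le_rfl).trans ?_
          have h3 := cube_ge hθ.1.le
          have := lint_diag hGm (fun i => θ * cc (1 / 2) i) (y - θ • y) (by simp [cc]; nlinarith)
          refine le_trans (le_of_eq ?_) this
          refine lintegral_congr fun x => ?_
          congr 1; funext i; simp [TT]; ring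
      _ ≤ 32 * I := by rw [lintegral_const]; exact mul_le_of_le_one_right' hJ1
  set ν := (volume.restrict D).prod J with hν
  set H : (Fin 3 → ℝ) → ℝ≥0∞ := fun y => ∫⁻ z, G (TT (1 / 2) z.1 + z.2 • (y - TT (1 / 2) z.1)) ∂ν with hH
  have mH : Measurable fun p : (Fin 3 → ℝ) × ((Fin 3 → ℝ) × ℝ) => G (TT (1 / 2) p.2.1 + p.2.2 • (p.1 - TT (1 / 2) p.2.1)) :=
    hGm.comp (by fun_prop : Continuous fun p : (Fin 3 → ℝ) × ((Fin 3 → ℝ) × ℝ) => TT (1 / 2) p.2.1 + p.2.2 • (p.1 - TT (1 / 2) p.2.1)).measurable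
  have mH1 : Measurable H := mH.lintegral_prod_right'
  have b3 : ∫⁻ y in Qb s, H y ≤ 160 * I := by
    rw [hH, lintegral_lintegral_swap mH.aemeasurable]
    calc _ ≤ ∫⁻ _z, 32 * I ∂ν := by
          refine lintegral_mono_ae ?_
          have : ∀ᵐ z ∂ν, z.2 ∈ Ioc (1 / 2 : ℝ) 1 := Measure.quasiMeasurePreserving_snd.ae hJae
          filter_upwards [this] with z hz
          refine (lintegral_mono' Measure.restrict_le_self le_rfl).trans ?_
          have h3 := cube_ge hz.1.le
          have := lint_diag hGm (fun _ => z.2) (TT (1 / 2) z.1 - z.2 • TT (1 / 2) z.1) (by nlinarith)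
          refine le_trans (le_of_eq ?_) this
          refine lintegral_congr fun x => ?_
          congr 1; funext i; simp; ring
      _ ≤ 32 * I * 5 := by
          rw [lintegral_const]
          refine mul_le_mul_right ?_ _
          rw [hν, ← univ_prod_univ, Measure.prod_prod, Measure.restrict_apply_univ]
          exact (mul_le_of_le_one_right' hJ1).trans hv
      _ = 160 * I := by ring
  have hQo : MeasurableSet (Qb s) := MeasurableSet.univ_pi fun i => measurableSet_Ioo
  have hQ1 := Qb_vol s
  have hQf : volume (Qb s) ≠ ⊤ := ((measure_mono hQ).trans hv).trans_lt (by simp) |>.ne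
  obtain ⟨y, hyQ, hy⟩ := exists_le_setLAverage (μ := volume) (s := Qb s) (f := H) (by
    intro h0; rw [h0] at hQ1; simp at hQ1) hQf mH1.aemeasurable
  have hyH : H y ≤ 160 * I := by
    refine hy.trans ?_
    rw [setLAverage_eq]
    refine le_trans ?_ b3
    rw [ENNReal.div_eq_inv_mul]
    exact mul_le_of_le_one_left' (ENNReal.inv_le_one.2 hQ1)
  have hyH' : ∫⁻ x in D, ∫⁻ θ, G (TT (1 / 2) x + θ • (y - TT (1 / 2) x)) ∂J ≤ 160 * I := by
    refine le_trans (le_of_eq ?_) hyH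
    rw [hH]
    simp only []
    rw [lintegral_prod _ (mm (fun z => TT (1 / 2) z.1 + z.2 • (y - TT (1 / 2) z.1)) (by fun_prop)).aemeasurable]
  refine ⟨y, hQ hyQ, ?_⟩
  have key : ∀ x ∈ D, ENNReal.ofReal ((u x - u y) ^ 2) ≤ 6 * (∫⁻ θ, G (TT θ x) ∂J + ∫⁻ θ, G (y + θ • (TT (1 / 2) x - y)) ∂J
      + ∫⁻ θ, G (TT (1 / 2) x + θ • (y - TT (1 / 2) x)) ∂J) := by
    intro x hx
    have hxQ := hTQ x hx
    have ew : ∀ θ : ℝ, TT θ x = ![0, 0, x 2] + θ • ![x 0, x 1, 0] := fun θ => by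
      funext i; fin_cases i <;> simp [TT, cc]
    set z := TT (1 / 2) x with hz
    set mid := y + (1 / 2 : ℝ) • (z - y) with hmid
    have l1 := leg hu ![0, 0, x 2] ![x 0, x 1, 0] (by simp [sq3]; exact hr x hx)
      (fun θ h0 h1 => by rw [← ew]; exact hT θ h0 h1 x hx) (x := x) (y := z) (by rw [← ew, TT_id]) (by rw [hz, ew])
    have l2 := leg hu y (z - y) (Qb_diff hxQ hyQ) (fun θ h0 h1 => hQ (by
        have := (Qb_convex s) hyQ hxQ (a := 1 - θ) (b := θ) (by linarith) (by linarith) (by ring)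
        convert this using 1; module)) (x := z) (y := mid) (by module) rfl
    have l3 := leg hu z (y - z) (Qb_diff hyQ hxQ) (fun θ h0 h1 => hQ (by
        have := (Qb_convex s) hxQ hyQ (a := 1 - θ) (b := θ) (by linarith) (by linarith) (by ring)
        convert this using 1; module)) (x := y) (y := mid) (by module) (by rw [hmid]; module)
    simp only [← ew] at l1
    have h3 : (u x - u y) ^ 2 ≤ 3 * ((u x - u z) ^ 2 + (u z - u mid) ^ 2 + (u y - u mid) ^ 2) := by
      nlinarith [sq_nonneg ((u x - u z) - (u z - u mid)), sq_nonneg ((u x - u z) + (u y - u mid)), sq_nonneg ((u z - u mid) + (u y - u mid))]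
    refine (ENNReal.ofReal_le_ofReal h3).trans ?_
    rw [ENNReal.ofReal_mul (by norm_num), ENNReal.ofReal_add (by positivity) (by positivity), ENNReal.ofReal_add (by positivity) (by positivity)]
    refine (mul_le_mul_right (add_le_add (add_le_add l1 l2) l3) _).trans (le_of_eq ?_)
    rw [← mul_add, ← mul_add, ← mul_assoc]
    congr 1
    rw [show ENNReal.ofReal 3 = 3 by norm_num]; norm_num
  have m1 : Measurable fun x => ∫⁻ θ, G (TT θ x) ∂J :=
    (mm (fun z => TT z.2 z.1) (TT_cont2.comp continuous_swap)).lintegral_prod_right'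
  have m2 : Measurable fun x => ∫⁻ θ, G (y + θ • (TT (1 / 2) x - y)) ∂J :=
    (mm (fun z => y + z.2 • (TT (1 / 2) z.1 - y)) (by fun_prop)).lintegral_prod_right'
  have m12 : Measurable fun x => ∫⁻ θ, G (TT θ x) ∂J + ∫⁻ θ, G (y + θ • (TT (1 / 2) x - y)) ∂J := m1.add m2
  refine (setLIntegral_mono_ae' hD.measurableSet (Filter.Eventually.of_forall key)).trans ?_
  rw [lintegral_const_mul' _ _ (by simp), lintegral_add_left m12, lintegral_add_left m1]
  calc _ ≤ 6 * (32 * I + 32 * I + 160 * I) := mul_le_mul_right (add_le_add (add_le_add b1 (b2 y)) hyH') _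
    _ = 1344 * I := by ring
end

section
open scoped ENNReal

/-- slab indicator -/
noncomputable def eI (S : Set ℝ) (x : Fin 3 → ℝ) : ℝ := S.indicator (fun _ => (1:ℝ)) (x 2)

lemma eI_mem {S : Set ℝ} {x : Fin 3 → ℝ} (h : x 2 ∈ S) : eI S x = 1 := indicator_of_mem h _
lemma eI_not {S : Set ℝ} {x : Fin 3 → ℝ} (h : x 2 ∉ S) : eI S x = 0 := indicator_of_notMem h _
lemma eI_nonneg (S : Set ℝ) (x : Fin 3 → ℝ) : 0 ≤ eI S x := indicator_nonneg (fun _ _ => zero_le_one) _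
lemma eI_le (S : Set ℝ) (x : Fin 3 → ℝ) : eI S x ≤ 1 := by
  by_cases h : x 2 ∈ S
  · rw [eI_mem h]
  · rw [eI_not h]; exact zero_le_one
lemma eI_meas {S : Set ℝ} (hS : MeasurableSet S) : Measurable (eI S) :=
  (measurable_const.indicator hS).comp (measurable_pi_apply 2)

lemma FN.int_S {K a C₀ : ℝ} {f : ℝ → ℝ → ℝ} (h : FN K a C₀ f) {S : Set ℝ} (hS : MeasurableSet S) {t1 t2 B : ℝ}
    (hsub : S ⊆ Icc t1 t2) (hB0 : 0 ≤ B) {G : (Fin 3 → ℝ) → ℝ}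
    (hG : AEStronglyMeasurable G (volume.restrict (nozzleFrom f K)))
    (hb : ∀ x ∈ nozzleFrom f K, x 2 ∈ S → |G x| ≤ B) :
    IntegrableOn (fun x => eI S x * G x) (nozzleFrom f K) := by
  refine h.int_slab (t1 := t1) (t2 := t2) (B := B) ?_ ?_ ?_
  · exact (eI_meas hS).aestronglyMeasurable.mul hG
  · intro x hx
    by_cases h2 : x 2 ∈ S
    · rw [eI_mem h2, one_mul]; exact hb x hx h2
    · rw [eI_not h2, zero_mul, abs_zero]; exact hB0
  · intro x hx h2
    rw [eI_not, zero_mul]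
    intro hc
    have := hsub hc
    rcases h2 with h2 | h2 <;> linarith [this.1, this.2]

lemma SP.u_bdd {K a C₀ m₀ M : ℝ} {f : ℝ → ℝ → ℝ} {φ : (Fin 3 → ℝ) → ℝ} (h : SP K a C₀ m₀ M f φ) (t1 t2 : ℝ) :
    ∃ B, 0 ≤ B ∧ ∀ x ∈ nozzleFrom f K, t1 ≤ x 2 → x 2 ≤ t2 → |uu m₀ φ x| ≤ B := by
  set S := closure (nozzleFrom f K) ∩ {x | t1 ≤ x 2 ∧ x 2 ≤ t2} with hS
  have hcl : closure (nozzleFrom f K) ⊆ {x | (-C₀ ≤ x 0 ∧ x 0 ≤ C₀) ∧ (-C₀ ≤ x 1 ∧ x 1 ≤ C₀)} := by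
    refine closure_minimal ?_ ?_
    · intro x hx
      exact ⟨abs_le.1 ((FN.abs0_le_rad x).trans (h.fn.rad_le hx)), abs_le.1 ((FN.abs1_le_rad x).trans (h.fn.rad_le hx))⟩
    · exact ((isClosed_le continuous_const (continuous_apply 0)).inter (isClosed_le (continuous_apply 0) continuous_const)).inter
        ((isClosed_le continuous_const (continuous_apply 1)).inter (isClosed_le (continuous_apply 1) continuous_const))
  have hc : IsCompact S := by
    refine IsCompact.of_isClosed_subset (isCompact_Icc (a := ![-C₀, -C₀, t1]) (b := ![C₀, C₀, t2])) ?_ ?_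
    · exact isClosed_closure.inter ((isClosed_le continuous_const (continuous_apply 2)).inter
        (isClosed_le (continuous_apply 2) continuous_const))
    · rintro x ⟨hx, h1, h2⟩
      obtain ⟨⟨a1, a2⟩, a3, a4⟩ := hcl hx
      constructor <;> intro i <;> fin_cases i <;> simp <;> linarith
  have hcont : ContinuousOn (uu m₀ φ) S :=
    (h.c1.continuousOn.mono inter_subset_left).sub (by fun_prop)
  obtain ⟨B, hB⟩ := hc.exists_bound_of_continuousOn hcont
  exact ⟨max B 0, le_max_right _ _, fun x hx h1 h2 => (hB x ⟨subset_closure hx, h1, h2⟩).trans (le_max_left _ _)⟩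

lemma FN.rad_near {K a C₀ : ℝ} {f : ℝ → ℝ → ℝ} (h : FN K a C₀ f) {Tc : ℝ} (hT : NR K a C₀ Tc) {x : Fin 3 → ℝ}
    (hx : x ∈ nozzleFrom f K) (h2 : Tc - 1 ≤ x 2) : rad x ≤ 11 / 10 :=
  ((h.mem_iff 0 x).1 hx).2.le.trans (h.f_near hT _ h2).2

lemma FN.vol_slab {K a C₀ : ℝ} {f : ℝ → ℝ → ℝ} (h : FN K a C₀ f) {Tc : ℝ} (hT : NR K a C₀ Tc) {s t : ℝ}
    (hs : Tc - 1 ≤ s) (hst : s ≤ t) :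
    volume (nozzleFrom f K ∩ {x | x 2 ∈ Icc s t}) ≤ ENNReal.ofReal (5 * (t - s)) := by
  have hs : nozzleFrom f K ∩ {x | x 2 ∈ Icc s t} ⊆ Icc ![-(11 / 10), -(11 / 10), s] ![11 / 10, 11 / 10, t] := by
    rintro x ⟨hx, h1, h2⟩
    have hr := h.rad_near hT hx (hs.trans h1)
    have e0 := abs_le.1 ((FN.abs0_le_rad x).trans hr)
    have e1 := abs_le.1 ((FN.abs1_le_rad x).trans hr)
    constructor <;> intro i <;> fin_cases i <;> simp <;> linarith
  refine (measure_mono hs).trans ?_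
  rw [Real.volume_Icc_pi, Fin.prod_univ_three]
  simp only [Matrix.cons_val]
  rw [← ENNReal.ofReal_mul (by norm_num), ← ENNReal.ofReal_mul (by norm_num)]
  exact ENNReal.ofReal_le_ofReal (by nlinarith)

lemma SP.poinc_slab {K a C₀ m₀ M : ℝ} {f : ℝ → ℝ → ℝ} {φ : (Fin 3 → ℝ) → ℝ} (h : SP K a C₀ m₀ M f φ) {Tc : ℝ}
    (hT : NR K a C₀ Tc) {s : ℝ} (hs : Tc - 1 ≤ s) :
    ∃ c : ℝ, ∫ x in nozzleFrom f K, eI (Ioo s (s + 1)) x * (uu m₀ φ x - c) ^ 2 ≤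
      1344 * ∫ x in nozzleFrom f K, eI (Ioo s (s + 1)) x * ∑ j, grad3 (uu m₀ φ) x j ^ 2 := by
  set u := uu m₀ φ with hu
  set D := nozzleFrom f K ∩ {x | x 2 ∈ Ioo s (s + 1)} with hD
  have hKs : K < s := by linarith [hT.1, h.fn.C0pos]
  have hDo : IsOpen D := h.fn.isOpen_noz.inter (isOpen_Ioo.preimage (continuous_apply 2))
  have hms : MeasurableSet {x : Fin 3 → ℝ | x 2 ∈ Ioo s (s + 1)} := (isOpen_Ioo.preimage (continuous_apply 2)).measurableSet
  have hTT : ∀ θ : ℝ, 1 / 2 ≤ θ → θ ≤ 1 → ∀ x ∈ D, TT θ x ∈ D := fun θ h0 h1 x hx =>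
    ⟨TT_mem (by linarith) h1 hx.1, by rw [mem_ofPred_eq, TT_two]; exact hx.2⟩
  have hQ : Qb s ⊆ D := by
    intro x hx
    obtain ⟨⟨h0, h1⟩, h2, h3⟩ := mem_Qb.1 hx
    refine ⟨(h.fn.mem_iff 0 x).2 ⟨by linarith, ?_⟩, h2, h3⟩
    have := (h.fn.f_near hT (ang 0 x) (show Tc - 1 ≤ x 2 by linarith)).1
    refine lt_of_lt_of_le ?_ this
    rw [rad, Real.sqrt_lt' (by norm_num)]
    have e0 : x 0 ^ 2 ≤ (6 / 10) ^ 2 := sq_le_sq' (by linarith [(abs_lt.1 h0).1]) (abs_lt.1 h0).2.le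
    have e1 : x 1 ^ 2 ≤ (6 / 10) ^ 2 := sq_le_sq' (by linarith [(abs_lt.1 h1).1]) (abs_lt.1 h1).2.le
    linarith
  have hrad : ∀ x ∈ D, rad x ≤ 11 / 10 := fun x hx => h.fn.rad_near hT hx.1 (by linarith [hx.2.1])
  have hTQ : ∀ x ∈ D, TT (1 / 2) x ∈ Qb s := by
    intro x hx
    have hr := hrad x hx
    refine mem_Qb.2 ⟨⟨?_, ?_⟩, ?_, ?_⟩
    · rw [TT_zero, abs_mul, abs_of_pos (by norm_num : (0:ℝ) < 1 / 2)]; linarith [FN.abs0_le_rad x]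
    · rw [TT_oneC, abs_mul, abs_of_pos (by norm_num : (0:ℝ) < 1 / 2)]; linarith [FN.abs1_le_rad x]
    · rw [TT_two]; exact hx.2.1
    · rw [TT_two]; exact hx.2.2
  have hv : volume D ≤ 5 := by
    have hsub : D ⊆ nozzleFrom f K ∩ {x | x 2 ∈ Icc s (s + 1)} := fun x hx => ⟨hx.1, hx.2.1.le, hx.2.2.le⟩
    have hss : s ≤ s + 1 := by linarith
    refine (measure_mono hsub).trans ((h.fn.vol_slab hT hs hss).trans ?_)
    rw [show (5:ℝ≥0∞) = ENNReal.ofReal 5 by norm_num]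
    exact ENNReal.ofReal_le_ofReal (by linarith)
  have hr4 : ∀ x ∈ D, x 0 ^ 2 + x 1 ^ 2 ≤ 4 := by
    intro x hx
    rw [← rad_sq]
    have := hrad x hx
    have h0 := rad_nonneg x
    nlinarith
  obtain ⟨y, -, hy⟩ := poinc hDo (fun x hx => h.u_c1 hx.1) hTT hQ hTQ hv hr4
  obtain ⟨B, hB0, hB⟩ := h.u_bdd s (s + 1)
  refine ⟨u y, ?_⟩
  have conv : ∀ G : (Fin 3 → ℝ) → ℝ, ∫ x in nozzleFrom f K, eI (Ioo s (s + 1)) x * G x = ∫ x in D, G x := by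
    intro G
    rw [hD, ← setIntegral_indicator hms]
    refine setIntegral_congr_fun h.fn.meas_noz fun x _ => ?_
    by_cases h2 : x 2 ∈ Ioo s (s + 1)
    · simp only [eI_mem h2, one_mul]
      exact (indicator_of_mem (show x ∈ {x : Fin 3 → ℝ | x 2 ∈ Ioo s (s + 1)} from h2) G).symm
    · simp only [eI_not h2, zero_mul]
      exact (indicator_of_notMem (show x ∉ {x : Fin 3 → ℝ | x 2 ∈ Ioo s (s + 1)} from h2) G).symm
  rw [conv, conv]
  have hDf : volume D < ⊤ := hv.trans_lt (by simp)
  have fin : IsFiniteMeasure (volume.restrict D) := ⟨by simpa using hDf⟩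
  have hcu : ContinuousOn u D := fun x hx => (h.u_c1 hx.1).continuousAt.continuousWithinAt
  have i1 : IntegrableOn (fun x => (u x - u y) ^ 2) D := by
    refine Integrable.of_bound (C := (B + |u y|) ^ 2) (((hcu.sub continuousOn_const).pow 2).aestronglyMeasurable hDo.measurableSet) ?_
    filter_upwards [ae_restrict_mem hDo.measurableSet] with x hx
    rw [Real.norm_eq_abs, abs_pow]
    refine pow_le_pow_left₀ (abs_nonneg _) ((abs_sub _ _).trans ?_) 2
    linarith [hB x hx.1 hx.2.1.le hx.2.2.le]
  have i2 : IntegrableOn (fun x => ∑ j, grad3 u x j ^ 2) D := by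
    refine Integrable.of_bound (C := ∑ _j : Fin 3, (M + |m₀ / π|) ^ 2)
      (Finset.measurable_sum _ fun j _ => (grad_meas u j).pow_const 2).aestronglyMeasurable ?_
    filter_upwards [ae_restrict_mem hDo.measurableSet] with x hx
    rw [Real.norm_eq_abs, abs_of_nonneg (Finset.sum_nonneg fun _ _ => sq_nonneg _)]
    refine Finset.sum_le_sum fun j _ => ?_
    rw [← sq_abs]
    exact pow_le_pow_left₀ (abs_nonneg _) (h.u_bd hx.1 j) 2
  have hn2 : 0 ≤ ∫ x in D, ∑ j, grad3 u x j ^ 2 := integral_nonneg fun _ => Finset.sum_nonneg fun _ _ => sq_nonneg _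
  have e : ∫⁻ x, GD u D x = ENNReal.ofReal (∫ x in D, ∑ j, grad3 u x j ^ 2) := by
    rw [GD, lintegral_indicator hDo.measurableSet, ofReal_integral_eq_lintegral_ofReal i2
      (Filter.Eventually.of_forall fun _ => Finset.sum_nonneg fun _ _ => sq_nonneg _)]
  rw [e, ← ofReal_integral_eq_lintegral_ofReal i1 (Filter.Eventually.of_forall fun _ => sq_nonneg _),
    show (1344:ℝ≥0∞) = ENNReal.ofReal 1344 by norm_num, ← ENNReal.ofReal_mul (by norm_num),
    ENNReal.ofReal_le_ofReal_iff (by positivity)] at hy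
  exact hy
end

section
/-- the explicit divergence free correction -/
noncomputable def Fv (q : ℝ) (f : ℝ → ℝ → ℝ) (x : Fin 3 → ℝ) : Fin 3 → ℝ :=
  ![q * (FF f 0 x ^ 2)⁻¹ * P2 f 0 x * x 0, q * (FF f 0 x ^ 2)⁻¹ * P2 f 0 x * x 1, q * ((FF f 0 x ^ 2)⁻¹ - 1)]

lemma FN.FF_inv_bd {K a C₀ : ℝ} {f : ℝ → ℝ → ℝ} (h : FN K a C₀ f) {x : Fin 3 → ℝ} (hx : x ∈ nozzleFrom f K) :
    0 < (FF f 0 x ^ 2)⁻¹ ∧ (FF f 0 x ^ 2)⁻¹ ≤ C₀ ^ 2 := by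
  have h1 := (h.rng (ang 0 x) (x 2) hx.1).1
  have h2 := h.fpos (ang 0 x) hx.1
  have h0 := h.C0pos
  rw [FF]
  refine ⟨by positivity, ?_⟩
  rw [← inv_pow]
  refine pow_le_pow_left₀ (by positivity) ?_ 2
  rw [one_div] at h1
  exact inv_le_of_inv_le₀ h0 h1

lemma FN.Fv_bd {K a C₀ : ℝ} {f : ℝ → ℝ → ℝ} (h : FN K a C₀ f) (q : ℝ) {x : Fin 3 → ℝ} (hx : x ∈ nozzleFrom f K) (j : Fin 3) :
    |Fv q f x j| ≤ 2 * |q| * C₀ ^ 5 * x 2 ^ (-a) := by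
  obtain ⟨i1, i2⟩ := h.FF_inv_bd hx
  have hC := h.C1
  have hC0 := h.C0pos
  have hx1 : 1 ≤ x 2 := by linarith [hx.1, h.K1]
  have hxp : 0 < x 2 := by linarith
  have hP : |P2 f 0 x| ≤ C₀ ^ 2 * x 2 ^ (-a) := by
    refine (h.dec_p2 (ang 0 x) hx.1).trans ?_
    exact mul_le_mul_of_nonneg_left (Real.rpow_le_rpow_of_exponent_le hx1 (by linarith)) (by positivity)
  have hpw : 0 ≤ x 2 ^ (-a) := by positivity
  have lat : ∀ y : ℝ, |y| ≤ C₀ → |q * (FF f 0 x ^ 2)⁻¹ * P2 f 0 x * y| ≤ 2 * |q| * C₀ ^ 5 * x 2 ^ (-a) := by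
    intro y hy
    rw [abs_mul, abs_mul, abs_mul, abs_of_pos i1]
    calc |q| * (FF f 0 x ^ 2)⁻¹ * |P2 f 0 x| * |y| ≤ |q| * C₀ ^ 2 * (C₀ ^ 2 * x 2 ^ (-a)) * C₀ := by gcongr
      _ = 1 * (|q| * C₀ ^ 5 * x 2 ^ (-a)) := by ring
      _ ≤ 2 * (|q| * C₀ ^ 5 * x 2 ^ (-a)) := by
          refine mul_le_mul_of_nonneg_right (by norm_num) (by positivity)
      _ = _ := by ring
  have hr := h.rad_le hx
  fin_cases j
  · exact lat _ ((FN.abs0_le_rad x).trans hr)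
  · exact lat _ ((FN.abs1_le_rad x).trans hr)
  · change |q * ((FF f 0 x ^ 2)⁻¹ - 1)| ≤ _
    have hfp := h.fpos (ang 0 x) hx.1
    have hd := h.dec_f (ang 0 x) hx.1
    have hup := (h.rng (ang 0 x) (x 2) hx.1).2
    have e : (FF f 0 x ^ 2)⁻¹ - 1 = -((FF f 0 x ^ 2)⁻¹ * ((f (ang 0 x) (x 2) - 1) * (1 + f (ang 0 x) (x 2)))) := by
      rw [FF]; field_simp; ring
    rw [e, abs_mul, abs_neg, abs_mul, abs_mul, abs_of_pos i1, abs_of_pos (by linarith : 0 < 1 + f (ang 0 x) (x 2))]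
    calc |q| * ((FF f 0 x ^ 2)⁻¹ * (|f (ang 0 x) (x 2) - 1| * (1 + f (ang 0 x) (x 2))))
        ≤ |q| * (C₀ ^ 2 * ((C₀ * x 2 ^ (-a)) * (C₀ + C₀))) := by gcongr
      _ = 2 * |q| * C₀ ^ 4 * x 2 ^ (-a) := by ring
      _ ≤ 2 * |q| * C₀ ^ 5 * x 2 ^ (-a) := by
          gcongr
          norm_num

lemma FN.Fv_bd' {K a C₀ : ℝ} {f : ℝ → ℝ → ℝ} (h : FN K a C₀ f) (q : ℝ) {x : Fin 3 → ℝ} (hx : x ∈ nozzleFrom f K) (j : Fin 3) :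
    |Fv q f x j| ≤ 2 * |q| * C₀ ^ 5 := by
  have hC0 := h.C0pos
  refine (h.Fv_bd q hx j).trans (mul_le_of_le_one_right (by positivity) ?_)
  exact Real.rpow_le_one_of_one_le_of_nonpos (by linarith [hx.1, h.K1]) (by linarith [h.a0])

lemma FN.Fv_meas {K a C₀ : ℝ} {f : ℝ → ℝ → ℝ} (h : FN K a C₀ f) (q : ℝ) (j : Fin 3) :
    AEStronglyMeasurable (fun x => Fv q f x j) (volume.restrict (nozzleFrom f K)) := by
  have hF : AEStronglyMeasurable (fun x => (FF f 0 x ^ 2)⁻¹) (volume.restrict (nozzleFrom f K)) :=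
    (((h.FF_meas 0).aemeasurable.pow_const 2).inv).aestronglyMeasurable
  fin_cases j
  · exact ((hF.const_mul q).mul (h.P2_meas 0)).mul (coord_aesm 0 _)
  · exact ((hF.const_mul q).mul (h.P2_meas 0)).mul (coord_aesm 1 _)
  · exact (hF.sub aestronglyMeasurable_const).const_mul q

namespace SP
variable {K a C₀ m₀ M : ℝ} {f : ℝ → ℝ → ℝ} {φ : (Fin 3 → ℝ) → ℝ}

lemma weakF (h : SP K a C₀ m₀ M f φ) {ψ : (Fin 3 → ℝ) → ℝ} {t1 t2 B : ℝ} (hψ : TS f K ψ t1 t2 B)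
    (hc : ∀ x ∈ nozzleFrom f K, ContDiffAt ℝ 1 ψ x) :
    IntegrableOn (fun x => ∑ j, (grad3 (uu m₀ φ) x j - Fv (m₀ / π) f x j) * grad3 ψ x j) (nozzleFrom f K) ∧
    ∫ x in nozzleFrom f K, ∑ j, (grad3 (uu m₀ φ) x j - Fv (m₀ / π) f x j) * grad3 ψ x j = 0 := by
  have i1 := h.weak_int hψ
  have i2 := (h.fn.V_int 0 hψ).const_mul (m₀ / π)
  have e1 := h.weak_ext hψ hc
  have e2 := h.fn.Vid 0 hψ
  have hEq : EqOn (fun x => (∑ i, grad3 φ x i * grad3 ψ x i) - m₀ / π * ((FF f 0 x ^ 2)⁻¹ * (P2 f 0 x * (x 0 * grad3 ψ x 0 + x 1 * grad3 ψ x 1) + grad3 ψ x 2)))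
      (fun x => ∑ j, (grad3 (uu m₀ φ) x j - Fv (m₀ / π) f x j) * grad3 ψ x j) (nozzleFrom f K) := by
    intro x hx
    obtain ⟨a0, a1, a2⟩ := h.u_grad' hx
    simp only [Fin.sum_univ_three, a0, a1, a2, Fv, Matrix.cons_val]
    ring
  refine ⟨(integrableOn_congr_fun hEq h.fn.meas_noz).1 (i1.sub i2), ?_⟩
  rw [← setIntegral_congr_fun h.fn.meas_noz hEq, integral_sub i1 i2, e1, integral_const_mul, e2]; ring

lemma fluxF (h : SP K a C₀ m₀ M f φ) {χ : ℝ → ℝ} {t1 t2 : ℝ} (ht : K < t1) (hχ : Continuous χ)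
    (hz : ∀ t, (t < t1 ∨ t2 < t) → χ t = 0) :
    IntegrableOn (fun x => χ (x 2) * (grad3 (uu m₀ φ) x 2 - Fv (m₀ / π) f x 2)) (nozzleFrom f K) ∧
    ∫ x in nozzleFrom f K, χ (x 2) * (grad3 (uu m₀ φ) x 2 - Fv (m₀ / π) f x 2) = 0 := by
  have hcs : HasCompactSupport χ := HasCompactSupport.intro (isCompact_Icc (a := t1) (b := t2))
    fun t ht => hz t (by by_contra hc; push Not at hc; exact ht hc)
  obtain ⟨B, hB⟩ := hcs.exists_bound_of_continuous hχ
  have hB0 : 0 ≤ B := (norm_nonneg _).trans (hB 0)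
  have hmχ : AEStronglyMeasurable (fun x : Fin 3 → ℝ => χ (x 2)) (volume.restrict (nozzleFrom f K)) :=
    (hχ.comp (continuous_apply 2)).aestronglyMeasurable
  have hF : AEStronglyMeasurable (fun x => (FF f 0 x ^ 2)⁻¹) (volume.restrict (nozzleFrom f K)) :=
    (((h.fn.FF_meas 0).aemeasurable.pow_const 2).inv).aestronglyMeasurable
  have i1 : IntegrableOn (fun x => χ (x 2) * grad3 φ x 2) (nozzleFrom f K) := by
    refine h.fn.int_slab (t1 := t1) (t2 := t2) (B := B * M) (hmχ.mul (FN.grad_aesm φ 2 _)) ?_ ?_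
    · intro x hx
      rw [abs_mul]
      exact mul_le_mul (hB _) (h.phi_bd hx 2) (abs_nonneg _) hB0
    · intro x _ h2
      rw [hz _ h2, zero_mul]
  have i2 : IntegrableOn (fun x => χ (x 2) * (FF f 0 x ^ 2)⁻¹) (nozzleFrom f K) := by
    refine h.fn.int_slab (t1 := t1) (t2 := t2) (B := B * C₀ ^ 2) (hmχ.mul hF) ?_ ?_
    · intro x hx
      obtain ⟨p1, p2⟩ := h.fn.FF_inv_bd hx
      rw [abs_mul, abs_of_pos p1]
      exact mul_le_mul (hB _) p2 p1.le hB0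
    · intro x _ h2
      rw [hz _ h2, zero_mul]
  have hEq : EqOn (fun x => χ (x 2) * grad3 φ x 2 - m₀ / π * (χ (x 2) * (FF f 0 x ^ 2)⁻¹))
      (fun x => χ (x 2) * (grad3 (uu m₀ φ) x 2 - Fv (m₀ / π) f x 2)) (nozzleFrom f K) := by
    intro x hx
    obtain ⟨a0, a1, a2⟩ := h.u_grad' hx
    simp only [a2, Fv, Matrix.cons_val]
    ring
  refine ⟨(integrableOn_congr_fun hEq h.fn.meas_noz).1 (i1.sub (i2.const_mul _)), ?_⟩
  rw [← setIntegral_congr_fun h.fn.meas_noz hEq, integral_sub i1 (i2.const_mul _), integral_const_mul,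
    h.flux_int ht hχ hz, h.fn.int_prof (fun t htK => hz t (Or.inl (by linarith)))]
  have := Real.pi_ne_zero
  field_simp; ring

end SP

/-- derivative of the smooth transition -/
noncomputable def sd (t : ℝ) : ℝ := deriv Real.smoothTransition t

lemma st_c1 : ContDiff ℝ 1 Real.smoothTransition := Real.smoothTransition.contDiff (n := 1)

lemma sd_cont : Continuous sd := st_c1.continuous_deriv le_rfl

lemma sd_has (t : ℝ) : HasDerivAt Real.smoothTransition (sd t) t :=
  (st_c1.differentiable (by norm_num) t).hasDerivAt

lemma sd_zero {t : ℝ} (h : t ∉ Ioo (0:ℝ) 1) : sd t = 0 := by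
  by_cases h0 : t ≤ 0
  · refine IsLocalMin.deriv_eq_zero (Filter.Eventually.of_forall fun y => ?_)
    rw [Real.smoothTransition.zero_of_nonpos h0]
    exact Real.smoothTransition.nonneg y
  · have h1 : 1 ≤ t := by
      by_contra hc
      push Not at h0 hc
      exact h ⟨h0, hc⟩
    refine IsLocalMax.deriv_eq_zero (Filter.Eventually.of_forall fun y => ?_)
    rw [Real.smoothTransition.one_of_one_le h1]
    exact Real.smoothTransition.le_one y

lemma sd_bd : ∃ L > 0, ∀ t, |sd t| ≤ L := by
  have hcs : HasCompactSupport sd := HasCompactSupport.intro (isCompact_Icc (a := (0:ℝ)) (b := 1))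
    fun t ht => sd_zero fun hc => ht (Ioo_subset_Icc_self hc)
  obtain ⟨B, hB⟩ := hcs.exists_bound_of_continuous sd_cont
  exact ⟨max B 1, lt_max_of_lt_right one_pos, fun t => (hB t).trans (le_max_left _ _)⟩
end

section
/-- local energy on a set of heights -/
noncomputable def EE (K m₀ : ℝ) (f : ℝ → ℝ → ℝ) (φ : (Fin 3 → ℝ) → ℝ) (S : Set ℝ) : ℝ :=
  ∫ x in nozzleFrom f K, eI S x * ∑ j, grad3 (uu m₀ φ) x j ^ 2

lemma pw_aux {χ L e v w g Φ : ℝ} (hχ : |χ| ≤ L * e) (hw : w ^ 2 ≤ 2 * g + 2 * Φ) :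
    |χ * v * w| ≤ L * (1 / 2 * (e * v ^ 2) + e * g + Φ * e) := by
  have h1 : |v * w| ≤ 1 / 2 * v ^ 2 + g + Φ := by
    rw [abs_le]; constructor <;> nlinarith [sq_nonneg (v - w), sq_nonneg (v + w)]
  rw [mul_assoc, abs_mul]
  calc |χ| * |v * w| ≤ L * e * (1 / 2 * v ^ 2 + g + Φ) :=
        mul_le_mul hχ h1 (abs_nonneg _) ((abs_nonneg _).trans hχ)
    _ = _ := by ring

lemma FN.vol_eI {K a C₀ : ℝ} {f : ℝ → ℝ → ℝ} (h : FN K a C₀ f) {Tc : ℝ} (hT : NR K a C₀ Tc) {s t : ℝ}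
    (hs : Tc - 1 ≤ s) (hst : s ≤ t) {S : Set ℝ} (hS : MeasurableSet S) (hsub : S ⊆ Icc s t) :
    IntegrableOn (eI S) (nozzleFrom f K) ∧ ∫ x in nozzleFrom f K, eI S x ≤ 5 * (t - s) := by
  have i1 : ∀ {S : Set ℝ}, MeasurableSet S → S ⊆ Icc s t → IntegrableOn (eI S) (nozzleFrom f K) := by
    intro S hS hsub
    have := h.int_S hS hsub zero_le_one (G := fun _ => 1) aestronglyMeasurable_const (fun _ _ _ => by simp)
    simpa using this
  refine ⟨i1 hS hsub, ?_⟩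
  have hms : MeasurableSet {x : Fin 3 → ℝ | x 2 ∈ Icc s t} := measurableSet_Icc.preimage (measurable_pi_apply 2)
  calc ∫ x in nozzleFrom f K, eI S x ≤ ∫ x in nozzleFrom f K, eI (Icc s t) x := by
        refine setIntegral_mono_on (i1 hS hsub) (i1 measurableSet_Icc Subset.rfl) h.meas_noz fun x _ => ?_
        by_cases h2 : x 2 ∈ S
        · rw [eI_mem h2, eI_mem (hsub h2)]
        · rw [eI_not h2]; exact eI_nonneg _ _
    _ = ∫ x in nozzleFrom f K, {x : Fin 3 → ℝ | x 2 ∈ Icc s t}.indicator (fun _ => (1:ℝ)) x := rfl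
    _ = volume.real (nozzleFrom f K ∩ {x : Fin 3 → ℝ | x 2 ∈ Icc s t}) := by
        rw [setIntegral_indicator hms, setIntegral_const, smul_eq_mul, mul_one]
    _ ≤ 5 * (t - s) := by
        have := h.vol_slab hT hs hst
        exact ENNReal.toReal_le_of_le_ofReal (by linarith) this

namespace SP
variable {K a C₀ m₀ M : ℝ} {f : ℝ → ℝ → ℝ} {φ : (Fin 3 → ℝ) → ℝ}

lemma g_bd (h : SP K a C₀ m₀ M f φ) {x : Fin 3 → ℝ} (hx : x ∈ nozzleFrom f K) :
    |∑ j, grad3 (uu m₀ φ) x j ^ 2| ≤ 3 * (M + |m₀ / π|) ^ 2 := by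
  rw [abs_of_nonneg (Finset.sum_nonneg fun _ _ => sq_nonneg _)]
  have : ∑ j : Fin 3, grad3 (uu m₀ φ) x j ^ 2 ≤ ∑ _j : Fin 3, (M + |m₀ / π|) ^ 2 := by
    refine Finset.sum_le_sum fun j _ => ?_
    rw [← sq_abs]
    exact pow_le_pow_left₀ (abs_nonneg _) (h.u_bd hx j) 2
  simpa using this

lemma EE_int (h : SP K a C₀ m₀ M f φ) {S : Set ℝ} (hS : MeasurableSet S) {t1 t2 : ℝ} (hsub : S ⊆ Icc t1 t2) :
    IntegrableOn (fun x => eI S x * ∑ j, grad3 (uu m₀ φ) x j ^ 2) (nozzleFrom f K) :=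
  h.fn.int_S hS hsub (B := 3 * (M + |m₀ / π|) ^ 2) (by positivity)
    (Finset.measurable_sum _ fun j _ => (grad_meas _ j).pow_const 2).aestronglyMeasurable (fun _ hx _ => h.g_bd hx)

lemma energy (h : SP K a C₀ m₀ M f φ) {Tc : ℝ} (hT : NR K a C₀ Tc) {L : ℝ} (hL : 0 < L) (hsd : ∀ t, |sd t| ≤ L)
    {A B Φ : ℝ} (hA : Tc - 1 ≤ A) (hAB : A + 1 ≤ B)
    (hΦ : ∀ x ∈ nozzleFrom f K, A ≤ x 2 → ∑ j, Fv (m₀ / π) f x j ^ 2 ≤ Φ) (hΦ0 : 0 ≤ Φ) :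
    1 / 2 * EE K m₀ f φ (Icc (A + 1) B) ≤ 1 / 2 * Φ * (5 * (B + 1 - A)) +
      L * (673 * EE K m₀ f φ (Ioo A (A + 1)) + 5 * Φ) + L * (673 * EE K m₀ f φ (Ioo B (B + 1)) + 5 * Φ) := by
  set Ω := nozzleFrom f K with hΩ
  set u := uu m₀ φ with hu
  have hKA : K < A := by linarith [hT.1, h.fn.C0pos]
  set η : ℝ → ℝ := fun t => Real.smoothTransition (t - A) - Real.smoothTransition (t - B) with hη
  set ηd : ℝ → ℝ := fun t => sd (t - A) - sd (t - B) with hηd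
  have hηh : ∀ t, HasDerivAt η (ηd t) t := fun t =>
    ((sd_has (t - A)).comp_sub_const t A).sub ((sd_has (t - B)).comp_sub_const t B)
  have hη0 : ∀ t, 0 ≤ η t := fun t => sub_nonneg.2 (Real.smoothTransition.monotone (by linarith))
  have hη1 : ∀ t, η t ≤ 1 := fun t => by
    have h1 := Real.smoothTransition.le_one (t - A)
    have h2 := Real.smoothTransition.nonneg (t - B)
    simp only [hη]; linarith
  have hηz : ∀ t, (t < A ∨ B + 1 < t) → η t = 0 := by
    rintro t (ht | ht)
    · simp only [hη]
      rw [Real.smoothTransition.zero_of_nonpos (by linarith), Real.smoothTransition.zero_of_nonpos (by linarith)]; ring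
    · simp only [hη]
      rw [Real.smoothTransition.one_of_one_le (by linarith), Real.smoothTransition.one_of_one_le (by linarith)]; ring
  have hηm : ∀ t ∈ Icc (A + 1) B, η t = 1 := by
    intro t ht
    simp only [hη]
    rw [Real.smoothTransition.one_of_one_le (by linarith [ht.1]), Real.smoothTransition.zero_of_nonpos (by linarith [ht.2])]; ring
  have hηc : ContDiff ℝ 1 η := (st_c1.comp (contDiff_id.sub contDiff_const)).sub (st_c1.comp (contDiff_id.sub contDiff_const))
  obtain ⟨Bu, hBu0, hBu⟩ := h.u_bdd A (B + 1)
  set M' := M + |m₀ / π| with hM'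
  have hM'0 : 0 ≤ M' := by have := h.hM; positivity
  set ψ : (Fin 3 → ℝ) → ℝ := fun x => η (x 2) * u x with hψ
  have hηx : ∀ x : Fin 3 → ℝ, HasFDerivAt (fun x : Fin 3 → ℝ => η (x 2)) (ηd (x 2) • ContinuousLinearMap.proj (R := ℝ) (φ := fun _ : Fin 3 => ℝ) 2) x :=
    fun x => HasDerivAt.comp_hasFDerivAt (h₂ := η) (f := fun x : Fin 3 → ℝ => x 2) x (hηh (x 2))
      (hasFDerivAt_apply (𝕜 := ℝ) (F' := fun _ : Fin 3 => ℝ) 2 x)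
  have hψg : ∀ x ∈ Ω, ∀ j, grad3 ψ x j = η (x 2) * grad3 u x j + (if j = 2 then ηd (x 2) * u x else 0) := by
    intro x hx j
    have this : fderiv ℝ ψ x = _ := ((hηx x).mul (h.u_diff hx).hasFDerivAt).fderiv
    rw [grad3, this, ← hu]
    fin_cases j
    · simp [grad3]
    · simp [grad3]
    · simp [grad3]; ring
  have hψc : ∀ x ∈ Ω, ContDiffAt ℝ 1 ψ x := fun x hx =>
    ((hηc.comp (contDiff_apply ℝ ℝ (2 : Fin 3))).contDiffAt).mul (h.u_c1 hx)
  have hηdz : ∀ t, (t < A ∨ B + 1 < t) → ηd t = 0 := by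
    rintro t (ht | ht)
    · simp only [hηd]
      rw [sd_zero (fun hc => by linarith [hc.1]), sd_zero (fun hc => by linarith [hc.1])]; ring
    · simp only [hηd]
      rw [sd_zero (fun hc => by linarith [hc.2]), sd_zero (fun hc => by linarith [hc.2])]; ring
  have hηdb : ∀ t, |ηd t| ≤ 2 * L := fun t => (abs_sub _ _).trans (by linarith [hsd (t - A), hsd (t - B)])
  have hTS : TS f K ψ A (B + 1) (Bu + M' + 2 * L * Bu) := by
    refine ⟨hKA, fun x hx => (hψc x hx).differentiableAt (by norm_num), ?_, ?_, ?_⟩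
    · intro x hx
      have hpos : 0 ≤ Bu + M' + 2 * L * Bu := by positivity
      by_cases h2 : x 2 < A ∨ B + 1 < x 2
      · simp only [hψ, hηz _ h2, zero_mul, abs_zero]; exact hpos
      · push Not at h2
        have := hBu x hx h2.1 h2.2
        simp only [hψ]
        rw [abs_mul, abs_of_nonneg (hη0 _)]
        have h3 : η (x 2) * |u x| ≤ 1 * Bu := mul_le_mul (hη1 _) this (abs_nonneg _) zero_le_one
        have : 0 ≤ L * Bu := by positivity
        linarith
    · intro x hx j
      rw [hψg x hx j]
      refine (abs_add_le _ _).trans ?_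
      have g1 : |η (x 2) * grad3 u x j| ≤ M' := by
        rw [abs_mul, abs_of_nonneg (hη0 _)]
        have : η (x 2) * |grad3 u x j| ≤ 1 * M' := mul_le_mul (hη1 _) (h.u_bd hx j) (abs_nonneg _) zero_le_one
        linarith
      have g2 : |if j = 2 then ηd (x 2) * u x else 0| ≤ 2 * L * Bu := by
        split_ifs
        · by_cases h2 : x 2 < A ∨ B + 1 < x 2
          · rw [hηdz _ h2, zero_mul, abs_zero]; positivity
          · push Not at h2
            rw [abs_mul]
            exact mul_le_mul (hηdb _) (hBu x hx h2.1 h2.2) (abs_nonneg _) (by positivity)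
        · rw [abs_zero]; positivity
      linarith
    · intro x hx h2
      simp only [hψ, hηz _ h2, zero_mul]
  obtain ⟨iw, ew⟩ := h.weakF hTS hψc
  have hz : ∀ s t, (t < s ∨ s + 1 < t) → sd (t - s) = 0 := by
    rintro s t (ht | ht)
    · exact sd_zero fun hc => by linarith [hc.1]
    · exact sd_zero fun hc => by linarith [hc.2]
  obtain ⟨iA, eA⟩ := h.fluxF (χ := fun t => sd (t - A)) hKA (sd_cont.comp (continuous_id.sub continuous_const)) (hz A)
  obtain ⟨iB, eB⟩ := h.fluxF (χ := fun t => sd (t - B)) (by linarith : K < B) (sd_cont.comp (continuous_id.sub continuous_const)) (hz B)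
  obtain ⟨cA, hcA⟩ := h.poinc_slab hT hA
  obtain ⟨cB, hcB⟩ := h.poinc_slab hT (by linarith : Tc - 1 ≤ B)
  have iP : ∀ s c : ℝ, A ≤ s → s ≤ B → IntegrableOn (fun x => eI (Ioo s (s + 1)) x * (u x - c) ^ 2) Ω := by
    intro s c h1 h2
    refine h.fn.int_S measurableSet_Ioo Ioo_subset_Icc_self (B := (Bu + |c|) ^ 2) (by positivity) ?_ ?_
    · have hcu : ContinuousOn u Ω := fun x hx => (h.u_c1 hx).continuousAt.continuousWithinAt
      exact ((hcu.sub continuousOn_const).pow 2).aestronglyMeasurable h.fn.meas_noz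
    · intro x hx hs
      rw [abs_pow]
      refine pow_le_pow_left₀ (abs_nonneg _) ((abs_sub _ _).trans ?_) 2
      linarith [hBu x hx (by linarith [hs.1]) (by linarith [hs.2])]
  have iPA := iP A cA le_rfl (by linarith)
  have iPB := iP B cB (by linarith) le_rfl
  have iEA := h.EE_int (S := Ioo A (A + 1)) measurableSet_Ioo Ioo_subset_Icc_self
  have iEB := h.EE_int (S := Ioo B (B + 1)) measurableSet_Ioo Ioo_subset_Icc_self
  have iEM := h.EE_int (S := Icc (A + 1) B) measurableSet_Icc Subset.rfl
  obtain ⟨jA, vA⟩ := h.fn.vol_eI hT hA (by linarith : A ≤ A + 1) (S := Ioo A (A + 1)) measurableSet_Ioo Ioo_subset_Icc_self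
  obtain ⟨jB, vB⟩ := h.fn.vol_eI hT (by linarith : Tc - 1 ≤ B) (by linarith : B ≤ B + 1) (S := Ioo B (B + 1)) measurableSet_Ioo Ioo_subset_Icc_self
  obtain ⟨jM, vM⟩ := h.fn.vol_eI hT hA (by linarith : A ≤ B + 1) (S := Icc A (B + 1)) measurableSet_Icc Subset.rfl
  set g : (Fin 3 → ℝ) → ℝ := fun x => ∑ j, grad3 u x j ^ 2 with hg
  set w2 : (Fin 3 → ℝ) → ℝ := fun x => grad3 u x 2 - Fv (m₀ / π) f x 2 with hw2
  -- pointwise inequality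
  have key : ∀ x ∈ Ω, 1 / 2 * (eI (Icc (A + 1) B) x * g x) ≤
      ((∑ j, (grad3 u x j - Fv (m₀ / π) f x j) * grad3 ψ x j) - cA * (sd (x 2 - A) * w2 x) + cB * (sd (x 2 - B) * w2 x))
      + 1 / 2 * Φ * eI (Icc A (B + 1)) x
      + L * (1 / 2 * (eI (Ioo A (A + 1)) x * (u x - cA) ^ 2) + eI (Ioo A (A + 1)) x * g x + Φ * eI (Ioo A (A + 1)) x)
      + L * (1 / 2 * (eI (Ioo B (B + 1)) x * (u x - cB) ^ 2) + eI (Ioo B (B + 1)) x * g x + Φ * eI (Ioo B (B + 1)) x) := by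
    intro x hx
    have hg0 : 0 ≤ g x := Finset.sum_nonneg fun _ _ => sq_nonneg _
    have hs : ∀ s, |sd (x 2 - s)| ≤ L * eI (Ioo s (s + 1)) x := by
      intro s
      by_cases h2 : x 2 ∈ Ioo s (s + 1)
      · rw [eI_mem h2, mul_one]; exact hsd _
      · rw [eI_not h2, mul_zero, sd_zero, abs_zero]
        intro hc; exact h2 ⟨by linarith [hc.1], by linarith [hc.2]⟩
    set F := Fv (m₀ / π) f x with hF
    have hsum : ∑ j, (grad3 u x j - F j) * grad3 ψ x j = η (x 2) * (g x - ∑ j, F j * grad3 u x j) + ηd (x 2) * u x * w2 x := by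
      simp only [hψg x hx, hg, hw2, Fin.sum_univ_three]
      simp; ring
    by_cases hxA : x 2 < A ∨ B + 1 < x 2
    · have n1 : x 2 ∉ Icc (A + 1) B := fun hc => by rcases hxA with hxA | hxA <;> linarith [hc.1, hc.2]
      have n2 : x 2 ∉ Icc A (B + 1) := fun hc => by rcases hxA with hxA | hxA <;> linarith [hc.1, hc.2]
      have n3 : x 2 ∉ Ioo A (A + 1) := fun hc => by rcases hxA with hxA | hxA <;> linarith [hc.1, hc.2]
      have n4 : x 2 ∉ Ioo B (B + 1) := fun hc => by rcases hxA with hxA | hxA <;> linarith [hc.1, hc.2]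
      have sA := hs A
      have sB := hs B
      rw [eI_not n3, mul_zero] at sA
      rw [eI_not n4, mul_zero] at sB
      have sA' := abs_nonpos_iff.1 sA
      have sB' := abs_nonpos_iff.1 sB
      rw [hsum, hηz _ hxA, hηdz _ hxA, eI_not n1, eI_not n2, eI_not n3, eI_not n4, sA', sB']
      simp
    · push Not at hxA
      have hΦx := hΦ x hx hxA.1
      rw [← hF] at hΦx
      have hFF : ∑ j, F j * grad3 u x j ≤ 1 / 2 * g x + 1 / 2 * Φ := by
        have : ∑ j, F j * grad3 u x j ≤ ∑ j, (1 / 2 * grad3 u x j ^ 2 + 1 / 2 * F j ^ 2) :=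
          Finset.sum_le_sum fun j _ => by nlinarith [sq_nonneg (F j - grad3 u x j)]
        rw [Finset.sum_add_distrib, ← Finset.mul_sum, ← Finset.mul_sum] at this
        linarith
      have hw : w2 x ^ 2 ≤ 2 * g x + 2 * Φ := by
        have a1 : grad3 u x 2 ^ 2 ≤ g x := Finset.single_le_sum (f := fun j => grad3 u x j ^ 2) (fun j _ => sq_nonneg _) (Finset.mem_univ 2)
        have a2 : F 2 ^ 2 ≤ ∑ j, F j ^ 2 := Finset.single_le_sum (f := fun j => F j ^ 2) (fun j _ => sq_nonneg _) (Finset.mem_univ 2)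
        have a3 : w2 x ^ 2 ≤ 2 * grad3 u x 2 ^ 2 + 2 * F 2 ^ 2 := by
          simp only [hw2]; nlinarith [sq_nonneg (grad3 u x 2 + F 2)]
        linarith
      have pA := (abs_le.1 (pw_aux (v := u x - cA) (hs A) hw)).1
      have pB := (abs_le.1 (pw_aux (v := u x - cB) (hs B) hw)).2
      have n2 : x 2 ∈ Icc A (B + 1) := hxA
      rw [hsum, eI_mem n2]
      have mid : 1 / 2 * (eI (Icc (A + 1) B) x * g x) ≤ η (x 2) * (g x - ∑ j, F j * grad3 u x j) + 1 / 2 * Φ := by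
        have b1 : η (x 2) * (1 / 2 * g x - 1 / 2 * Φ) ≤ η (x 2) * (g x - ∑ j, F j * grad3 u x j) :=
          mul_le_mul_of_nonneg_left (by linarith) (hη0 _)
        have b2 : η (x 2) * Φ ≤ Φ := mul_le_of_le_one_left hΦ0 (hη1 _)
        have b3 : eI (Icc (A + 1) B) x * g x ≤ η (x 2) * g x := by
          refine mul_le_mul_of_nonneg_right ?_ hg0
          by_cases h2 : x 2 ∈ Icc (A + 1) B
          · rw [eI_mem h2, hηm _ h2]
          · rw [eI_not h2]; exact hη0 _
        have b4 : η (x 2) * (1 / 2 * g x - 1 / 2 * Φ) = 1 / 2 * (η (x 2) * g x) - 1 / 2 * (η (x 2) * Φ) := by ring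
        linarith
      have dd : ηd (x 2) * u x * w2 x = sd (x 2 - A) * (u x - cA) * w2 x - sd (x 2 - B) * (u x - cB) * w2 x
          + cA * (sd (x 2 - A) * w2 x) - cB * (sd (x 2 - B) * w2 x) := by simp only [hηd]; ring
      linarith
  set W : (Fin 3 → ℝ) → ℝ := fun x => ∑ j, (grad3 u x j - Fv (m₀ / π) f x j) * grad3 ψ x j with hW
  have iW1 : IntegrableOn (fun x => W x - cA * (sd (x 2 - A) * w2 x)) Ω := iw.sub (iA.const_mul cA)
  have iW : IntegrableOn (fun x => W x - cA * (sd (x 2 - A) * w2 x) + cB * (sd (x 2 - B) * w2 x)) Ω := iW1.add (iB.const_mul cB)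
  have iR1 : IntegrableOn (fun x => (W x - cA * (sd (x 2 - A) * w2 x) + cB * (sd (x 2 - B) * w2 x))
      + 1 / 2 * Φ * eI (Icc A (B + 1)) x) Ω := iW.add (jM.const_mul (1 / 2 * Φ))
  have J3 : ∀ s c : ℝ, IntegrableOn (fun x => eI (Ioo s (s + 1)) x * (u x - c) ^ 2) Ω →
      IntegrableOn (fun x => eI (Ioo s (s + 1)) x * g x) Ω → IntegrableOn (eI (Ioo s (s + 1))) Ω →
      IntegrableOn (fun x => L * (1 / 2 * (eI (Ioo s (s + 1)) x * (u x - c) ^ 2) + eI (Ioo s (s + 1)) x * g x + Φ * eI (Ioo s (s + 1)) x)) Ω ∧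
      ∫ x in Ω, L * (1 / 2 * (eI (Ioo s (s + 1)) x * (u x - c) ^ 2) + eI (Ioo s (s + 1)) x * g x + Φ * eI (Ioo s (s + 1)) x)
      = L * (1 / 2 * (∫ x in Ω, eI (Ioo s (s + 1)) x * (u x - c) ^ 2) + (∫ x in Ω, eI (Ioo s (s + 1)) x * g x)
        + Φ * ∫ x in Ω, eI (Ioo s (s + 1)) x) := by
    intro s c k1 k2 k3
    have k12 : IntegrableOn (fun x => 1 / 2 * (eI (Ioo s (s + 1)) x * (u x - c) ^ 2) + eI (Ioo s (s + 1)) x * g x) Ω :=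
      (k1.const_mul _).add k2
    have k3' : IntegrableOn (fun x => Φ * eI (Ioo s (s + 1)) x) Ω := k3.const_mul _
    have k1' : IntegrableOn (fun x => 1 / 2 * (eI (Ioo s (s + 1)) x * (u x - c) ^ 2)) Ω := k1.const_mul _
    refine ⟨(k12.add k3').const_mul L, ?_⟩
    rw [integral_const_mul, integral_add k12 k3', integral_add k1' k2, integral_const_mul, integral_const_mul]
  obtain ⟨jA3, q1⟩ := J3 A cA iPA iEA jA
  obtain ⟨jB3, q2⟩ := J3 B cB iPB iEB jB
  have iR2 : IntegrableOn (fun x => (W x - cA * (sd (x 2 - A) * w2 x) + cB * (sd (x 2 - B) * w2 x))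
      + 1 / 2 * Φ * eI (Icc A (B + 1)) x
      + L * (1 / 2 * (eI (Ioo A (A + 1)) x * (u x - cA) ^ 2) + eI (Ioo A (A + 1)) x * g x + Φ * eI (Ioo A (A + 1)) x)) Ω :=
    iR1.add jA3
  have iR3 : IntegrableOn (fun x => (W x - cA * (sd (x 2 - A) * w2 x) + cB * (sd (x 2 - B) * w2 x))
      + 1 / 2 * Φ * eI (Icc A (B + 1)) x
      + L * (1 / 2 * (eI (Ioo A (A + 1)) x * (u x - cA) ^ 2) + eI (Ioo A (A + 1)) x * g x + Φ * eI (Ioo A (A + 1)) x)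
      + L * (1 / 2 * (eI (Ioo B (B + 1)) x * (u x - cB) ^ 2) + eI (Ioo B (B + 1)) x * g x + Φ * eI (Ioo B (B + 1)) x)) Ω :=
    iR2.add jB3
  have mono2 := setIntegral_mono_on (iEM.const_mul (1 / 2)) iR3 h.fn.meas_noz key
  rw [integral_const_mul, integral_add iR2 jB3, integral_add iR1 jA3, integral_add iW (jM.const_mul _),
    integral_add iW1 (iB.const_mul cB), integral_sub iw (iA.const_mul cA), q1, q2, integral_const_mul, integral_const_mul,
    integral_const_mul, ew, eA, eB] at mono2
  have v1 : Φ * ∫ x in Ω, eI (Ioo A (A + 1)) x ≤ Φ * 5 := mul_le_mul_of_nonneg_left (by linarith) hΦ0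
  have v2 : Φ * ∫ x in Ω, eI (Ioo B (B + 1)) x ≤ Φ * 5 := mul_le_mul_of_nonneg_left (by linarith) hΦ0
  have v3 : 1 / 2 * Φ * ∫ x in Ω, eI (Icc A (B + 1)) x ≤ 1 / 2 * Φ * (5 * (B + 1 - A)) :=
    mul_le_mul_of_nonneg_left vM (by positivity)
  have z1 : L * (1 / 2 * (∫ x in Ω, eI (Ioo A (A + 1)) x * (u x - cA) ^ 2) + (∫ x in Ω, eI (Ioo A (A + 1)) x * g x)
        + Φ * ∫ x in Ω, eI (Ioo A (A + 1)) x) ≤ L * (673 * EE K m₀ f φ (Ioo A (A + 1)) + 5 * Φ) := by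
    refine mul_le_mul_of_nonneg_left ?_ hL.le
    have : ∫ x in Ω, eI (Ioo A (A + 1)) x * g x = EE K m₀ f φ (Ioo A (A + 1)) := rfl
    linarith
  have z2 : L * (1 / 2 * (∫ x in Ω, eI (Ioo B (B + 1)) x * (u x - cB) ^ 2) + (∫ x in Ω, eI (Ioo B (B + 1)) x * g x)
        + Φ * ∫ x in Ω, eI (Ioo B (B + 1)) x) ≤ L * (673 * EE K m₀ f φ (Ioo B (B + 1)) + 5 * Φ) := by
    refine mul_le_mul_of_nonneg_left ?_ hL.le
    have : ∫ x in Ω, eI (Ioo B (B + 1)) x * g x = EE K m₀ f φ (Ioo B (B + 1)) := rfl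
    linarith
  have z0 : ∫ x in Ω, eI (Icc (A + 1) B) x * g x = EE K m₀ f φ (Icc (A + 1) B) := rfl
  rw [z0] at mono2
  linarith

end SP
end

section
lemma half_rpow {T : ℝ} (hT : 0 < T) (a : ℝ) : (T / 2) ^ (-a) = 2 ^ a * T ^ (-a) := by
  rw [Real.div_rpow hT.le (by norm_num), Real.rpow_neg (by norm_num : (0:ℝ) ≤ 2) a, div_inv_eq_mul, mul_comm]

lemma exp_decay {θ b : ℝ} (h0 : 0 < θ) (h1 : θ < 1) (hb : 0 ≤ b) :
    ∃ D > 0, ∀ N : ℕ, 1 ≤ N → (N : ℝ) * θ ^ N ≤ D * (2 * (N : ℝ)) ^ (-b) := by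
  obtain ⟨p, hp⟩ := exists_nat_ge b
  have ht := tendsto_pow_const_mul_const_pow_of_abs_lt_one (p + 1) (r := θ) (by rwa [abs_of_pos h0])
  obtain ⟨D, hD⟩ := ht.bddAbove_range
  have hD' : ∀ n : ℕ, (n : ℝ) ^ (p + 1) * θ ^ n ≤ D := fun n => hD ⟨n, rfl⟩
  refine ⟨2 ^ p * max D 1, by positivity, fun N hN => ?_⟩
  have hN' : (1 : ℝ) ≤ N := by exact_mod_cast hN
  have h2 : (2 * (N : ℝ)) ^ b ≤ (2 * (N : ℝ)) ^ p := by
    rw [← Real.rpow_natCast]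
    exact Real.rpow_le_rpow_of_exponent_le (by linarith) hp
  rw [Real.rpow_neg (by positivity), ← div_eq_mul_inv, le_div_iff₀ (by positivity)]
  calc (N : ℝ) * θ ^ N * (2 * N) ^ b ≤ N * θ ^ N * (2 * (N : ℝ)) ^ p := by gcongr
    _ = 2 ^ p * ((N : ℝ) ^ (p + 1) * θ ^ N) := by rw [mul_pow]; ring
    _ ≤ 2 ^ p * max D 1 := by gcongr; exact (hD' N).trans (le_max_left _ _)

lemma seq_iter {E : ℕ → ℝ} {Q Φ : ℝ} (hQ : 0 < Q) (n : ℕ)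
    (hE : ∀ k < n, E k ≤ Q * (E (k + 1) - E k) + Q * Φ * ((k : ℝ) + 1)) (hΦ : 0 ≤ Φ) :
    ∀ j ≤ n, E (n - j) ≤ Q * Φ * ((n - j : ℕ) : ℝ) + Q * Φ * (1 + Q) + (Q / (1 + Q)) ^ j * (E n - (Q * Φ * n + Q * Φ * (1 + Q))) := by
  intro j
  induction j with
  | zero => intro _; simp
  | succ j ih =>
    intro hj
    have h1 := ih (by omega)
    have h2 := hE (n - (j + 1)) (by omega)
    have h3 : n - (j + 1) + 1 = n - j := by omega
    have h4 : ((n - (j + 1) : ℕ) : ℝ) + 1 = ((n - j : ℕ) : ℝ) := by exact_mod_cast h3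
    rw [h3, h4] at h2
    rw [show ((n - (j + 1) : ℕ) : ℝ) = ((n - j : ℕ) : ℝ) - 1 by linarith]
    set k := ((n - j : ℕ) : ℝ)
    set R := E n - (Q * Φ * n + Q * Φ * (1 + Q))
    have hQ1 : 0 < 1 + Q := by linarith
    have h5 : E (n - (j + 1)) ≤ Q / (1 + Q) * (E (n - j) + Φ * k) := by
      rw [div_mul_eq_mul_div, le_div_iff₀ hQ1]; linarith
    refine h5.trans ?_
    have h6 : Q / (1 + Q) * (E (n - j) + Φ * k) ≤ Q / (1 + Q) * ((Q * Φ * k + Q * Φ * (1 + Q) + (Q / (1 + Q)) ^ j * R) + Φ * k) := by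
      refine mul_le_mul_of_nonneg_left (by linarith) (by positivity)
    refine h6.trans (le_of_eq ?_)
    rw [pow_succ]
    field_simp
    ring

namespace SP
variable {K a C₀ m₀ M : ℝ} {f : ℝ → ℝ → ℝ} {φ : (Fin 3 → ℝ) → ℝ}

lemma EE_split (h : SP K a C₀ m₀ M f φ) (s t : ℝ) (hst : s ≤ t) :
    EE K m₀ f φ (Icc s t) + EE K m₀ f φ (Ioo (s - 1) s) + EE K m₀ f φ (Ioo t (t + 1)) ≤ EE K m₀ f φ (Icc (s - 1) (t + 1)) := by
  have i1 := h.EE_int (S := Icc s t) measurableSet_Icc Subset.rfl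
  have i2 := h.EE_int (S := Ioo (s - 1) s) measurableSet_Ioo Ioo_subset_Icc_self
  have i3 := h.EE_int (S := Ioo t (t + 1)) measurableSet_Ioo Ioo_subset_Icc_self
  have i4 := h.EE_int (S := Icc (s - 1) (t + 1)) measurableSet_Icc Subset.rfl
  have i12 : IntegrableOn (fun x => eI (Icc s t) x * ∑ j, grad3 (uu m₀ φ) x j ^ 2 + eI (Ioo (s - 1) s) x * ∑ j, grad3 (uu m₀ φ) x j ^ 2) (nozzleFrom f K) := i1.add i2
  unfold EE
  rw [← integral_add i1 i2, ← integral_add i12 i3]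
  refine setIntegral_mono_on (i12.add i3) i4 h.fn.meas_noz fun x _ => ?_
  have hg0 : 0 ≤ ∑ j, grad3 (uu m₀ φ) x j ^ 2 := Finset.sum_nonneg fun _ _ => sq_nonneg _
  rw [← add_mul, ← add_mul]
  refine mul_le_mul_of_nonneg_right ?_ hg0
  by_cases h1 : x 2 ∈ Icc s t
  · rw [eI_mem h1, eI_not (fun hc => by linarith [hc.2, h1.1]), eI_not (fun hc => by linarith [hc.1, h1.2]),
      eI_mem (show x 2 ∈ Icc (s - 1) (t + 1) from ⟨by linarith [h1.1], by linarith [h1.2]⟩)]; norm_num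
  · by_cases h2 : x 2 ∈ Ioo (s - 1) s
    · rw [eI_not h1, eI_mem h2, eI_not (fun hc => by linarith [hc.1, h2.2]),
        eI_mem (show x 2 ∈ Icc (s - 1) (t + 1) from ⟨by linarith [h2.1], by linarith [h2.2]⟩)]; norm_num
    · by_cases h3 : x 2 ∈ Ioo t (t + 1)
      · rw [eI_not h1, eI_not h2, eI_mem h3, eI_mem (show x 2 ∈ Icc (s - 1) (t + 1) from ⟨by linarith [h3.1], by linarith [h3.2]⟩)]; norm_num
      · rw [eI_not h1, eI_not h2, eI_not h3]; simpa using eI_nonneg _ _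

lemma EE_le (h : SP K a C₀ m₀ M f φ) {Tc : ℝ} (hT : NR K a C₀ Tc) {s t : ℝ} (hs : Tc - 1 ≤ s) (hst : s ≤ t) :
    EE K m₀ f φ (Icc s t) ≤ 3 * (M + |m₀ / π|) ^ 2 * (5 * (t - s)) := by
  obtain ⟨j, v⟩ := h.fn.vol_eI hT hs hst (S := Icc s t) measurableSet_Icc Subset.rfl
  have i1 := h.EE_int (S := Icc s t) measurableSet_Icc Subset.rfl
  calc EE K m₀ f φ (Icc s t) ≤ ∫ x in nozzleFrom f K, 3 * (M + |m₀ / π|) ^ 2 * eI (Icc s t) x := by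
        refine setIntegral_mono_on i1 (j.const_mul _) h.fn.meas_noz fun x hx => ?_
        rw [mul_comm]
        exact mul_le_mul_of_nonneg_right ((le_abs_self _).trans (h.g_bd hx)) (eI_nonneg _ _)
    _ = 3 * (M + |m₀ / π|) ^ 2 * ∫ x in nozzleFrom f K, eI (Icc s t) x := integral_const_mul _ _
    _ ≤ _ := mul_le_mul_of_nonneg_left v (by positivity)

lemma energy_step (h : SP K a C₀ m₀ M f φ) {Tc : ℝ} (hT : NR K a C₀ Tc) {L : ℝ} (hL : 0 < L) (hsd : ∀ t, |sd t| ≤ L)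
    {T Φ : ℝ} {k : ℕ} (hk : Tc ≤ T - k)
    (hΦ : ∀ x ∈ nozzleFrom f K, T - k - 1 ≤ x 2 → ∑ j, Fv (m₀ / π) f x j ^ 2 ≤ Φ) (hΦ0 : 0 ≤ Φ) :
    EE K m₀ f φ (Icc (T - k) (T + k)) ≤ (1366 * L + 10) * (EE K m₀ f φ (Icc (T - (k + 1 : ℕ)) (T + (k + 1 : ℕ))) -
      EE K m₀ f φ (Icc (T - k) (T + k))) + (1366 * L + 10) * Φ * ((k : ℝ) + 1) := by
  have hk0 : (0 : ℝ) ≤ k := Nat.cast_nonneg k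
  have h1 := h.energy hT hL hsd (A := T - k - 1) (B := T + k) (by linarith) (by linarith) hΦ hΦ0
  have h2 := h.EE_split (T - k) (T + k) (by linarith)
  rw [show T - (k : ℝ) - 1 + 1 = T - k by ring] at h1
  rw [show T - ((k + 1 : ℕ) : ℝ) = T - k - 1 by push_cast; ring, show T + ((k + 1 : ℕ) : ℝ) = T + k + 1 by push_cast; ring]
  have eA : 0 ≤ EE K m₀ f φ (Ioo (T - k - 1) (T - k)) :=
    integral_nonneg fun x => mul_nonneg (eI_nonneg _ _) (Finset.sum_nonneg fun _ _ => sq_nonneg _)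
  have eB : 0 ≤ EE K m₀ f φ (Ioo (T + k) (T + k + 1)) :=
    integral_nonneg fun x => mul_nonneg (eI_nonneg _ _) (Finset.sum_nonneg fun _ _ => sq_nonneg _)
  set E0 := EE K m₀ f φ (Icc (T - k) (T + k))
  set E1 := EE K m₀ f φ (Icc (T - k - 1) (T + k + 1))
  set EA := EE K m₀ f φ (Ioo (T - k - 1) (T - k))
  set EB := EE K m₀ f φ (Ioo (T + k) (T + k + 1))
  have h3 : L * (EA + EB) ≤ L * (E1 - E0) := mul_le_mul_of_nonneg_left (by linarith) hL.le
  have h4 : 0 ≤ L * Φ * k := by positivity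
  have h5 : 0 ≤ L * Φ := by positivity
  have h6 : 0 ≤ Φ * k := by positivity
  have h7 : 0 ≤ L * (E1 - E0) := mul_nonneg hL.le (by linarith)
  have h8 : (1366 * L + 10) * (E1 - E0) = 1366 * (L * (E1 - E0)) + 10 * (E1 - E0) := by ring
  have h9 : (1366 * L + 10) * Φ * ((k : ℝ) + 1) = 1366 * (L * Φ * k) + 10 * (Φ * k) + 1366 * (L * Φ) + 10 * Φ := by ring
  rw [h8, h9]
  linarith

end SP

/-- decay of the local energy -/
lemma SP.EE_dec (K a C₀ m₀ M : ℝ) (ha : 0 < a) (hC1 : 1 ≤ C₀) (hM : 0 < M) : ∃ C > 0, ∃ T0, 4 ≤ T0 ∧ NR K a C₀ T0 ∧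
    ∀ (f : ℝ → ℝ → ℝ) (φ : (Fin 3 → ℝ) → ℝ), SP K a C₀ m₀ M f φ → ∀ T, T0 ≤ T →
      EE K m₀ f φ (Icc (T - 1) (T + 1)) ≤ C * (T ^ (-a)) ^ 2 := by
  obtain ⟨Tc, hT⟩ := exists_NR K a C₀ ha
  obtain ⟨L, hL, hsd⟩ := sd_bd
  set Q := 1366 * L + 10 with hQ
  have hQ0 : 0 < Q := by positivity
  set θ := Q / (1 + Q) with hθ
  have hθ0 : 0 < θ := by positivity
  have hθ1 : θ < 1 := by rw [hθ, div_lt_one (by positivity)]; linarith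
  obtain ⟨D, hD, hdec⟩ := exp_decay hθ0 hθ1 (b := 2 * a) (by positivity)
  set P := 3 * (2 * |m₀ / π| * C₀ ^ 5) ^ 2 * (2 ^ a) ^ 2 with hP
  have hP0 : 0 ≤ P := by positivity
  set M' := 3 * (M + |m₀ / π|) ^ 2 * 10 with hM'
  have hM'0 : 0 < M' := by positivity
  refine ⟨Q * P + Q * P * (1 + Q) + M' * (θ ^ 2)⁻¹ * D, by positivity, max (max 4 Tc) (2 * Tc), (le_max_left _ _).trans (le_max_left _ _), ?_, ?_⟩
  · have hh : Tc ≤ max (max 4 Tc) (2 * Tc) := (le_max_right _ _).trans (le_max_left _ _)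
    exact ⟨hT.1.trans hh, fun t ht => hT.2 t (by linarith)⟩
  intro f φ h T hT0
  have hT4 : 4 ≤ T := ((le_max_left _ _).trans (le_max_left _ _)).trans hT0
  have hT2 : 2 * Tc ≤ T := (le_max_right _ _).trans hT0
  set n := ⌊T / 2⌋₊ with hn
  have hn1 : (n : ℝ) ≤ T / 2 := Nat.floor_le (by linarith)
  have hn2 : T / 2 < n + 1 := Nat.lt_floor_add_one _
  have hn3 : 2 ≤ n := Nat.le_floor (by push_cast; linarith)
  set Φ := P * (T ^ (-a)) ^ 2 with hΦ
  have hΦ0 : 0 ≤ Φ := by positivity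
  have hTp : 0 < T := by linarith
  have hF : ∀ x ∈ nozzleFrom f K, T / 2 ≤ x 2 → ∑ j, Fv (m₀ / π) f x j ^ 2 ≤ Φ := by
    intro x hx hx2
    have h1 : ∀ j : Fin 3, Fv (m₀ / π) f x j ^ 2 ≤ (2 * |m₀ / π| * C₀ ^ 5 * (2 ^ a * T ^ (-a))) ^ 2 := by
      intro j
      rw [← sq_abs, ← half_rpow hTp]
      refine pow_le_pow_left₀ (abs_nonneg _) ((h.fn.Fv_bd _ hx j).trans ?_) 2
      refine mul_le_mul_of_nonneg_left ?_ (by positivity)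
      exact Real.rpow_le_rpow_of_nonpos (by linarith) hx2 (by linarith)
    refine (Finset.sum_le_sum fun j _ => h1 j).trans (le_of_eq ?_)
    simp only [Finset.sum_const, Finset.card_univ, Fintype.card_fin, nsmul_eq_mul, hΦ, hP]
    push_cast; ring
  set E : ℕ → ℝ := fun k => EE K m₀ f φ (Icc (T - k) (T + k)) with hE
  have hstep : ∀ k < n, E k ≤ Q * (E (k + 1) - E k) + Q * Φ * ((k : ℝ) + 1) := by
    intro k hk
    have hk' : (k : ℝ) + 1 ≤ n := by exact_mod_cast hk
    exact h.energy_step hT hL hsd (by linarith) (fun x hx hx2 => hF x hx (by linarith)) hΦ0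
  have hit := seq_iter hQ0 n hstep hΦ0 (n - 1) (by omega)
  rw [show n - (n - 1) = 1 by omega] at hit
  have hEn : E n ≤ M' * n := by
    have := h.EE_le hT (s := T - n) (t := T + n) (by linarith) (by linarith [(Nat.cast_nonneg n : (0:ℝ) ≤ n)])
    refine this.trans (le_of_eq ?_)
    rw [hM']; ring
  have hθn : θ ^ (n - 1) * (n : ℝ) ≤ (θ ^ 2)⁻¹ * D * (T ^ (-a)) ^ 2 := by
    have h1 := hdec (n + 1) (by omega)
    have h2 : (2 * ((n + 1 : ℕ) : ℝ)) ^ (-(2 * a)) ≤ (T ^ (-a)) ^ 2 := by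
      rw [← Real.rpow_natCast, ← Real.rpow_mul hTp.le, show -a * ((2 : ℕ) : ℝ) = -(2 * a) by push_cast; ring]
      exact Real.rpow_le_rpow_of_nonpos hTp (by push_cast; linarith) (by linarith)
    have h3 : θ ^ (n + 1) = θ ^ (n - 1) * θ ^ 2 := by rw [← pow_add]; congr 1; omega
    have h4 : θ ^ (n - 1) * (n : ℝ) * θ ^ 2 ≤ D * (T ^ (-a)) ^ 2 := by
      calc θ ^ (n - 1) * (n : ℝ) * θ ^ 2 = n * θ ^ (n + 1) := by rw [h3]; ring
        _ ≤ ((n + 1 : ℕ) : ℝ) * θ ^ (n + 1) := by gcongr; linarith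
        _ ≤ _ := h1
        _ ≤ _ := by gcongr
    rw [mul_assoc, inv_mul_eq_div, le_div_iff₀ (by positivity)]
    exact h4
  have hE1 : E 1 = EE K m₀ f φ (Icc (T - 1) (T + 1)) := by simp [hE]
  rw [← hE1]
  have hb : θ ^ (n - 1) * (E n - (Q * Φ * n + Q * Φ * (1 + Q))) ≤ θ ^ (n - 1) * (M' * n) := by
    refine mul_le_mul_of_nonneg_left ?_ (by positivity)
    have : 0 ≤ Q * Φ * n + Q * Φ * (1 + Q) := by positivity
    linarith
  have hb2 : θ ^ (n - 1) * (M' * n) ≤ M' * ((θ ^ 2)⁻¹ * D * (T ^ (-a)) ^ 2) := by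
    calc θ ^ (n - 1) * (M' * n) = M' * (θ ^ (n - 1) * n) := by ring
      _ ≤ _ := mul_le_mul_of_nonneg_left hθn hM'0.le
  calc E 1 ≤ Q * Φ * ((1 : ℕ) : ℝ) + Q * Φ * (1 + Q) + θ ^ (n - 1) * (E n - (Q * Φ * n + Q * Φ * (1 + Q))) := hit
    _ ≤ Q * Φ * ((1 : ℕ) : ℝ) + Q * Φ * (1 + Q) + M' * ((θ ^ 2)⁻¹ * D * (T ^ (-a)) ^ 2) := by linarith
    _ = _ := by rw [hΦ]; push_cast; ring

/-- decay of the local `L¹` norm -/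
lemma SP.II_dec (K a C₀ m₀ M : ℝ) (ha : 0 < a) (hC1 : 1 ≤ C₀) (hM : 0 < M) : ∃ C > 0, ∃ T0, 4 ≤ T0 ∧ NR K a C₀ T0 ∧
    ∀ (f : ℝ → ℝ → ℝ) (φ : (Fin 3 → ℝ) → ℝ), SP K a C₀ m₀ M f φ → ∀ T, T0 ≤ T →
      II K m₀ f φ T ≤ C * T ^ (-a) := by
  obtain ⟨C, hC, T0, h4, hNR, hE⟩ := SP.EE_dec K a C₀ m₀ M ha hC1 hM
  refine ⟨C + 8, by positivity, T0, h4, hNR, fun f φ h T hT => ?_⟩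
  have hTp : 0 < T := by linarith
  have hEE := hE f φ h T hT
  set l := T ^ (-a) with hl
  have hl0 : 0 < l := by positivity
  obtain ⟨j, v⟩ := h.fn.vol_eI hNR (by linarith : T0 - 1 ≤ T - 1) (by linarith : T - 1 ≤ T + 1) (S := Icc (T - 1) (T + 1)) measurableSet_Icc Subset.rfl
  have i1 := h.EE_int (S := Icc (T - 1) (T + 1)) measurableSet_Icc Subset.rfl
  have i2 : IntegrableOn (fun x => l⁻¹ * (eI (Icc (T - 1) (T + 1)) x * ∑ j, grad3 (uu m₀ φ) x j ^ 2) + 3 / 4 * l * eI (Icc (T - 1) (T + 1)) x) (nozzleFrom f K) :=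
    (i1.const_mul _).add (j.const_mul _)
  have i3 : IntegrableOn (fun x => eI (Icc (T - 1) (T + 1)) x * ∑ j, |grad3 (uu m₀ φ) x j|) (nozzleFrom f K) := by
    refine h.fn.int_S measurableSet_Icc Subset.rfl (B := 3 * (M + |m₀ / π|)) (by positivity)
      (Finset.measurable_sum _ fun j _ => (continuous_abs.measurable.comp (grad_meas _ j))).aestronglyMeasurable (fun x hx _ => ?_)
    rw [abs_of_nonneg (Finset.sum_nonneg fun _ _ => abs_nonneg _)]
    have : ∑ j : Fin 3, |grad3 (uu m₀ φ) x j| ≤ ∑ _j : Fin 3, (M + |m₀ / π|) := Finset.sum_le_sum fun j _ => h.u_bd hx j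
    refine this.trans (le_of_eq ?_)
    rw [Finset.sum_const, Finset.card_univ, Fintype.card_fin, nsmul_eq_mul]; norm_num
  have e1 : II K m₀ f φ T = ∫ x in nozzleFrom f K, eI (Icc (T - 1) (T + 1)) x * ∑ j, |grad3 (uu m₀ φ) x j| := by
    unfold II
    rw [← setIntegral_indicator (meas_slab1 T)]
    refine setIntegral_congr_fun h.fn.meas_noz fun x _ => ?_
    by_cases h2 : x 2 ∈ Icc (T - 1) (T + 1)
    · have h3 : x ∈ {y : Fin 3 → ℝ | |y 2 - T| ≤ 1} := by
        rw [mem_ofPred_eq]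
        exact abs_le.2 ⟨by linarith [h2.1], by linarith [h2.2]⟩
      simp only [eI_mem h2, one_mul, indicator_of_mem h3]
    · have h3 : x ∉ {y : Fin 3 → ℝ | |y 2 - T| ≤ 1} := fun hc => by
        rw [mem_ofPred_eq] at hc
        have := abs_le.1 hc
        exact h2 ⟨by linarith [this.1], by linarith [this.2]⟩
      simp only [eI_not h2, zero_mul, indicator_of_notMem h3]
  have m1 : ∫ x in nozzleFrom f K, eI (Icc (T - 1) (T + 1)) x * ∑ j, |grad3 (uu m₀ φ) x j| ≤
      ∫ x in nozzleFrom f K, (l⁻¹ * (eI (Icc (T - 1) (T + 1)) x * ∑ j, grad3 (uu m₀ φ) x j ^ 2) + 3 / 4 * l * eI (Icc (T - 1) (T + 1)) x) := by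
    refine setIntegral_mono_on i3 i2 h.fn.meas_noz fun x _ => ?_
    have q : ∀ v : ℝ, |v| ≤ l⁻¹ * v ^ 2 + 1 / 4 * l := by
      intro v
      have : l⁻¹ * (|v| - l / 2) ^ 2 = l⁻¹ * v ^ 2 + 1 / 4 * l - |v| := by
        rw [← sq_abs v]; field_simp; ring
      have h0 : 0 ≤ l⁻¹ * (|v| - l / 2) ^ 2 := by positivity
      linarith
    have s1 : ∑ j : Fin 3, |grad3 (uu m₀ φ) x j| ≤ ∑ j : Fin 3, (l⁻¹ * grad3 (uu m₀ φ) x j ^ 2 + 1 / 4 * l) :=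
      Finset.sum_le_sum fun j _ => q _
    rw [Finset.sum_add_distrib, ← Finset.mul_sum] at s1
    simp only [Finset.sum_const, Finset.card_univ, Fintype.card_fin, nsmul_eq_mul] at s1
    push_cast at s1
    have s2 := mul_le_mul_of_nonneg_left s1 (eI_nonneg (Icc (T - 1) (T + 1)) x)
    refine s2.trans (le_of_eq ?_)
    ring
  rw [integral_add (i1.const_mul _) (j.const_mul _), integral_const_mul, integral_const_mul] at m1
  rw [e1]
  have a1 : l⁻¹ * EE K m₀ f φ (Icc (T - 1) (T + 1)) ≤ l⁻¹ * (C * l ^ 2) := mul_le_mul_of_nonneg_left hEE (by positivity)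
  have a2 : l⁻¹ * (C * l ^ 2) = C * l := by field_simp
  have a3 : 3 / 4 * l * ∫ x in nozzleFrom f K, eI (Icc (T - 1) (T + 1)) x ≤ 3 / 4 * l * (5 * (T + 1 - (T - 1))) :=
    mul_le_mul_of_nonneg_left v (by positivity)
  unfold EE at a1
  linarith
end

section
lemma final_iter (K a C₀ m₀ M : ℝ) (ha : 0 < a) (hC1 : 1 ≤ C₀) (hM : 0 < M) : ∃ C > 0, ∃ T1, 4 ≤ T1 ∧
    ∀ (f : ℝ → ℝ → ℝ) (φ : (Fin 3 → ℝ) → ℝ), SP K a C₀ m₀ M f φ → ∀ x ∈ nozzleFrom f K, 2 * T1 ≤ x 2 →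
      ∀ j, |grad3 (uu m₀ φ) x j| ≤ C * x 2 ^ (-a) := by
  obtain ⟨N, hN, hloc⟩ := SP.local_est a C₀ m₀ ha hC1
  obtain ⟨C, hC, T1, h4, hNR, hI⟩ := SP.II_dec K a C₀ m₀ M ha hC1 hM
  obtain ⟨D, hD, hdec⟩ := exp_decay (θ := 1 / 2) (b := a) (by norm_num) (by norm_num) ha.le
  have hC0 : 0 < C₀ := by linarith
  set ε := min ((2 * N)⁻¹) ((100 * C₀ ^ 7)⁻¹) with hε
  have hε0 : 0 < ε := lt_min (by positivity) (by positivity)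
  have hε1 : 100 * C₀ ^ 7 * ε ≤ 1 := by
    calc 100 * C₀ ^ 7 * ε ≤ 100 * C₀ ^ 7 * (100 * C₀ ^ 7)⁻¹ := mul_le_mul_of_nonneg_left (min_le_right _ _) (by positivity)
      _ = 1 := mul_inv_cancel₀ (by positivity)
  have hε2 : N * ε ≤ 1 / 2 := by
    calc N * ε ≤ N * (2 * N)⁻¹ := mul_le_mul_of_nonneg_left (min_le_left _ _) hN.le
      _ = 1 / 2 := by field_simp
  set C' := N * ((ε ^ 3)⁻¹ * C + 1) with hC'
  have hC'0 : 0 < C' := by positivity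
  set M' := M + |m₀ / π| with hM'
  have hM'0 : 0 < M' := by positivity
  refine ⟨M' * (2 * D) + 2 * C' * 2 ^ a, by positivity, T1, h4, fun f φ h x hx hx2 => ?_⟩
  have step : ∀ x ∈ nozzleFrom f K, T1 ≤ x 2 → ∀ S : ℝ,
      (∀ y ∈ nozzleFrom f K, |y 2 - x 2| ≤ 1 → ∀ j, |grad3 (uu m₀ φ) y j| ≤ S) → ∀ j, |grad3 (uu m₀ φ) x j| ≤ S / 2 + C' * x 2 ^ (-a) := by
    intro x hx hxT S hS j
    have hS0 : 0 ≤ S := (abs_nonneg _).trans (hS x hx (by simp) 0)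
    have h1 := hloc K M f φ h T1 hNR x hx hxT S hS ε hε0 hε1 j
    have h2 := hI f φ h (x 2) hxT
    have h3 : (ε ^ 3)⁻¹ * II K m₀ f φ (x 2) ≤ (ε ^ 3)⁻¹ * (C * x 2 ^ (-a)) := mul_le_mul_of_nonneg_left h2 (by positivity)
    have h4 : N * ε * S ≤ 1 / 2 * S := mul_le_mul_of_nonneg_right hε2 hS0
    calc |grad3 (uu m₀ φ) x j| ≤ N * ((ε ^ 3)⁻¹ * II K m₀ f φ (x 2) + ε * S + x 2 ^ (-a)) := h1
      _ ≤ N * ((ε ^ 3)⁻¹ * (C * x 2 ^ (-a)) + ε * S + x 2 ^ (-a)) := mul_le_mul_of_nonneg_left (by linarith) hN.le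
      _ = N * ε * S + C' * x 2 ^ (-a) := by rw [hC']; ring
      _ ≤ _ := by linarith
  have ind : ∀ k : ℕ, ∀ x ∈ nozzleFrom f K, T1 + k ≤ x 2 → ∀ j, |grad3 (uu m₀ φ) x j| ≤ (1 / 2) ^ k * M' + 2 * C' * (x 2 - k) ^ (-a) := by
    intro k
    induction k with
    | zero =>
      intro x hx hxT j
      have h0 : 0 ≤ x 2 - ((0 : ℕ) : ℝ) := by push_cast at hxT ⊢; linarith
      have h1 : 0 ≤ 2 * C' * (x 2 - ((0 : ℕ) : ℝ)) ^ (-a) := mul_nonneg (by positivity) (Real.rpow_nonneg h0 _)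
      have h2 := h.u_bd hx j
      rw [pow_zero, one_mul]
      linarith
    | succ k ih =>
      intro x hx hxT j
      push_cast at hxT
      have hk0 : (0 : ℝ) ≤ k := Nat.cast_nonneg k
      have hp : 0 < x 2 - ((k : ℝ) + 1) := by linarith
      have h1 := step x hx (by linarith) ((1 / 2) ^ k * M' + 2 * C' * (x 2 - ((k : ℝ) + 1)) ^ (-a)) (fun y hy hyx i => by
        have hy2 := (abs_le.1 hyx).1
        refine (ih y hy (by linarith) i).trans ?_
        have : (y 2 - k) ^ (-a) ≤ (x 2 - ((k : ℝ) + 1)) ^ (-a) := Real.rpow_le_rpow_of_nonpos hp (by linarith) (by linarith)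
        have h3 := mul_le_mul_of_nonneg_left this (by positivity : 0 ≤ 2 * C')
        linarith) j
      have h2 : x 2 ^ (-a) ≤ (x 2 - ((k : ℝ) + 1)) ^ (-a) := Real.rpow_le_rpow_of_nonpos hp (by linarith) (by linarith)
      have h3 := mul_le_mul_of_nonneg_left h2 hC'0.le
      push_cast
      rw [pow_succ]
      linarith
  intro j
  have hxp : 0 < x 2 := by linarith
  set n := ⌊x 2 / 2⌋₊ with hn
  have hn1 : (n : ℝ) ≤ x 2 / 2 := Nat.floor_le (by linarith)
  have hn2 : x 2 / 2 < n + 1 := Nat.lt_floor_add_one _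
  have h1 := ind n x hx (by linarith) j
  have h2 : (x 2 - n) ^ (-a) ≤ 2 ^ a * x 2 ^ (-a) := by
    rw [← half_rpow hxp]
    exact Real.rpow_le_rpow_of_nonpos (by linarith) (by linarith) (by linarith)
  have h3 : (1 / 2 : ℝ) ^ n ≤ 2 * D * x 2 ^ (-a) := by
    have e1 := hdec (n + 1) (by omega)
    have e2 : (2 * ((n + 1 : ℕ) : ℝ)) ^ (-a) ≤ x 2 ^ (-a) :=
      Real.rpow_le_rpow_of_nonpos hxp (by push_cast; linarith) (by linarith)
    have e3 := mul_le_mul_of_nonneg_left e2 hD.le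
    have e4 : (1 / 2 : ℝ) ^ (n + 1) ≤ ((n + 1 : ℕ) : ℝ) * (1 / 2) ^ (n + 1) := by
      refine le_mul_of_one_le_left (by positivity) ?_
      push_cast; linarith [(Nat.cast_nonneg n : (0 : ℝ) ≤ n)]
    have e5 : (1 / 2 : ℝ) ^ (n + 1) = (1 / 2) ^ n * (1 / 2) := pow_succ _ _
    linarith
  have h4 := mul_le_mul_of_nonneg_left h3 hM'0.le
  have h5 := mul_le_mul_of_nonneg_left h2 (by positivity : 0 ≤ 2 * C')
  have h6 : (M' * (2 * D) + 2 * C' * 2 ^ a) * x 2 ^ (-a) = M' * (2 * D * x 2 ^ (-a)) + 2 * C' * (2 ^ a * x 2 ^ (-a)) := by ring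
  rw [h6]
  linarith

lemma norm3_le {v : Fin 3 → ℝ} {B : ℝ} (hB : ∀ j, |v j| ≤ B) : norm3 v ≤ 2 * B := by
  have hB0 : 0 ≤ B := (abs_nonneg _).trans (hB 0)
  unfold norm3
  rw [Real.sqrt_le_left (by positivity), Fin.sum_univ_three]
  have h : ∀ j, v j ^ 2 ≤ B ^ 2 := fun j => by rw [← sq_abs]; exact pow_le_pow_left₀ (abs_nonneg _) (hB j) 2
  have h3 : 0 ≤ B ^ 2 := sq_nonneg _
  have h4 : (2 * B) ^ 2 = 4 * B ^ 2 := by ring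
  linarith [h 0, h 1, h 2]

lemma final_all (K a C₀ m₀ M : ℝ) (ha : 0 < a) (hC1 : 1 ≤ C₀) (hM : 0 < M) : ∃ C > 0,
    ∀ (f : ℝ → ℝ → ℝ) (φ : (Fin 3 → ℝ) → ℝ), SP K a C₀ m₀ M f φ → ∀ x ∈ nozzleFrom f K,
      norm3 (grad3 φ x - ![0, 0, m₀ / π]) ≤ C * x 2 ^ (-a) := by
  obtain ⟨C, hC, T1, h4, hb⟩ := final_iter K a C₀ m₀ M ha hC1 hM
  set M' := M + |m₀ / π| with hM'
  have hM'0 : 0 < M' := by positivity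
  refine ⟨2 * (C + M' * (2 * T1) ^ a), by positivity, fun f φ h x hx => ?_⟩
  rw [← h.u_grad hx, mul_assoc]
  refine norm3_le fun j => ?_
  have hxp : 0 < x 2 := by linarith [hx.1, h.fn.K1]
  have hpos : 0 < x 2 ^ (-a) := Real.rpow_pos_of_pos hxp _
  have hT : 0 < (2 * T1) ^ a := Real.rpow_pos_of_pos (by linarith) _
  rw [add_mul]
  by_cases hx2 : 2 * T1 ≤ x 2
  · have h1 := hb f φ h x hx hx2 j
    have : 0 ≤ M' * (2 * T1) ^ a * x 2 ^ (-a) := by positivity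
    linarith
  · push Not at hx2
    have h1 := h.u_bd hx j
    have h2 : 1 ≤ (2 * T1) ^ a * x 2 ^ (-a) := by
      rw [Real.rpow_neg hxp.le, ← div_eq_mul_inv, one_le_div (by positivity)]
      exact Real.rpow_le_rpow hxp.le hx2.le ha.le
    have h3 : M' * 1 ≤ M' * ((2 * T1) ^ a * x 2 ^ (-a)) := mul_le_mul_of_nonneg_left h2 hM'0.le
    have h5 : 0 ≤ C * x 2 ^ (-a) := by positivity
    linarith
end

/-- algebraic convergence rate for incompressible potential flow when the
nozzle boundary converges to the unit cylinder at rate x₃^{−a}: a bounded weak solution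
of Δφ = 0 with slip condition and flux m₀ satisfies |∇φ − (0,0,q₀)| ≤ C x₃^{−a},
q₀ = m₀/π, with C depending only on M, m₀, C₀, a, K. -/
theorem incompressible_algebraic_rate
    (K a C₀ m₀ M : ℝ) (hK : 1 < K) (ha : 0 < a) (hC₀ : 1 ≤ C₀) (hM : 0 < M) :
    ∃ C > (0:ℝ), ∀ (f : ℝ → ℝ → ℝ) (φ : (Fin 3 → ℝ) → ℝ),
      -- f is C² on ℝ × (K,∞) with ‖f‖_{C²} ≤ C₀
      ContDiffOn ℝ 2 (fun p : ℝ × ℝ => f p.1 p.2) {p : ℝ × ℝ | K < p.2} →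
      (∀ p ∈ {p : ℝ × ℝ | K < p.2}, ∀ n : ℕ, n ≤ 2 →
        ‖iteratedFDerivWithin ℝ n (fun p : ℝ × ℝ => f p.1 p.2) {p : ℝ × ℝ | K < p.2} p‖ ≤ C₀) →
      -- 2π-periodicity in τ
      (∀ τ t : ℝ, f (τ + 2 * π) t = f τ t) →
      -- bounds 1/C₀ ≤ f ≤ C₀
      (∀ τ t : ℝ, K < t → 1 / C₀ ≤ f τ t ∧ f τ t ≤ C₀) →
      -- decay of the boundary to the unit cylinder at rate x₃^{−a}
      (∀ τ t : ℝ, K < t →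
        |f τ t - 1| + t * |deriv (fun s => f τ s) t|
          + t ^ 2 * |deriv (deriv (fun s => f τ s)) t| ≤ C₀ * t ^ (-a)) →
      -- φ is C¹ up to the boundary
      ContDiffOn ℝ 1 φ (closure (nozzleFrom f K)) →
      -- weak form of Δφ = 0 with the slip boundary condition
      (∀ ψ : (Fin 3 → ℝ) → ℝ, ContDiff ℝ 1 ψ → HasCompactSupport ψ →
        tsupport ψ ⊆ {x : Fin 3 → ℝ | K < x 2} →
        ∫ x in nozzleFrom f K, ∑ i, grad3 φ x i * grad3 ψ x i = 0) →
      -- mass flux m₀ through each cross-section Σ_t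
      (∀ t : ℝ, K < t →
        ∫ x' in {x' : Fin 2 → ℝ | (Fin.snoc x' t : Fin 3 → ℝ) ∈ nozzleFrom f K},
          grad3 φ (Fin.snoc x' t) 2 = m₀) →
      -- uniform gradient bound
      (∀ x ∈ nozzleFrom f K, norm3 (grad3 φ x) ≤ M) →
      ∀ x ∈ nozzleFrom f K, 2 * K < x 2 →
        norm3 (grad3 φ x - ![0, 0, m₀ / π]) ≤ C * (x 2) ^ (-a) := by
  obtain ⟨C, hC, hb⟩ := final_all K a C₀ m₀ M ha hC₀ hM
  exact ⟨C, hC, fun f φ h1 h2 h3 h4 h5 h6 h7 h8 h9 x hx _ =>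
    hb f φ ⟨⟨hK, ha, hC₀, h1, h2, h3, h4, h5⟩, hM, h6, h7, h8, h9⟩ x hx⟩
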